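/- Fix a prime p. Assume the following (GRH-conditional) counting bound of Li–Pomerance holds for a = p: there is a constant C such that for every odd prime q and every real X ≥ 3, the number of positive integers n ≤ X divisible by some prime r with r ≡ 1 (mod q), p^((r−1)/q) ≡ 1 (mod r), and r ≥ q²(log q)⁴ is at most C·(X/(q log q) + X·log log X/q²). Then there is a constant C' (depending on p) such that for all sufficiently large X, F_p(X) ≤ C'·X·√(log log X / log X). -/

import Mathlib

open Polynomial Filter

/-- `n` is `p`-practical if `x^n - 1` has a divisor in `𝔽_p[x]` of every degree
between `1` and `n`. -/
def IsPPractical (p n : ℕ) : Prop :=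
  ∀ m : ℕ, 1 ≤ m → m ≤ n → ∃ g : Polynomial (ZMod p), g ∣ X ^ n - 1 ∧ g.natDegree = m

namespace PP

noncomputable def W (σ : ℝ) (N : ℕ) : ℝ := ∏ p ∈ Nat.primesBelow N, (1 - (p : ℝ) ^ (-σ))

noncomputable def A (σ : ℝ) (N : ℕ) : ℝ :=
  ∑ p ∈ Nat.primesBelow N, Real.log p / ((p : ℝ) ^ σ - 1)

lemma prime_rpow_neg {σ : ℝ} (hσ : 0 < σ) {p : ℕ} (hp : p.Prime) :
    0 < (p : ℝ) ^ (-σ) ∧ (p : ℝ) ^ (-σ) < 1 := by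
  have h1 : (1 : ℝ) < p := by exact_mod_cast hp.one_lt
  exact ⟨by positivity, Real.rpow_lt_one_of_one_lt_of_neg h1 (by linarith)⟩

lemma prime_rpow {σ : ℝ} (hσ : 0 < σ) {p : ℕ} (hp : p.Prime) : 1 < (p : ℝ) ^ σ := by
  have h1 : (1 : ℝ) < p := by exact_mod_cast hp.one_lt
  exact Real.one_lt_rpow h1 hσ

lemma W_pos {σ : ℝ} (hσ : 0 < σ) (N : ℕ) : 0 < W σ N := by
  apply Finset.prod_pos
  intro p hp
  have := (prime_rpow_neg hσ (Nat.prime_of_mem_primesBelow hp)).2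
  linarith

lemma W_succ_prime (σ : ℝ) {N : ℕ} (hN : N.Prime) :
    W σ (N + 1) = W σ N * (1 - (N : ℝ) ^ (-σ)) := by
  unfold W
  rw [Nat.primesBelow_succ, if_pos hN, Finset.prod_insert (Nat.notMem_primesBelow N), mul_comm]

lemma W_succ_not (σ : ℝ) {N : ℕ} (hN : ¬ N.Prime) : W σ (N + 1) = W σ N := by
  unfold W
  rw [Nat.primesBelow_succ, if_neg hN]

lemma A_succ_prime (σ : ℝ) {N : ℕ} (hN : N.Prime) :
    A σ (N + 1) = A σ N + Real.log N / ((N : ℝ) ^ σ - 1) := by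
  unfold A
  rw [Nat.primesBelow_succ, if_pos hN, Finset.sum_insert (Nat.notMem_primesBelow N), add_comm]

lemma A_succ_not (σ : ℝ) {N : ℕ} (hN : ¬ N.Prime) : A σ (N + 1) = A σ N := by
  unfold A
  rw [Nat.primesBelow_succ, if_neg hN]

lemma A_term_nonneg {σ : ℝ} (hσ : 0 < σ) {p : ℕ} (hp : p.Prime) :
    0 ≤ Real.log p / ((p : ℝ) ^ σ - 1) :=
  div_nonneg (Real.log_natCast_nonneg p) (by linarith [prime_rpow hσ hp])

lemma primesBelow_mono {M N : ℕ} (h : M ≤ N) : Nat.primesBelow M ⊆ Nat.primesBelow N := by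
  intro p hp
  rw [Nat.mem_primesBelow] at *
  exact ⟨by omega, hp.2⟩

lemma A_nonneg {σ : ℝ} (hσ : 0 < σ) (N : ℕ) : 0 ≤ A σ N :=
  Finset.sum_nonneg fun p hp => A_term_nonneg hσ (Nat.prime_of_mem_primesBelow hp)

lemma A_mono {σ : ℝ} (hσ : 0 < σ) {M N : ℕ} (h : M ≤ N) : A σ M ≤ A σ N :=
  Finset.sum_le_sum_of_subset_of_nonneg (primesBelow_mono h)
    fun p hp _ => A_term_nonneg hσ (Nat.prime_of_mem_primesBelow hp)

lemma A_anti {σ σ' : ℝ} (hσ : 0 < σ') (h : σ' ≤ σ) (N : ℕ) : A σ N ≤ A σ' N := by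
  apply Finset.sum_le_sum
  intro p hp
  have hp := Nat.prime_of_mem_primesBelow hp
  have h1 : (1 : ℝ) < p := by exact_mod_cast hp.one_lt
  have h2 := prime_rpow hσ hp
  have h3 : (p : ℝ) ^ σ' ≤ (p : ℝ) ^ σ := Real.rpow_le_rpow_of_exponent_le h1.le h
  apply div_le_div_of_nonneg_left (Real.log_natCast_nonneg p) <;> linarith

lemma W_mono_sigma {σ σ' : ℝ} (hσ : 0 < σ') (h : σ' ≤ σ) (N : ℕ) : W σ' N ≤ W σ N := by
  apply Finset.prod_le_prod
  · intro p hp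
    have := (prime_rpow_neg hσ (Nat.prime_of_mem_primesBelow hp)).2
    linarith
  · intro p hp
    have hp := Nat.prime_of_mem_primesBelow hp
    have h1 : (1 : ℝ) < p := by exact_mod_cast hp.one_lt
    have : (p : ℝ) ^ (-σ) ≤ (p : ℝ) ^ (-σ') := Real.rpow_le_rpow_of_exponent_le h1.le (by linarith)
    linarith

lemma W_anti {σ : ℝ} (hσ : 0 < σ) {M N : ℕ} (h : M ≤ N) : W σ N ≤ W σ M := by
  unfold W
  rw [← Finset.prod_sdiff (primesBelow_mono h)]
  have : ∏ p ∈ Nat.primesBelow N \ Nat.primesBelow M, (1 - (p : ℝ) ^ (-σ)) ≤ 1 := by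
    apply Finset.prod_le_one
    · intro p hp
      have := (prime_rpow_neg hσ (Nat.prime_of_mem_primesBelow (Finset.sdiff_subset hp))).2
      linarith
    · intro p hp
      have := (prime_rpow_neg hσ (Nat.prime_of_mem_primesBelow (Finset.sdiff_subset hp))).1
      linarith
  calc _ ≤ 1 * _ := mul_le_mul_of_nonneg_right this (W_pos hσ M).le
    _ = _ := one_mul _

/-- convexity comparison -/
lemma W_ratio {σ σ' : ℝ} (hσ : 0 < σ') (h : σ' ≤ σ) (N : ℕ) :
    W σ N * Real.exp (-((σ - σ') * A σ' N)) ≤ W σ' N := by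
  have key : W σ N ≤ W σ' N * Real.exp ((σ - σ') * A σ' N) := by
    unfold W A
    rw [Finset.mul_sum, Real.exp_sum, ← Finset.prod_mul_distrib]
    apply Finset.prod_le_prod
    · intro p hp
      have := (prime_rpow_neg (hσ.trans_le h) (Nat.prime_of_mem_primesBelow hp)).2
      linarith
    · intro p hp
      have hp := Nat.prime_of_mem_primesBelow hp
      have h1 : (1 : ℝ) < p := by exact_mod_cast hp.one_lt
      have h2 := prime_rpow hσ hp
      obtain ⟨h3, h4⟩ := prime_rpow_neg hσ hp
      set x := (p : ℝ) ^ σ' with hx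
      have hxi : (p : ℝ) ^ (-σ') = x⁻¹ := Real.rpow_neg (by linarith) _
      have h5 : (p : ℝ) ^ (-σ) = x⁻¹ * (p : ℝ) ^ (-(σ - σ')) := by
        rw [← hxi, ← Real.rpow_add (by linarith)]; ring_nf
      have h6 : 1 - (σ - σ') * Real.log p ≤ (p : ℝ) ^ (-(σ - σ')) := by
        rw [Real.rpow_def_of_pos (by linarith)]
        have := Real.add_one_le_exp (Real.log p * (-(σ - σ')))
        linarith
      have h7 := Real.add_one_le_exp ((σ - σ') * (Real.log p / (x - 1)))
      rw [hxi] at h3 h4 ⊢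
      rw [h5]
      have hx1 : 0 < x - 1 := by linarith
      calc 1 - x⁻¹ * (p : ℝ) ^ (-(σ - σ')) ≤ 1 - x⁻¹ * (1 - (σ - σ') * Real.log p) := by
            have := mul_le_mul_of_nonneg_left h6 h3.le
            linarith
        _ = (1 - x⁻¹) * ((σ - σ') * (Real.log p / (x - 1)) + 1) := by
            field_simp
            ring
        _ ≤ _ := mul_le_mul_of_nonneg_left h7 (by linarith)
  rw [Real.exp_neg]
  have := Real.exp_pos ((σ - σ') * A σ' N)
  rw [mul_inv_le_iff₀ this]
  exact key

lemma zeta_sum {s : ℝ} (hs : 0 < s) :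
    Summable (fun n : ℕ => ((n : ℝ) ^ (-(1 + s)))) ∧
    ∑' n : ℕ, ((n : ℝ) ^ (-(1 + s))) ≤ 1 + 1 / s := by
  have hsum : Summable (fun n : ℕ => ((n : ℝ) ^ (-(1 + s)))) :=
    Real.summable_nat_rpow.mpr (by linarith)
  refine ⟨hsum, ?_⟩
  have h1 := ZetaAsymptotics.zeta_limit_aux1 (s := 1 + s) (by linarith)
  have h2 : 0 ≤ ZetaAsymptotics.termTSum (1 + s) :=
    tsum_nonneg fun n => ZetaAsymptotics.term_nonneg _ _
  rw [hsum.tsum_eq_zero_add]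
  have h3 : ((0 : ℕ) : ℝ) ^ (-(1 + s)) = 0 := by
    rw [Nat.cast_zero, Real.zero_rpow (by linarith)]
  rw [h3, zero_add]
  have h4 : ∀ n : ℕ, ((n + 1 : ℕ) : ℝ) ^ (-(1 + s)) = 1 / ((n : ℝ) + 1) ^ (1 + s) := by
    intro n
    rw [Real.rpow_neg (by positivity), one_div]
    push_cast; rfl
  simp_rw [h4]
  have : 0 ≤ (1 + s) * ZetaAsymptotics.termTSum (1 + s) := by positivity
  have h5 : 1 + s - 1 = s := by ring
  rw [h5] at h1
  linarith

lemma W_zeta {s : ℝ} (hs : 0 < s) (N : ℕ) : s / (1 + s) ≤ W (1 + s) N := by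
  obtain ⟨hsum, hle⟩ := zeta_sum hs
  let f : ℕ →* ℝ :=
    { toFun := fun n => (n : ℝ) ^ (-(1 + s))
      map_one' := by simp
      map_mul' := by
        intro a b
        push_cast
        exact Real.mul_rpow (by positivity) (by positivity) }
  have h := EulerProduct.prod_primesBelow_geometric_eq_tsum_smoothNumbers (f := f) hsum N
  have h2 : ∑' m : Nat.smoothNumbers N, f m ≤ 1 + 1 / s := by
    refine le_trans ?_ hle
    exact hsum.tsum_subtype_le (fun n : ℕ => ((n : ℝ) ^ (-(1 + s)))) _ (fun n => by positivity)
  have h3 : (W (1 + s) N)⁻¹ ≤ 1 + 1 / s := by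
    unfold W
    rw [← Finset.prod_inv_distrib]
    exact h.le.trans h2
  have hW := W_pos (σ := 1 + s) (by linarith) N
  have h4 : (1 + 1 / s)⁻¹ ≤ W (1 + s) N := inv_le_of_inv_le₀ hW h3
  convert h4 using 1
  field_simp
  ring

lemma log_prod_primeFactors_le {n : ℕ} (hn : n ≠ 0) :
    ∑ p ∈ n.primeFactors, Real.log p ≤ Real.log n := by
  rw [← Real.log_prod (fun p hp => by
    have := (Nat.prime_of_mem_primeFactors hp).pos
    positivity)]
  apply Real.log_le_log
  · apply Finset.prod_pos
    intro p hp
    have := (Nat.prime_of_mem_primeFactors hp).pos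
    positivity
  · rw [← Nat.cast_prod]
    exact_mod_cast Nat.le_of_dvd (Nat.pos_of_ne_zero hn) (Nat.prod_primeFactors_dvd n)

lemma theta_primesBelow (N : ℕ) :
    ∑ p ∈ Nat.primesBelow (N + 1), Real.log p ≤ Real.log 4 * N := by
  have h := Chebyshev.theta_le_log4_mul_x (x := N) (by positivity)
  rw [Chebyshev.theta_eq_sum_Icc, Nat.floor_natCast] at h
  refine le_trans (le_of_eq ?_) h
  apply Finset.sum_congr _ (fun _ _ => rfl)
  ext p
  simp only [Nat.mem_primesBelow, Finset.mem_filter, Finset.mem_Icc]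
  constructor
  · rintro ⟨a, b⟩; exact ⟨by omega, b⟩
  · rintro ⟨a, b⟩; exact ⟨by omega, b⟩

lemma mertens_aux (N : ℕ) (hN : 1 ≤ N) :
    ∑ p ∈ Nat.primesBelow (N + 1), Real.log p / p ≤ Real.log N + Real.log 4 := by
  have h1 : ∑ p ∈ Nat.primesBelow (N + 1), (((N / p : ℕ) : ℝ)) * Real.log p
      ≤ N * Real.log N := by
    calc _ = ∑ p ∈ Nat.primesBelow (N + 1), ∑ n ∈ (Finset.Ioc 0 N).filter (p ∣ ·), Real.log p := by
          apply Finset.sum_congr rfl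
          intro p hp
          rw [Finset.sum_const, Nat.Ioc_filter_dvd_card_eq_div, nsmul_eq_mul]
      _ = ∑ n ∈ Finset.Ioc 0 N, ∑ p ∈ (Nat.primesBelow (N + 1)).filter (· ∣ n), Real.log p := by
          simp_rw [Finset.sum_filter]
          rw [Finset.sum_comm]
      _ ≤ ∑ n ∈ Finset.Ioc 0 N, Real.log N := by
          apply Finset.sum_le_sum
          intro n hn
          rw [Finset.mem_Ioc] at hn
          have hpos : (0 : ℝ) < n := by exact_mod_cast hn.1
          refine le_trans ?_ ((log_prod_primeFactors_le (n := n) (by omega)).trans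
            (Real.log_le_log hpos (by exact_mod_cast hn.2)))
          apply Finset.sum_le_sum_of_subset_of_nonneg
          · intro p hp
            simp only [Finset.mem_filter, Nat.mem_primesBelow] at hp
            rw [Nat.mem_primeFactors]
            exact ⟨hp.1.2, hp.2, by omega⟩
          · intro p _ _; exact Real.log_natCast_nonneg p
      _ = _ := by simp
  have h2 := theta_primesBelow N
  have hNr : (0 : ℝ) < N := by exact_mod_cast hN
  have h3 : N * ∑ p ∈ Nat.primesBelow (N + 1), Real.log p / p ≤
      N * (Real.log N + Real.log 4) := by
    calc _ = ∑ p ∈ Nat.primesBelow (N + 1), ((N : ℝ) / p) * Real.log p := by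
          rw [Finset.mul_sum]
          apply Finset.sum_congr rfl
          intro p _
          ring
      _ ≤ ∑ p ∈ Nat.primesBelow (N + 1), ((((N / p : ℕ) : ℝ)) * Real.log p + Real.log p) := by
          apply Finset.sum_le_sum
          intro p _
          have : (N : ℝ) / p ≤ ((N / p : ℕ) : ℝ) + 1 := by
            have := Nat.lt_floor_add_one ((N : ℝ) / p)
            rw [Nat.floor_div_eq_div] at this
            exact this.le
          calc _ ≤ (((N / p : ℕ) : ℝ) + 1) * Real.log p :=
                mul_le_mul_of_nonneg_right this (Real.log_natCast_nonneg p)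
            _ = _ := by ring
      _ ≤ _ := by rw [Finset.sum_add_distrib]; linarith
  exact le_of_mul_le_mul_left h3 hNr

lemma mertens : ∃ C : ℝ, 0 ≤ C ∧ ∀ N : ℕ, 1 ≤ N → A 1 (N + 1) ≤ Real.log N + C := by
  have hsum : Summable (fun n : ℕ => 4 * ((n : ℝ) ^ (-(3 / 2 : ℝ)))) :=
    (Real.summable_nat_rpow.mpr (by norm_num)).mul_left 4
  have hnn : 0 ≤ ∑' n : ℕ, 4 * ((n : ℝ) ^ (-(3 / 2 : ℝ))) := tsum_nonneg fun n => by positivity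
  refine ⟨Real.log 4 + ∑' n : ℕ, 4 * ((n : ℝ) ^ (-(3 / 2 : ℝ))), ?_, ?_⟩
  · have := Real.log_nonneg (show (1 : ℝ) ≤ 4 by norm_num)
    linarith
  intro N hN
  have h1 := mertens_aux N hN
  have h2 : A 1 (N + 1) ≤ ∑ p ∈ Nat.primesBelow (N + 1), (Real.log p / p +
      4 * ((p : ℝ) ^ (-(3 / 2 : ℝ)))) := by
    apply Finset.sum_le_sum
    intro p hp
    have hp := Nat.prime_of_mem_primesBelow hp
    have hp2 : (2 : ℝ) ≤ p := by exact_mod_cast hp.two_le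
    have hl := Real.log_le_rpow_div (x := p) (by positivity) (ε := 1 / 2) (by norm_num)
    have e1 : (p : ℝ) ^ (-(3 / 2 : ℝ)) = (p : ℝ) ^ (1 / 2 : ℝ) * ((p : ℝ) ^ 2)⁻¹ := by
      rw [← Real.rpow_natCast, ← Real.rpow_neg (by positivity), ← Real.rpow_add (by positivity)]
      norm_num
    rw [Real.rpow_one, e1]
    have e2 : Real.log p / (p - 1) = Real.log p / p + Real.log p / (p * (p - 1)) := by
      have : (p : ℝ) - 1 ≠ 0 := by linarith
      field_simp
      ring
    rw [e2]
    have hp0 : (0 : ℝ) < p := by linarith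
    have : Real.log p / (p * (p - 1)) ≤ 4 * ((p : ℝ) ^ (1 / 2 : ℝ) * ((p : ℝ) ^ 2)⁻¹) := by
      rw [div_le_iff₀ (by nlinarith)]
      have h5 : 4 * ((p : ℝ) ^ (1 / 2 : ℝ) * ((p : ℝ) ^ 2)⁻¹) * (p * (p - 1)) =
        (p : ℝ) ^ (1 / 2 : ℝ) * (4 * (p - 1) / p) := by field_simp
      rw [h5]
      have h6 : (2 : ℝ) ≤ 4 * (p - 1) / p := by
        rw [le_div_iff₀ hp0]; linarith
      have h7 : (0 : ℝ) ≤ (p : ℝ) ^ (1 / 2 : ℝ) := by positivity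
      nlinarith
    linarith
  rw [Finset.sum_add_distrib] at h2
  have h3 := hsum.sum_le_tsum (Nat.primesBelow (N + 1)) (fun n _ => by positivity)
  linarith

/-- weighted comparison -/
lemma weighted_compare (d w : ℕ → ℝ) (hw : ∀ n, 0 ≤ w n) (hanti : ∀ n, w (n + 1) ≤ w n)
    (hd : ∀ n, 0 ≤ ∑ i ∈ Finset.range n, d i) (n : ℕ) :
    0 ≤ ∑ i ∈ Finset.range n, d i * w i := by
  have : ∀ n, w n * ∑ i ∈ Finset.range n, d i ≤ ∑ i ∈ Finset.range n, d i * w i := by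
    intro n
    induction n with
    | zero => simp
    | succ k ih =>
      rw [Finset.sum_range_succ (fun i => d i * w i)]
      calc w (k + 1) * ∑ i ∈ Finset.range (k + 1), d i
          ≤ w k * ∑ i ∈ Finset.range (k + 1), d i :=
            mul_le_mul_of_nonneg_right (hanti k) (hd _)
        _ = w k * ∑ i ∈ Finset.range k, d i + d k * w k := by
            rw [Finset.sum_range_succ]; ring
        _ ≤ _ := by linarith
  exact (mul_nonneg (hw n) (hd n)).trans (this n)

lemma A_shift : ∃ C : ℝ, 0 ≤ C ∧ ∀ s : ℝ, 0 < s → ∀ N : ℕ, A (1 + s) N ≤ C + 2 / s := by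
  obtain ⟨C, hC, hM⟩ := mertens
  refine ⟨C + 4, by linarith, ?_⟩
  intro s hs N
  -- sequence indexed by i, standing for the integer i + 1
  let a : ℕ → ℝ := fun i => if (i + 1).Prime then Real.log (i + 1 : ℕ) / ((i + 1 : ℕ) - 1 : ℝ) else 0
  let b : ℕ → ℝ := fun i => if i = 0 then C else Real.log (i + 1 : ℕ) - Real.log (i : ℕ)
  let w : ℕ → ℝ := fun i => ((i + 1 : ℕ) : ℝ) ^ (-s)
  have hb : ∀ n, ∑ i ∈ Finset.range (n + 1), b i = Real.log (n + 1 : ℕ) + C := by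
    intro n
    induction n with
    | zero => simp [b]
    | succ k ih =>
      rw [Finset.sum_range_succ, ih]
      simp only [b, if_neg (Nat.succ_ne_zero k)]
      ring
  have ha : ∀ n, ∑ i ∈ Finset.range n, a i = A 1 (n + 1) := by
    intro n
    induction n with
    | zero => simp [A, Nat.primesBelow]; 
              rw [Finset.sum_eq_zero]
              intro p hp
              simp only [Finset.mem_filter, Finset.mem_singleton] at hp
              exact absurd hp.2 (by rw [hp.1]; norm_num)
    | succ k ih =>
      rw [Finset.sum_range_succ, ih]
      by_cases hp : (k + 1).Prime
      · rw [A_succ_prime 1 hp, Real.rpow_one]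
        simp only [a, if_pos hp]
      · rw [A_succ_not 1 hp]
        simp only [a, if_neg hp, add_zero]
  have key := weighted_compare (fun i => b i - a i) w (fun n => by positivity)
    (fun n => by
      simp only [w]
      apply Real.rpow_le_rpow_of_nonpos (by positivity) (by push_cast; linarith) (by linarith))
    (fun n => by
      rw [Finset.sum_sub_distrib]
      cases n with
      | zero => simp
      | succ k =>
        rw [hb, ha]
        have := hM (k + 1) (by omega)
        linarith) N
  simp_rw [sub_mul] at key
  rw [Finset.sum_sub_distrib] at key
  have h1 : A (1 + s) N ≤ A (1 + s) (N + 1) := A_mono (by linarith) (by omega)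
  have h2 : ∀ n, A (1 + s) (n + 1) ≤ ∑ i ∈ Finset.range n, a i * w i := by
    intro n
    induction n with
    | zero => simp [A, Nat.primesBelow]; 
              rw [Finset.sum_eq_zero]
              intro p hp
              simp only [Finset.mem_filter, Finset.mem_singleton] at hp
              exact absurd hp.2 (by rw [hp.1]; norm_num)
    | succ k ih =>
      rw [Finset.sum_range_succ]
      by_cases hp : (k + 1).Prime
      · rw [A_succ_prime _ hp]
        have h3 : Real.log (k + 1 : ℕ) / (((k + 1 : ℕ) : ℝ) ^ (1 + s) - 1) ≤ a k * w k := by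
          simp only [a, w, if_pos hp]
          have hk : (1 : ℝ) < ((k + 1 : ℕ) : ℝ) := by exact_mod_cast hp.one_lt
          generalize hx : ((k + 1 : ℕ) : ℝ) = x at hk ⊢
          rw [Real.rpow_neg (by linarith), ← div_eq_mul_inv, div_div, Real.rpow_add (by linarith),
            Real.rpow_one]
          have hy : 1 < x ^ s := Real.one_lt_rpow hk hs
          apply div_le_div_of_nonneg_left (Real.log_nonneg hk.le) <;> nlinarith
        linarith
      · rw [A_succ_not _ hp]
        simp only [a, if_neg hp, zero_mul, add_zero]
        exact ih
  have h3 : ∑ i ∈ Finset.range N, b i * w i ≤ C + 2 * ∑ i ∈ Finset.range N, ((i + 1 : ℕ) : ℝ) ^ (-(1 + s)) := by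
    have : ∀ i ∈ Finset.range N, b i * w i ≤ (if i = 0 then C else 0) +
        2 * ((i + 1 : ℕ) : ℝ) ^ (-(1 + s)) := by
      intro i _
      by_cases hi : i = 0
      · subst hi; simp [b, w]
      · simp only [b, w, if_neg hi, zero_add]
        have hi0 : (1 : ℝ) ≤ i := by exact_mod_cast Nat.one_le_iff_ne_zero.mpr hi
        have hl : Real.log (i + 1 : ℕ) - Real.log (i : ℕ) ≤ 2 * ((i + 1 : ℕ) : ℝ)⁻¹ := by
          rw [← Real.log_div (by positivity) (by positivity)]
          have := Real.log_le_sub_one_of_pos (x := ((i + 1 : ℕ) : ℝ) / i) (by positivity)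
          refine this.trans ?_
          push_cast
          rw [show ((i : ℝ) + 1) / i - 1 = 1 / i by field_simp; ring, ← div_eq_mul_inv,
            div_le_div_iff₀ (by positivity) (by positivity)]
          linarith
        rw [show -(1 + s) = -1 + -s by ring, Real.rpow_add (by positivity), Real.rpow_neg_one]
        have : 0 ≤ ((i + 1 : ℕ) : ℝ) ^ (-s) := by positivity
        nlinarith
    refine (Finset.sum_le_sum this).trans ?_
    rw [Finset.sum_add_distrib, ← Finset.mul_sum]
    have : ∑ i ∈ Finset.range N, (if i = 0 then C else 0) ≤ C := by
      rw [Finset.sum_ite_eq' (Finset.range N) 0 (fun _ => C)]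
      split_ifs <;> linarith
    linarith
  obtain ⟨hsum, hz⟩ := zeta_sum hs
  have h4 : ∑ i ∈ Finset.range N, ((i + 1 : ℕ) : ℝ) ^ (-(1 + s)) ≤ 1 + 1 / s := by
    have := hsum.sum_le_tsum (Finset.range (N + 1)) (fun n _ => by positivity)
    rw [Finset.sum_range_succ'] at this
    have h0 : (0 : ℝ) ≤ ((0 : ℕ) : ℝ) ^ (-(1 + s)) := by positivity
    linarith
  have h5 := h2 N
  have : 2 / s = 2 * (1 / s) := by ring
  linarith

lemma W1_lower : ∃ c : ℝ, 0 < c ∧ ∀ Y : ℕ, 2 ≤ Y → c / Real.log Y ≤ W 1 (Y + 1) := by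
  obtain ⟨C, hC, hM⟩ := mertens
  refine ⟨Real.exp (-(1 + 2 * C)) / 3, by positivity, ?_⟩
  intro Y hY
  have hY2 : (2 : ℝ) ≤ Y := by exact_mod_cast hY
  have hl2 : (1 / 2 : ℝ) < Real.log Y := by
    have := Real.log_two_gt_d9
    have := Real.log_le_log (by norm_num) hY2
    linarith
  set s := 1 / Real.log Y with hs
  have hs0 : 0 < s := by positivity
  have h1 := W_ratio (σ' := 1) (σ := 1 + s) (by norm_num) (by linarith) (Y + 1)
  have h2 := W_zeta hs0 (Y + 1)
  have h3 := hM Y (by omega)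
  have h4 : (1 + s - 1) * A 1 (Y + 1) ≤ 1 + 2 * C := by
    rw [show 1 + s - 1 = s by ring, hs, div_mul_eq_mul_div, one_mul, div_le_iff₀ (by linarith)]
    nlinarith
  have h5 : Real.exp (-(1 + 2 * C)) ≤ Real.exp (-((1 + s - 1) * A 1 (Y + 1))) :=
    Real.exp_le_exp.mpr (by linarith)
  have h6 : 1 / (3 * Real.log Y) ≤ s / (1 + s) := by
    rw [hs]
    rw [show 1 / Real.log Y / (1 + 1 / Real.log Y) = 1 / (Real.log Y + 1) by field_simp]
    apply one_div_le_one_div_of_le <;> linarith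
  calc Real.exp (-(1 + 2 * C)) / 3 / Real.log Y = 1 / (3 * Real.log Y) * Real.exp (-(1 + 2 * C)) := by
        field_simp
    _ ≤ W (1 + s) (Y + 1) * Real.exp (-((1 + s - 1) * A 1 (Y + 1))) := by
        apply mul_le_mul (h6.trans h2) h5 (by positivity) (W_pos (by linarith) _).le
    _ ≤ _ := h1

/-- the exponent slightly below one -/
noncomputable def dl (Y : ℕ) : ℝ := 1 / (4 * Real.log Y)

lemma dl_facts {Y : ℕ} (hY : 2 ≤ Y) : 1 / 2 < Real.log Y ∧ 0 < dl Y ∧ dl Y < 1 / 2 ∧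
    dl Y * Real.log Y = 1 / 4 := by
  have hY2 : (2 : ℝ) ≤ Y := by exact_mod_cast hY
  have hl2 : (0.69 : ℝ) < Real.log Y := by
    have := Real.log_two_gt_d9
    have := Real.log_le_log (by norm_num) hY2
    linarith
  refine ⟨by linarith, by unfold dl; positivity, ?_, ?_⟩
  · unfold dl
    rw [div_lt_iff₀ (by positivity)]
    linarith
  · unfold dl
    field_simp

lemma A_below {Y : ℕ} (hY : 2 ≤ Y) {θ : ℕ} (hθ : θ ≤ Y) :
    A (1 - dl Y) (θ + 1) ≤ A 1 (θ + 1) * (1 + 4 * dl Y * Real.log θ) := by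
  obtain ⟨hl, h0, h1, h2⟩ := dl_facts hY
  unfold A
  rw [Finset.sum_mul]
  apply Finset.sum_le_sum
  intro p hp
  rw [Nat.mem_primesBelow] at hp
  obtain ⟨hpθ, hp⟩ := hp
  have hp2 : (2 : ℝ) ≤ p := by exact_mod_cast hp.two_le
  have hpθ' : (p : ℝ) ≤ θ := by exact_mod_cast Nat.lt_succ_iff.mp hpθ
  have hlog : Real.log p ≤ Real.log θ := Real.log_le_log (by linarith) hpθ'
  have hlog2 : Real.log θ ≤ Real.log Y := Real.log_le_log (by linarith) (by exact_mod_cast hθ)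
  have hlp : 0 < Real.log p := Real.log_pos (by linarith)
  set δ := dl Y
  have hδp : δ * Real.log p ≤ 1 / 4 := by nlinarith
  have hδ0 : 0 < δ * Real.log p := by positivity
  -- y = p ^ δ
  have hy1 : (p : ℝ) ^ δ ≤ 1 + 4 / 3 * (δ * Real.log p) := by
    rw [Real.rpow_def_of_pos (by linarith), mul_comm (Real.log p)]
    have := Real.add_one_le_exp (-(δ * Real.log p))
    rw [Real.exp_neg] at this
    have hpos := Real.exp_pos (δ * Real.log p)
    have h3 : Real.exp (δ * Real.log p) * (1 - δ * Real.log p) ≤ 1 := by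
      calc _ ≤ Real.exp (δ * Real.log p) * (Real.exp (δ * Real.log p))⁻¹ :=
            mul_le_mul_of_nonneg_left (by linarith) hpos.le
        _ = 1 := mul_inv_cancel₀ hpos.ne'
    by_contra hcon
    push Not at hcon
    nlinarith
  set y := (p : ℝ) ^ δ with hy
  have hy0 : 1 < y := Real.one_lt_rpow (by linarith) h0
  have hσ : (p : ℝ) ^ (1 - δ) = p / y := by
    rw [Real.rpow_sub (by linarith), Real.rpow_one]
  rw [hσ, Real.rpow_one, div_mul_eq_mul_div, mul_div_assoc]
  rw [div_eq_mul_inv]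
  apply mul_le_mul_of_nonneg_left _ hlp.le
  have hyle : y ≤ 4 / 3 := by linarith
  have e1 : (p / y - 1)⁻¹ = y / (p - y) := by
    have : (p : ℝ) - y ≠ 0 := by linarith
    field_simp
  rw [e1, div_le_div_iff₀ (by linarith) (by linarith)]
  set u := δ * Real.log p
  have hu : 4 * δ * Real.log θ ≥ 4 * u := by
    simp only [u]; nlinarith
  have h6 : y * (p - 1) ≤ (1 + 4 * u) * (p - y) := by
    nlinarith
  nlinarith

lemma Wσ_lower : ∃ c : ℝ, 0 < c ∧ ∀ Y : ℕ, 2 ≤ Y → c / Real.log Y ≤ W (1 - dl Y) (Y + 1) := by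
  obtain ⟨C, hC, hM⟩ := mertens
  obtain ⟨c, hc, hW⟩ := W1_lower
  refine ⟨c * Real.exp (-(1 + C)), by positivity, ?_⟩
  intro Y hY
  obtain ⟨hl, h0, h1, h2⟩ := dl_facts hY
  have h3 := W_ratio (σ' := 1 - dl Y) (σ := 1) (by linarith) (by linarith) (Y + 1)
  have h4 := A_below hY le_rfl
  have h5 := hM Y (by omega)
  have h6 := hW Y hY
  have hA := A_nonneg (σ := 1) one_pos (Y + 1)
  have h7 : (1 - (1 - dl Y)) * A (1 - dl Y) (Y + 1) ≤ 1 + C := by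
    rw [show 1 - (1 - dl Y) = dl Y by ring]
    have : 1 + 4 * dl Y * Real.log Y = 2 := by rw [mul_assoc, h2]; norm_num
    rw [this] at h4
    nlinarith
  calc c * Real.exp (-(1 + C)) / Real.log Y = c / Real.log Y * Real.exp (-(1 + C)) := by ring
    _ ≤ W 1 (Y + 1) * Real.exp (-((1 - (1 - dl Y)) * A (1 - dl Y) (Y + 1))) := by
        apply mul_le_mul h6 (Real.exp_le_exp.mpr (by linarith)) (by positivity)
          (W_pos one_pos _).le
    _ ≤ _ := h3

lemma pi_bound : ∃ C : ℝ, 0 < C ∧ ∀ x : ℝ, 2 ≤ x →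
    ((Nat.primeCounting ⌊x⌋₊ : ℕ) : ℝ) ≤ C * x / Real.log x := by
  refine ⟨2 * Real.log 4 + 2, by have := Real.log_nonneg (show (1:ℝ) ≤ 4 by norm_num); linarith, ?_⟩
  intro x hx
  have h := Chebyshev.pi_le_log4_mul_div (x := x) (by linarith)
  have hl : 0 < Real.log x := Real.log_pos (by linarith)
  rw [Real.log_sqrt (by linarith)] at h
  have h2 : √x ≤ 2 * x / Real.log x := by
    rw [le_div_iff₀ hl]
    have := Real.log_le_rpow_div (x := x) (by linarith) (ε := 1 / 2) (by norm_num)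
    rw [← Real.sqrt_eq_rpow] at this
    have h3 := Real.mul_self_sqrt (show 0 ≤ x by linarith)
    have h4 := Real.sqrt_nonneg x
    nlinarith
  have h3 : Real.log 4 * x / (Real.log x / 2) = 2 * Real.log 4 * x / Real.log x := by
    field_simp
  rw [h3] at h
  calc _ ≤ _ := h
    _ ≤ 2 * Real.log 4 * x / Real.log x + 2 * x / Real.log x := by linarith
    _ = _ := by ring

end PP

namespace PP

/-- the part of `m` composed of primes below `r` -/
def sm (m r : ℕ) : ℕ := ∏ p ∈ Nat.primesBelow r, p ^ (m.factorization p)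

/-- `T`-dense numbers in the prime chain sense -/
def BT (T m : ℕ) : Prop := m ≠ 0 ∧ ∀ r : ℕ, r.Prime → r ∣ m → r ≤ T * sm m r

lemma sm_smooth {m N : ℕ} (h : m ∈ Nat.smoothNumbers N) : sm m N = m := by
  have h0 := Nat.ne_zero_of_mem_smoothNumbers h
  conv_rhs => rw [← Nat.prod_factorization_pow_eq_self h0]
  unfold sm
  rw [Nat.prod_factorization_eq_prod_primeFactors]
  symm
  apply Finset.prod_subset
  · intro p hp
    rw [Nat.mem_primeFactors] at hp
    rw [Nat.mem_primesBelow]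
    exact ⟨Nat.mem_smoothNumbers'.mp h p hp.1 hp.2.1, hp.1⟩
  · intro p _ hp
    rw [← Nat.support_factorization, Finsupp.notMem_support_iff] at hp
    rw [hp, pow_zero]

lemma sm_congr {m m' r : ℕ} (h : ∀ p, p.Prime → p < r → m.factorization p = m'.factorization p) :
    sm m r = sm m' r := by
  unfold sm
  apply Finset.prod_congr rfl
  intro p hp
  rw [Nat.mem_primesBelow] at hp
  rw [h p hp.2 hp.1]

lemma sm_dvd {m : ℕ} (hm : m ≠ 0) (r : ℕ) : sm m r ∣ m := by
  have h1 : m ∈ Nat.smoothNumbers (max r (m + 1)) := by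
    rw [Nat.mem_smoothNumbers']
    intro p hp hpm
    have := Nat.le_of_dvd (Nat.pos_of_ne_zero hm) hpm
    omega
  conv_rhs => rw [← sm_smooth h1]
  exact Finset.prod_dvd_prod_of_subset _ _ _ (primesBelow_mono (le_max_left _ _))

open Classical in
noncomputable def B (T X N : ℕ) : Finset ℕ :=
  (Finset.Icc 1 X).filter (fun m => BT T m ∧ m ∈ Nat.smoothNumbers N)

lemma mem_B {T X N m : ℕ} : m ∈ B T X N ↔ (1 ≤ m ∧ m ≤ X) ∧ BT T m ∧ m ∈ Nat.smoothNumbers N := by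
  classical
  unfold B
  simp only [Finset.mem_filter, Finset.mem_Icc]

lemma smooth_not_dvd {N m : ℕ} (hN : N.Prime) (h : m ∈ Nat.smoothNumbers N) : ¬ N ∣ m := by
  intro hd
  exact absurd (Nat.mem_smoothNumbers'.mp h N hN hd) (lt_irrefl _)

lemma fact_mul_pow {N m a : ℕ} (hN : N.Prime) (hm : m ≠ 0) {p : ℕ} (hp : p.Prime) (hpN : p ≠ N) :
    (N ^ a * m).factorization p = m.factorization p := by
  rw [Nat.factorization_mul (pow_ne_zero _ hN.ne_zero) hm, Nat.factorization_pow,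
    hN.factorization]
  simp [Finsupp.single_apply, hpN.symm]

lemma B_lift {T X N m a : ℕ} (hN : N.Prime) (h : m ∈ B T X N) (hNT : N ≤ T * m ∨ a = 0)
    (hX : N ^ a * m ≤ X) : N ^ a * m ∈ B T X (N + 1) := by
  rw [mem_B] at *
  obtain ⟨⟨h1, h2⟩, ⟨h3, h4⟩, h5⟩ := h
  have hpos : 0 < N ^ a * m := Nat.mul_pos (pow_pos hN.pos _) (by omega)
  refine ⟨⟨hpos, hX⟩, ⟨hpos.ne', ?_⟩, ?_⟩
  · intro r hr hrd
    by_cases hrN : r = N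
    · subst hrN
      rcases hNT with hNT | ha
      · rw [sm_congr (m' := m) (fun p hp hpr => fact_mul_pow hr h3 hp hpr.ne), sm_smooth h5]
        exact hNT
      · subst ha
        rw [pow_zero, one_mul] at hrd
        exact absurd hrd (smooth_not_dvd hr h5)
    · have hrm : r ∣ m := by
        rcases (Nat.Prime.dvd_mul hr).mp hrd with h | h
        · exact absurd ((Nat.prime_dvd_prime_iff_eq hr hN).mp (hr.dvd_of_dvd_pow h)) hrN
        · exact h
      have hlt := Nat.mem_smoothNumbers'.mp h5 r hr hrm
      rw [sm_congr (m' := m) (fun p hp hpr => fact_mul_pow hN h3 hp (by omega))]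
      exact h4 r hr hrm
  · rw [Nat.mem_smoothNumbers']
    intro r hr hrd
    rcases (Nat.Prime.dvd_mul hr).mp hrd with h | h
    · have := (Nat.prime_dvd_prime_iff_eq hr hN).mp (hr.dvd_of_dvd_pow h)
      omega
    · have := Nat.mem_smoothNumbers'.mp h5 r hr h
      omega

lemma B_drop {T X N m a : ℕ} (hN : N.Prime) (hm : m ∈ Nat.smoothNumbers N)
    (h : N ^ a * m ∈ B T X (N + 1)) : m ∈ B T X N ∧ (N ≤ T * m ∨ a = 0) := by
  rw [mem_B] at *
  have h3 := Nat.ne_zero_of_mem_smoothNumbers hm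
  obtain ⟨⟨h1, h2⟩, ⟨_, h4⟩, h5⟩ := h
  refine ⟨⟨⟨by omega, ?_⟩, ⟨h3, ?_⟩, hm⟩, ?_⟩
  · exact (Nat.le_mul_of_pos_left m (pow_pos hN.pos a)).trans h2
  · intro r hr hrm
    have hlt := Nat.mem_smoothNumbers'.mp hm r hr hrm
    rw [← sm_congr (m := N ^ a * m) (fun p hp hpr => fact_mul_pow hN h3 hp (by omega))]
    exact h4 r hr (hrm.mul_left _)
  · by_cases ha : a = 0
    · exact Or.inr ha
    · left
      have := h4 N hN ((dvd_pow_self N ha).mul_right _)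
      rwa [sm_congr (m' := m) (fun p hp hpr => fact_mul_pow hN h3 hp hpr.ne), sm_smooth hm] at this

def kk (T X N m : ℕ) : ℕ := if N ≤ T * m then Nat.log N (X / m) + 1 else 1

lemma sum_B_succ {T X N : ℕ} (hN : N.Prime) (f : ℕ → ℝ) :
    ∑ m ∈ B T X (N + 1), f m = ∑ m ∈ B T X N, ∑ a ∈ Finset.range (kk T X N m), f (N ^ a * m) := by
  rw [Finset.sum_sigma']
  symm
  refine Finset.sum_bij' (fun x _ => N ^ x.2 * x.1)
    (fun m _ => ⟨m / N ^ (m.factorization N), m.factorization N⟩) ?_ ?_ ?_ ?_ ?_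
  · rintro ⟨m, a⟩ h
    rw [Finset.mem_sigma, Finset.mem_range] at h
    obtain ⟨hm, ha⟩ := h
    dsimp only at hm ha ⊢
    have hm' := mem_B.mp hm
    unfold kk at ha
    split_ifs at ha with hT
    · apply B_lift hN hm (Or.inl hT)
      have h1 : N ^ a ≤ X / m := by
        apply Nat.pow_le_of_le_log
        · exact (Nat.div_pos hm'.1.2 hm'.1.1).ne'
        · omega
      exact (Nat.le_div_iff_mul_le hm'.1.1).mp h1
    · have : a = 0 := by omega
      subst this
      apply B_lift hN hm (Or.inr rfl)
      rw [pow_zero, one_mul]; exact hm'.1.2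
  · intro m' hm'
    have hm'' := mem_B.mp hm'
    have hne : m' ≠ 0 := by omega
    have hdec : N ^ (m'.factorization N) * (m' / N ^ (m'.factorization N)) = m' :=
      Nat.ordProj_mul_ordCompl_eq_self m' N
    have hsm : m' / N ^ (m'.factorization N) ∈ Nat.smoothNumbers N := by
      rw [Nat.mem_smoothNumbers']
      intro p hp hpd
      have h1 := Nat.mem_smoothNumbers'.mp hm''.2.2 p hp (hpd.trans (Nat.ordCompl_dvd m' N))
      have h2 : p ≠ N := by
        rintro rfl
        exact Nat.not_dvd_ordCompl hp hne hpd
      omega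
    rw [← hdec] at hm'
    obtain ⟨h1, h2⟩ := B_drop hN hsm (a := m'.factorization N) (by
      rw [hdec] at hm' ⊢; exact hm')
    rw [Finset.mem_sigma, Finset.mem_range]
    refine ⟨h1, ?_⟩
    dsimp only
    unfold kk
    split_ifs with hT
    · rw [Nat.lt_succ_iff]
      have h1' := mem_B.mp h1
      apply Nat.le_log_of_pow_le hN.one_lt
      rw [Nat.le_div_iff_mul_le h1'.1.1, hdec]
      exact hm''.1.2
    · rcases h2 with h2 | h2
      · exact absurd h2 hT
      · omega
  · rintro ⟨m, a⟩ h
    rw [Finset.mem_sigma, Finset.mem_range] at h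
    obtain ⟨hm, ha⟩ := h
    dsimp only at hm ha ⊢
    have hm' := mem_B.mp hm
    have hf : (N ^ a * m).factorization N = a := by
      have := Nat.factorization_eq_zero_of_not_dvd (smooth_not_dvd hN hm'.2.2)
      rw [Nat.factorization_mul (pow_ne_zero _ hN.ne_zero) (by omega), Nat.factorization_pow,
        hN.factorization]
      simp [this]
    rw [hf, Nat.mul_div_cancel_left _ (pow_pos hN.pos a)]
  · intro m' hm'
    exact Nat.ordProj_mul_ordCompl_eq_self m' N
  · intro x _; rfl

lemma B_succ_not {T X N : ℕ} (hN : ¬ N.Prime) : B T X (N + 1) = B T X N := by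
  ext m
  rw [mem_B, mem_B, Nat.smoothNumbers_succ hN]

lemma geom1 {x : ℝ} (k : ℕ) : ∑ a ∈ Finset.range k, x ^ a * (1 - x) = 1 - x ^ k := by
  induction k with
  | zero => simp
  | succ n ih => rw [Finset.sum_range_succ, ih]; ring

lemma geom2 {x u l : ℝ} (hx : x < 1) (k : ℕ) :
    ∑ a ∈ Finset.range k, x ^ a * (1 - x) * (u + a * l - l * x / (1 - x))
      = u - x ^ k * (u + k * l) := by
  have : (1 - x) ≠ 0 := by linarith
  induction k with
  | zero => simp
  | succ n ih =>
    rw [Finset.sum_range_succ, ih]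
    push_cast
    field_simp
    ring

/-- cutoff -/
def cc (T N m : ℕ) : ℕ := min N (T * m + 1)

lemma B_zero (T X : ℕ) : B T X 0 ⊆ {1} := by
  intro m hm
  rw [mem_B] at hm
  have h := hm.2.2
  rw [Nat.smoothNumbers_zero] at h
  simpa using h

lemma rpow_term {σ : ℝ} {N m : ℕ} (a : ℕ) :
    ((N ^ a * m : ℕ) : ℝ) ^ (-σ) = (m : ℝ) ^ (-σ) * ((N : ℝ) ^ (-σ)) ^ a := by
  push_cast
  rw [Real.mul_rpow (by positivity) (by positivity), ← Real.rpow_natCast,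
    ← Real.rpow_natCast, ← Real.rpow_mul (by positivity), ← Real.rpow_mul (by positivity), mul_comm,
    mul_comm (a : ℝ)]

lemma cc_lift {T N m : ℕ} (hN : N.Prime) (h : N ≤ T * m) (a : ℕ) :
    cc T N m = N ∧ cc T (N + 1) (N ^ a * m) = N + 1 := by
  unfold cc
  have h1 : T * m ≤ T * (N ^ a * m) :=
    Nat.mul_le_mul_left _ (Nat.le_mul_of_pos_left m (pow_pos hN.pos a))
  omega

lemma cc_same {T N m : ℕ} (h : ¬ N ≤ T * m) : cc T (N + 1) m = cc T N m := by
  unfold cc; omega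

lemma W_cc_not {σ : ℝ} {T N : ℕ} (hN : ¬ N.Prime) (m : ℕ) :
    W σ (cc T (N + 1) m) = W σ (cc T N m) ∧ A σ (cc T (N + 1) m) = A σ (cc T N m) := by
  by_cases h : N ≤ T * m
  · have h1 : cc T (N + 1) m = N + 1 := by unfold cc; omega
    have h2 : cc T N m = N := by unfold cc; omega
    rw [h1, h2]
    exact ⟨W_succ_not σ hN, A_succ_not σ hN⟩
  · rw [cc_same h]; exact ⟨rfl, rfl⟩

theorem dense1 {σ : ℝ} (hσ : 0 < σ) (T X N : ℕ) :
    ∑ m ∈ B T X N, (m : ℝ) ^ (-σ) * W σ (cc T N m) ≤ 1 := by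
  induction N with
  | zero =>
    calc _ ≤ ∑ m ∈ ({1} : Finset ℕ), (m : ℝ) ^ (-σ) * W σ (cc T 0 m) :=
          Finset.sum_le_sum_of_subset_of_nonneg (B_zero T X)
            (fun m _ _ => mul_nonneg (by positivity) (W_pos hσ _).le)
      _ ≤ 1 := by simp [cc, W, Nat.primesBelow]
  | succ N ih =>
    by_cases hN : N.Prime
    · rw [sum_B_succ hN]
      refine le_trans (Finset.sum_le_sum ?_) ih
      intro m hm
      obtain ⟨hx0, hx1⟩ := prime_rpow_neg hσ hN
      by_cases hT : N ≤ T * m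
      · have e : ∀ a ∈ Finset.range (kk T X N m), ((N ^ a * m : ℕ) : ℝ) ^ (-σ) *
            W σ (cc T (N + 1) (N ^ a * m)) = ((m : ℝ) ^ (-σ) * W σ N) *
              (((N : ℝ) ^ (-σ)) ^ a * (1 - (N : ℝ) ^ (-σ))) := by
          intro a _
          rw [rpow_term, (cc_lift hN hT a).2, W_succ_prime σ hN]
          ring
        rw [Finset.sum_congr rfl e, ← Finset.mul_sum, geom1, (cc_lift hN hT 0).1]
        have h1 : 0 ≤ (m : ℝ) ^ (-σ) * W σ N := mul_nonneg (by positivity) (W_pos hσ _).le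
        have h2 : 0 ≤ ((N : ℝ) ^ (-σ)) ^ (kk T X N m) := by positivity
        nlinarith
      · have : kk T X N m = 1 := by unfold kk; rw [if_neg hT]
        rw [this, Finset.sum_range_one, pow_zero, one_mul, cc_same hT]
    · rw [B_succ_not hN]
      refine le_trans (le_of_eq ?_) ih
      apply Finset.sum_congr rfl
      intro m _
      rw [(W_cc_not hN m).1]

theorem dense2 {σ : ℝ} (hσ : 0 < σ) (T X N : ℕ) (hA : A σ N ≤ Real.log X) :
    ∑ m ∈ B T X N, (m : ℝ) ^ (-σ) * W σ (cc T N m) * (Real.log m - A σ (cc T N m)) ≤ 0 := by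
  induction N with
  | zero =>
    apply Finset.sum_nonpos
    intro m hm
    have := B_zero T X hm
    rw [Finset.mem_singleton] at this
    subst this
    simp [cc, A, Nat.primesBelow]
  | succ N ih =>
    have hA' : A σ N ≤ Real.log X := (A_mono hσ (Nat.le_succ N)).trans hA
    by_cases hN : N.Prime
    · rw [sum_B_succ hN]
      refine le_trans (Finset.sum_le_sum ?_) (ih hA')
      intro m hm
      obtain ⟨hx0, hx1⟩ := prime_rpow_neg hσ hN
      have hm' := mem_B.mp hm
      have hm0 : (0 : ℝ) < m := by exact_mod_cast hm'.1.1
      have hN0 : (0 : ℝ) < N := by exact_mod_cast hN.pos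
      have hX0 : (0 : ℝ) < X := by exact_mod_cast (lt_of_lt_of_le hm'.1.1 hm'.1.2)
      by_cases hT : N ≤ T * m
      · have hA2 : Real.log N / ((N : ℝ) ^ σ - 1) =
            Real.log N * (N : ℝ) ^ (-σ) / (1 - (N : ℝ) ^ (-σ)) := by
          rw [Real.rpow_neg hN0.le]
          have := prime_rpow hσ hN
          have h3 : (N : ℝ) ^ σ - 1 ≠ 0 := by linarith
          field_simp
        have e : ∀ a ∈ Finset.range (kk T X N m), ((N ^ a * m : ℕ) : ℝ) ^ (-σ) *
            W σ (cc T (N + 1) (N ^ a * m)) *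
            (Real.log (N ^ a * m : ℕ) - A σ (cc T (N + 1) (N ^ a * m))) =
            ((m : ℝ) ^ (-σ) * W σ N) *
              (((N : ℝ) ^ (-σ)) ^ a * (1 - (N : ℝ) ^ (-σ)) * ((Real.log m - A σ N) + a * Real.log N
                - Real.log N * (N : ℝ) ^ (-σ) / (1 - (N : ℝ) ^ (-σ)))) := by
          intro a _
          rw [rpow_term, (cc_lift hN hT a).2, W_succ_prime σ hN, A_succ_prime σ hN, hA2]
          have : Real.log (N ^ a * m : ℕ) = Real.log m + a * Real.log N := by
            push_cast
            rw [Real.log_mul (by positivity) (by positivity), Real.log_pow]; ring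
          rw [this]
          ring
        rw [Finset.sum_congr rfl e, ← Finset.mul_sum, geom2 hx1, (cc_lift hN hT 0).1]
        have h1 : 0 ≤ (m : ℝ) ^ (-σ) * W σ N := mul_nonneg (by positivity) (W_pos hσ _).le
        have h2 : 0 ≤ ((N : ℝ) ^ (-σ)) ^ (kk T X N m) := by positivity
        have h3 : 0 ≤ (Real.log m - A σ N) + (kk T X N m) * Real.log N := by
          have h4 : (X : ℝ) ≤ (N : ℝ) ^ (kk T X N m) * m := by
            unfold kk
            rw [if_pos hT]
            have h5 : X / m < N ^ (Nat.log N (X / m) + 1) := Nat.lt_pow_succ_log_self hN.one_lt _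
            have h6 : X < N ^ (Nat.log N (X / m) + 1) * m := (Nat.div_lt_iff_lt_mul hm'.1.1).mp h5
            exact_mod_cast h6.le
          have h5 := Real.log_le_log hX0 h4
          rw [Real.log_mul (by positivity) (by positivity), Real.log_pow] at h5
          linarith
        have h4 := mul_nonneg h2 h3
        nlinarith
      · have : kk T X N m = 1 := by unfold kk; rw [if_neg hT]
        rw [this, Finset.sum_range_one, pow_zero, one_mul, cc_same hT]
    · rw [B_succ_not hN]
      refine le_trans (le_of_eq ?_) (ih hA')
      apply Finset.sum_congr rfl
      intro m _
      rw [(W_cc_not hN m).1, (W_cc_not hN m).2]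

end PP

namespace PP

lemma sm_pos (m r : ℕ) : 0 < sm m r := by
  unfold sm
  apply Finset.prod_pos
  intro p hp
  exact pow_pos (Nat.prime_of_mem_primesBelow hp).pos _

lemma BT_of_le {T m : ℕ} (hm : m ≠ 0) (h : m ≤ T) : BT T m := by
  refine ⟨hm, fun r _ hrm => ?_⟩
  have h1 := Nat.le_of_dvd (Nat.pos_of_ne_zero hm) hrm
  exact (h1.trans h).trans (Nat.le_mul_of_pos_right T (sm_pos m r))

lemma smooth_sum {σ : ℝ} (hσ : 0 < σ) (N : ℕ) (S : Finset ℕ)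
    (hS : ∀ m ∈ S, m ∈ Nat.smoothNumbers N) :
    (∑ m ∈ S, (m : ℝ) ^ (-σ)) * W σ N ≤ 1 := by
  set X := S.sup id with hX
  have h := dense1 hσ (X + N) X N
  refine le_trans ?_ h
  rw [Finset.sum_mul]
  have hle : ∀ m ∈ S, m ≤ X := fun m hm => Finset.le_sup (f := id) hm
  have hsub : S ⊆ B (X + N) X N := by
    intro m hm
    have h0 := Nat.ne_zero_of_mem_smoothNumbers (hS m hm)
    have := hle m hm
    rw [mem_B]
    exact ⟨⟨by omega, this⟩, BT_of_le h0 (by omega), hS m hm⟩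
  refine le_trans (Finset.sum_le_sum ?_) (Finset.sum_le_sum_of_subset_of_nonneg hsub
    (fun m _ _ => mul_nonneg (by positivity) (W_pos hσ _).le))
  intro m hm
  have h0 := Nat.ne_zero_of_mem_smoothNumbers (hS m hm)
  have h1 : X + N ≤ (X + N) * m := Nat.le_mul_of_pos_right _ (Nat.pos_of_ne_zero h0)
  have : cc (X + N) N m = N := by
    unfold cc; omega
  rw [this]

lemma W1_upper (Y : ℕ) (hY : 1 ≤ Y) : Real.log Y * W 1 (Y + 1) ≤ 1 := by
  have h := smooth_sum (σ := 1) one_pos (Y + 1) (Finset.Icc 1 Y) (by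
    intro m hm
    rw [Finset.mem_Icc] at hm
    rw [Nat.mem_smoothNumbers']
    intro p hp hpm
    have := Nat.le_of_dvd (by omega) hpm
    omega)
  refine le_trans (mul_le_mul_of_nonneg_right ?_ (W_pos one_pos _).le) h
  have h1 := log_add_one_le_harmonic Y
  have h2 : (harmonic Y : ℝ) = ∑ m ∈ Finset.Icc 1 Y, (m : ℝ) ^ (-(1 : ℝ)) := by
    rw [harmonic_eq_sum_Icc]
    push_cast
    apply Finset.sum_congr rfl
    intro m _
    rw [Real.rpow_neg_one]
  rw [← h2]
  refine le_trans (Real.log_le_log (by exact_mod_cast hY) (by push_cast; linarith)) h1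

lemma lemmaD (K : ℝ) (hK : 1 ≤ K) : ∃ C L0 : ℝ, 0 < C ∧ 1 ≤ L0 ∧ ∀ T : ℕ, 1 ≤ T → ∀ Λ : ℝ, L0 ≤ Λ →
    ∀ S : Finset ℕ, (∀ m ∈ S, BT T m ∧ Λ ≤ Real.log m ∧ Real.log m ≤ K * Λ) →
    ∑ m ∈ S, (m : ℝ)⁻¹ ≤ C * (1 + Real.log T) := by
  obtain ⟨CA, hCA, hshift⟩ := A_shift
  obtain ⟨C2, hC2, hM⟩ := mertens
  refine ⟨Real.exp (6 * K) * (1 + C2), 6 * CA + 6, by positivity, by linarith, ?_⟩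
  intro T hT Λ hΛ S hS
  have hΛ0 : 0 < Λ := by linarith
  have hTlog : 0 ≤ Real.log T := Real.log_natCast_nonneg T
  set s := 6 / Λ with hs
  have hs0 : 0 < s := by positivity
  set X := ⌊Real.exp (K * Λ)⌋₊ with hX
  have hXlog : Λ - 1 ≤ Real.log X := by
    have h1 : Real.exp (K * Λ) < X + 1 := Nat.lt_floor_add_one _
    have h2 : Real.exp (Λ - 1) ≤ X := by
      have h3 : Real.exp Λ ≤ Real.exp (K * Λ) := Real.exp_le_exp.mpr (by nlinarith)
      have h4 : Real.exp Λ = Real.exp 1 * Real.exp (Λ - 1) := by rw [← Real.exp_add]; ring_nf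
      have h5 : 1 ≤ Real.exp (Λ - 1) := Real.one_le_exp (by linarith)
      have h6 : 2 ≤ Real.exp 1 := by have := Real.add_one_le_exp 1; linarith
      nlinarith
    calc Λ - 1 = Real.log (Real.exp (Λ - 1)) := (Real.log_exp _).symm
      _ ≤ _ := Real.log_le_log (Real.exp_pos _) h2
  set N := T * X + 2 with hN
  have h2s : 2 / s = Λ / 3 := by rw [hs]; field_simp; norm_num
  have hAN : ∀ n, A (1 + s) n ≤ CA + Λ / 3 := by
    intro n
    have := hshift s hs0 n
    rwa [h2s] at this
  have hσ : 0 < 1 + s := by linarith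
  have d1 := dense1 hσ T X N
  have d2 := dense2 hσ T X N ((hAN N).trans (by linarith))
  have hsub : S ⊆ B T X N := by
    intro m hm
    obtain ⟨h1, h2, h3⟩ := hS m hm
    have hm0 : (0 : ℝ) < m := by exact_mod_cast Nat.pos_of_ne_zero h1.1
    have hmX : m ≤ X := by
      apply Nat.le_floor
      rw [← Real.exp_log hm0]
      exact Real.exp_le_exp.mpr h3
    rw [mem_B]
    refine ⟨⟨Nat.pos_of_ne_zero h1.1, hmX⟩, h1, ?_⟩
    rw [Nat.mem_smoothNumbers']
    intro p hp hpm
    have := Nat.le_of_dvd (Nat.pos_of_ne_zero h1.1) hpm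
    have : X ≤ T * X := Nat.le_mul_of_pos_left X hT
    omega
  have hpt : ∀ m ∈ B T X N, (if m ∈ S then (m : ℝ)⁻¹ * (Real.exp (-(6 * K))) else 0) -
      (m : ℝ) ^ (-(1 + s)) * W (1 + s) (cc T N m) * (Real.log T + C2) ≤
      (m : ℝ) ^ (-(1 + s)) * W (1 + s) (cc T N m) * (Real.log m - A (1 + s) (cc T N m)) := by
    intro m hm
    have hm' := mem_B.mp hm
    have hm0 : (0 : ℝ) < m := by exact_mod_cast hm'.1.1
    have hT0 : (0 : ℝ) < T := by exact_mod_cast hT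
    have hcc : cc T N m = T * m + 1 := by
      unfold cc
      have : T * m ≤ T * X := Nat.mul_le_mul_left _ hm'.1.2
      omega
    rw [hcc]
    have hA1 : A (1 + s) (T * m + 1) ≤ Real.log T + Real.log m + C2 := by
      have h1 := A_anti (σ := 1 + s) (σ' := 1) one_pos (by linarith) (T * m + 1)
      have h2 := hM (T * m) (Nat.mul_pos hT hm'.1.1)
      push_cast at h2
      rw [Real.log_mul hT0.ne' hm0.ne'] at h2
      linarith
    set w := (m : ℝ) ^ (-(1 + s)) * W (1 + s) (T * m + 1) with hw
    have hw0 : 0 ≤ w := mul_nonneg (by positivity) (W_pos hσ _).le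
    split_ifs with hmS
    · obtain ⟨h1, h2, h3⟩ := hS m hmS
      have h4 := hAN (T * m + 1)
      have h5 : Λ / 2 ≤ Real.log m - A (1 + s) (T * m + 1) := by linarith
      have h6 : (m : ℝ)⁻¹ * Real.exp (-(6 * K)) ≤ (m : ℝ) ^ (-(1 + s)) := by
        rw [show -(1 + s) = -1 + -s by ring, Real.rpow_add hm0, Real.rpow_neg_one]
        apply mul_le_mul_of_nonneg_left _ (by positivity)
        rw [Real.rpow_def_of_pos hm0]
        apply Real.exp_le_exp.mpr
        have : Real.log m * s ≤ 6 * K := by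
          rw [hs, mul_div_assoc', div_le_iff₀ hΛ0]
          nlinarith
        linarith
      have h7 : 2 / Λ ≤ W (1 + s) (T * m + 1) := by
        refine le_trans ?_ (W_zeta hs0 _)
        rw [hs, show 6 / Λ / (1 + 6 / Λ) = 6 / (Λ + 6) by field_simp]
        rw [div_le_div_iff₀ hΛ0 (by linarith)]
        linarith
      have h8 : (m : ℝ)⁻¹ * Real.exp (-(6 * K)) * (2 / Λ) ≤ w :=
        mul_le_mul h6 h7 (by positivity) (by positivity)
      have h9 : (m : ℝ)⁻¹ * Real.exp (-(6 * K)) ≤ w * (Λ / 2) := by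
        calc _ = (m : ℝ)⁻¹ * Real.exp (-(6 * K)) * (2 / Λ) * (Λ / 2) := by field_simp
          _ ≤ _ := mul_le_mul_of_nonneg_right h8 (by linarith)
      have h10 := mul_le_mul_of_nonneg_left h5 hw0
      have h11 : 0 ≤ w * (Real.log T + C2) := by positivity
      linarith
    · nlinarith
  have hsum := (Finset.sum_le_sum hpt).trans d2
  rw [Finset.sum_sub_distrib, ← Finset.sum_mul, Finset.sum_ite_mem,
    Finset.inter_eq_right.mpr hsub, ← Finset.sum_mul] at hsum
  have h1 : (∑ m ∈ S, (m : ℝ)⁻¹) * Real.exp (-(6 * K)) ≤ Real.log T + C2 := by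
    have : 0 ≤ Real.log T + C2 := by positivity
    nlinarith
  rw [Real.exp_neg, ← div_eq_mul_inv, div_le_iff₀ (Real.exp_pos _)] at h1
  have h2 : Real.log T + C2 ≤ (1 + C2) * (1 + Real.log T) := by nlinarith
  have h3 := Real.exp_pos (6 * K)
  nlinarith

lemma sum_inv_le (S : Finset ℕ) (L : ℝ) (hS : ∀ m ∈ S, m ≠ 0 ∧ Real.log m ≤ L) (hL : 0 ≤ L) :
    ∑ m ∈ S, (m : ℝ)⁻¹ ≤ 1 + L := by
  have h1 : S ⊆ Finset.Icc 1 ⌊Real.exp L⌋₊ := by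
    intro m hm
    obtain ⟨h0, h1⟩ := hS m hm
    rw [Finset.mem_Icc]
    have hm0 : (0 : ℝ) < m := by exact_mod_cast Nat.pos_of_ne_zero h0
    refine ⟨Nat.pos_of_ne_zero h0, Nat.le_floor ?_⟩
    rw [← Real.exp_log hm0]
    exact Real.exp_le_exp.mpr h1
  have h2 := harmonic_le_one_add_log ⌊Real.exp L⌋₊
  rw [harmonic_eq_sum_Icc] at h2
  push_cast at h2
  have h3 : Real.log ⌊Real.exp L⌋₊ ≤ L := by
    have h4 : (1 : ℝ) ≤ ⌊Real.exp L⌋₊ := by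
      have : 1 ≤ ⌊Real.exp L⌋₊ := Nat.le_floor (by simpa using hL)
      exact_mod_cast this
    calc _ ≤ Real.log (Real.exp L) :=
          Real.log_le_log (by linarith) (Nat.floor_le (Real.exp_pos L).le)
      _ = L := Real.log_exp L
  calc _ ≤ ∑ m ∈ Finset.Icc 1 ⌊Real.exp L⌋₊, (m : ℝ)⁻¹ :=
        Finset.sum_le_sum_of_subset_of_nonneg h1 (fun m _ _ => by positivity)
    _ ≤ _ := by linarith

lemma log_sum_aux {C L0 : ℝ} (hC : 0 < C) (hL0 : 1 ≤ L0) (T : ℕ)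
    (hD : ∀ Λ : ℝ, L0 ≤ Λ →
    ∀ S : Finset ℕ, (∀ m ∈ S, BT T m ∧ Λ ≤ Real.log m ∧ Real.log m ≤ 2 * Λ) →
    ∑ m ∈ S, (m : ℝ)⁻¹ ≤ C * (1 + Real.log T)) (j : ℕ) :
    ∀ S : Finset ℕ, (∀ m ∈ S, BT T m ∧ Real.log m ≤ L0 * 2 ^ j) →
    ∑ m ∈ S, (m : ℝ)⁻¹ * Real.log m ≤ L0 * (1 + L0) + 2 * (C * (1 + Real.log T)) * (L0 * 2 ^ j) := by
  have hTlog : 0 ≤ Real.log T := Real.log_natCast_nonneg T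
  induction j with
  | zero =>
    intro S hS
    have h1 := sum_inv_le S L0 (fun m hm => ⟨(hS m hm).1.1, by simpa using (hS m hm).2⟩) (by linarith)
    have h2 : ∑ m ∈ S, (m : ℝ)⁻¹ * Real.log m ≤ ∑ m ∈ S, (m : ℝ)⁻¹ * L0 := by
      apply Finset.sum_le_sum
      intro m hm
      apply mul_le_mul_of_nonneg_left _ (by positivity)
      simpa using (hS m hm).2
    rw [← Finset.sum_mul] at h2
    have h3 : 0 ≤ 2 * (C * (1 + Real.log T)) * (L0 * 2 ^ 0) := by positivity
    nlinarith
  | succ j ih =>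
    intro S hS
    set Λ := L0 * 2 ^ j with hΛ
    have hΛL : L0 ≤ Λ := by
      have : (1 : ℝ) ≤ 2 ^ j := one_le_pow₀ (by norm_num)
      nlinarith
    have e : L0 * 2 ^ (j + 1) = 2 * Λ := by rw [hΛ]; ring
    rw [e] at hS ⊢
    rw [← Finset.sum_filter_add_sum_filter_not S (fun m : ℕ => Real.log m ≤ Λ)]
    have h1 := ih (S.filter (fun m : ℕ => Real.log m ≤ Λ)) (by
      intro m hm
      rw [Finset.mem_filter] at hm
      exact ⟨(hS m hm.1).1, hm.2⟩)
    have h2 := hD Λ hΛL (S.filter (fun m : ℕ => ¬ Real.log m ≤ Λ)) (by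
      intro m hm
      rw [Finset.mem_filter] at hm
      exact ⟨(hS m hm.1).1, (not_le.mp hm.2).le, (hS m hm.1).2⟩)
    have h3 : ∑ m ∈ S.filter (fun m : ℕ => ¬ Real.log m ≤ Λ), (m : ℝ)⁻¹ * Real.log m ≤
        ∑ m ∈ S.filter (fun m : ℕ => ¬ Real.log m ≤ Λ), (m : ℝ)⁻¹ * (2 * Λ) := by
      apply Finset.sum_le_sum
      intro m hm
      rw [Finset.mem_filter] at hm
      exact mul_le_mul_of_nonneg_left (hS m hm.1).2 (by positivity)
    rw [← Finset.sum_mul] at h3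
    have : 0 ≤ 2 * Λ := by linarith
    nlinarith

lemma log_sum (K : ℝ) (hK : 1 ≤ K) : ∃ C : ℝ, 0 < C ∧ ∀ T : ℕ, 1 ≤ T → ∀ Y : ℕ, 2 ≤ Y →
    ∀ S : Finset ℕ, (∀ m ∈ S, BT T m ∧ Real.log m ≤ K * Real.log Y) →
    ∑ m ∈ S, (m : ℝ)⁻¹ * (Real.log T + Real.log m) ≤ C * (1 + Real.log T) * Real.log Y := by
  obtain ⟨C, L0, hC, hL0, hD⟩ := lemmaD 2 (by norm_num)
  refine ⟨(2 + K) + 2 * (L0 * (1 + L0)) + 2 * C * (2 * L0 + 2 * K), by positivity, ?_⟩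
  intro T hT Y hY S hS
  have hl := (dl_facts hY).1
  have hTlog : 0 ≤ Real.log T := Real.log_natCast_nonneg T
  have h1 := sum_inv_le S (K * Real.log Y) (fun m hm => ⟨(hS m hm).1.1, (hS m hm).2⟩) (by positivity)
  obtain ⟨j, hj1, hj2⟩ : ∃ j : ℕ, K * Real.log Y ≤ L0 * 2 ^ j ∧ L0 * 2 ^ j ≤ L0 + 2 * K * Real.log Y := by
    by_cases h : K * Real.log Y ≤ L0
    · refine ⟨0, by simpa using h, ?_⟩
      simp only [pow_zero, mul_one]
      have : 0 ≤ 2 * K * Real.log Y := by positivity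
      linarith
    · push Not at h
      obtain ⟨n, hn1, hn2⟩ := exists_nat_pow_near (x := K * Real.log Y / L0) (y := 2)
        (by rw [le_div_iff₀ (by linarith)]; linarith) (by norm_num)
      rw [le_div_iff₀ (by linarith)] at hn1
      rw [div_lt_iff₀ (by linarith)] at hn2
      refine ⟨n + 1, by linarith, ?_⟩
      rw [pow_succ]
      nlinarith
  have h2 := log_sum_aux hC hL0 T (hD T hT) j S (fun m hm => ⟨(hS m hm).1, (hS m hm).2.trans hj1⟩)
  have h3 : ∑ m ∈ S, (m : ℝ)⁻¹ * (Real.log T + Real.log m) =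
      (∑ m ∈ S, (m : ℝ)⁻¹) * Real.log T + ∑ m ∈ S, (m : ℝ)⁻¹ * Real.log m := by
    rw [Finset.sum_mul, ← Finset.sum_add_distrib]
    apply Finset.sum_congr rfl
    intro m _; ring
  rw [h3]
  set l := Real.log Y
  set t := Real.log T
  have h4 : (∑ m ∈ S, (m : ℝ)⁻¹) * t ≤ (2 + K) * (1 + t) * l := by
    calc _ ≤ (1 + K * l) * t := mul_le_mul_of_nonneg_right h1 hTlog
      _ ≤ (2 * l + K * l) * t := mul_le_mul_of_nonneg_right (by linarith) hTlog
      _ = (2 + K) * t * l := by ring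
      _ ≤ _ := by
        apply mul_le_mul_of_nonneg_right _ (by linarith)
        apply mul_le_mul_of_nonneg_left (by linarith) (by linarith)
  have h5 : L0 * (1 + L0) ≤ 2 * (L0 * (1 + L0)) * (1 + t) * l := by
    have h0 : 0 ≤ L0 * (1 + L0) := by positivity
    have : 1 ≤ 2 * ((1 + t) * l) := by nlinarith
    nlinarith
  have h6 : 2 * (C * (1 + t)) * (L0 * 2 ^ j) ≤ 2 * C * (2 * L0 + 2 * K) * (1 + t) * l := by
    have h0 : 0 ≤ 2 * (C * (1 + t)) := by positivity
    have h7 : L0 * 2 ^ j ≤ (2 * L0 + 2 * K) * l := by nlinarith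
    calc _ ≤ 2 * (C * (1 + t)) * ((2 * L0 + 2 * K) * l) := mul_le_mul_of_nonneg_left h7 h0
      _ = _ := by ring
  linarith

set_option maxHeartbeats 1000000 in
lemma lemmaE : ∃ C V0 : ℝ, 0 < C ∧ 1 ≤ V0 ∧ ∀ T : ℕ, 1 ≤ T → ∀ Y : ℕ, 2 ≤ Y → ∀ Z : ℝ,
    V0 * Real.log Y ≤ Z → ∀ S : Finset ℕ,
    (∀ m ∈ S, BT T m ∧ m ∈ Nat.smoothNumbers (Y + 1) ∧ Z ≤ Real.log m) →
    ∑ m ∈ S, (m : ℝ)⁻¹ ≤ C * (1 + Real.log T) * Real.exp (-(Z / (4 * Real.log Y))) := by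
  obtain ⟨C2, hC2, hM⟩ := mertens
  obtain ⟨c, hc, hW⟩ := Wσ_lower
  set C4 := 2 + 4 * C2 with hC4
  obtain ⟨CS, hCS, hlog⟩ := log_sum C4 (by linarith)
  set D := (1 + 2 * C2) + Real.exp (C4 / 4) * CS with hD
  have hD0 : 0 < D := by positivity
  refine ⟨D / (c * C4), 2 * C4, by positivity, by linarith, ?_⟩
  intro T hT Y hY Z hZ S hS
  obtain ⟨hl, hd0, hd1, hd2⟩ := dl_facts hY
  have hTlog : 0 ≤ Real.log T := Real.log_natCast_nonneg T
  rcases S.eq_empty_or_nonempty with rfl | ⟨m0, hm0⟩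
  · simp only [Finset.sum_empty]; positivity
  set X := S.sup id with hX
  have hle : ∀ m ∈ S, m ≤ X := fun m hm => Finset.le_sup (f := id) hm
  have hσ : 0 < 1 - dl Y := by linarith
  have hAY : A (1 - dl Y) (Y + 1) ≤ C4 * Real.log Y := by
    have h1 := A_below hY le_rfl
    have h2 : 1 + 4 * dl Y * Real.log Y = 2 := by rw [mul_assoc, hd2]; norm_num
    rw [h2] at h1
    have h3 := hM Y (by omega)
    rw [hC4]
    nlinarith
  have hZX : Z ≤ Real.log X := by
    refine (hS m0 hm0).2.2.trans (Real.log_le_log ?_ (by exact_mod_cast hle m0 hm0))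
    exact_mod_cast Nat.pos_of_ne_zero (hS m0 hm0).1.1
  have hC4l : 0 ≤ C4 * Real.log Y := by positivity
  have d1 := dense1 hσ T X (Y + 1)
  have d2 := dense2 hσ T X (Y + 1) (by linarith)
  have hsub : S ⊆ B T X (Y + 1) := by
    intro m hm
    obtain ⟨h1, h2, h3⟩ := hS m hm
    rw [mem_B]
    exact ⟨⟨Nat.pos_of_ne_zero h1.1, hle m hm⟩, h1, h2⟩
  set E := Real.exp (Z / (4 * Real.log Y)) with hE
  set S' := (B T X (Y + 1)).filter (fun m : ℕ => Real.log m ≤ C4 * Real.log Y) with hS'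
  have hpt : ∀ m ∈ B T X (Y + 1), (if m ∈ S then (m : ℝ)⁻¹ * (E * c * C4) else 0) -
      (m : ℝ) ^ (-(1 - dl Y)) * W (1 - dl Y) (cc T (Y + 1) m) * (Real.log T + 2 * C2) -
      (if m ∈ S' then (m : ℝ)⁻¹ * (Real.log T + Real.log m) * (Real.exp (C4 / 4) * (4 * dl Y)) else 0)
      ≤ (m : ℝ) ^ (-(1 - dl Y)) * W (1 - dl Y) (cc T (Y + 1) m) *
        (Real.log m - A (1 - dl Y) (cc T (Y + 1) m)) := by
    intro m hm
    have hm' := mem_B.mp hm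
    have hm0 : (0 : ℝ) < m := by exact_mod_cast hm'.1.1
    have hm1 : (1 : ℝ) ≤ m := by exact_mod_cast hm'.1.1
    have hlm : 0 ≤ Real.log m := Real.log_nonneg hm1
    have hT0 : (0 : ℝ) < T := by exact_mod_cast hT
    set θ := min Y (T * m) with hθ
    have hcc : cc T (Y + 1) m = θ + 1 := by
      unfold cc; omega
    rw [hcc]
    have hθ1 : 1 ≤ θ := by
      have : 0 < T * m := Nat.mul_pos hT hm'.1.1
      omega
    have hθY : θ ≤ Y := min_le_left _ _
    have hθ0 : (0 : ℝ) < θ := by exact_mod_cast hθ1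
    have hlθ : 0 ≤ Real.log θ := Real.log_natCast_nonneg θ
    have hlθY : Real.log θ ≤ Real.log Y := Real.log_le_log hθ0 (by exact_mod_cast hθY)
    have hlθT : Real.log θ ≤ Real.log T + Real.log m := by
      rw [← Real.log_mul hT0.ne' hm0.ne']
      apply Real.log_le_log hθ0
      have : θ ≤ T * m := min_le_right _ _
      exact_mod_cast this
    set w := (m : ℝ) ^ (-(1 - dl Y)) * W (1 - dl Y) (θ + 1) with hw
    have hw0 : 0 ≤ w := mul_nonneg (by positivity) (W_pos hσ _).le
    have hrp : (m : ℝ) ^ (-(1 - dl Y)) = (m : ℝ)⁻¹ * Real.exp (dl Y * Real.log m) := by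
      rw [show -(1 - dl Y) = -1 + dl Y by ring, Real.rpow_add hm0, Real.rpow_neg_one,
        Real.rpow_def_of_pos hm0, mul_comm (Real.log (m : ℝ))]
    have hAθ : A (1 - dl Y) (θ + 1) ≤ C4 * Real.log Y :=
      (A_mono hσ (by omega)).trans hAY
    have hge : (if m ∈ S' then (m : ℝ)⁻¹ * (Real.log T + Real.log m) * (Real.exp (C4 / 4) * (4 * dl Y)) else 0)
        ≥ 0 := by
      split_ifs
      · positivity
      · exact le_rfl
    have hDw : 0 ≤ w * (Real.log T + 2 * C2) := by positivity
    by_cases hmS : m ∈ S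
    · rw [if_pos hmS]
      obtain ⟨h1, h2, h3⟩ := hS m hmS
      have h5 : Z / 2 ≤ Real.log m - A (1 - dl Y) (θ + 1) := by linarith
      have h6 : (m : ℝ)⁻¹ * E ≤ (m : ℝ) ^ (-(1 - dl Y)) := by
        rw [hrp]
        apply mul_le_mul_of_nonneg_left _ (by positivity)
        apply Real.exp_le_exp.mpr
        have : Z / (4 * Real.log Y) = dl Y * Z := by unfold dl; ring
        rw [this]
        exact mul_le_mul_of_nonneg_left h3 hd0.le
      have h7 : c / Real.log Y ≤ W (1 - dl Y) (θ + 1) :=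
        (hW Y hY).trans (W_anti hσ (by omega))
      have h8 : (m : ℝ)⁻¹ * E * (c / Real.log Y) ≤ w :=
        mul_le_mul h6 h7 (by positivity) (by positivity)
      have h9 : (m : ℝ)⁻¹ * (E * c * C4) ≤ w * (Z / 2) := by
        calc _ = (m : ℝ)⁻¹ * E * (c / Real.log Y) * (C4 * Real.log Y) := by field_simp
          _ ≤ w * (Z / 2) := mul_le_mul h8 (by linarith) hC4l hw0
      have h10 := mul_le_mul_of_nonneg_left h5 hw0
      linarith
    · rw [if_neg hmS]
      by_cases hcmp : A (1 - dl Y) (θ + 1) ≤ Real.log m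
      · have : 0 ≤ w * (Real.log m - A (1 - dl Y) (θ + 1)) := mul_nonneg hw0 (by linarith)
        linarith
      · push Not at hcmp
        have hmS' : m ∈ S' := by
          rw [hS', Finset.mem_filter]
          exact ⟨hm, by linarith⟩
        rw [if_pos hmS']
        have h1 := A_below hY hθY
        have h2 := hM θ hθ1
        have h3 : 4 * dl Y * Real.log θ ≤ 1 := by
          have := mul_le_mul_of_nonneg_left hlθY hd0.le
          linarith
        have h3' : 0 ≤ 4 * dl Y * Real.log θ := by positivity
        have h4 : A (1 - dl Y) (θ + 1) ≤ Real.log θ + 2 * C2 + 4 * dl Y * Real.log θ * Real.log θ := by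
          calc _ ≤ _ := h1
            _ ≤ (Real.log θ + C2) * (1 + 4 * dl Y * Real.log θ) :=
              mul_le_mul_of_nonneg_right h2 (by linarith)
            _ = Real.log θ + C2 + C2 * (4 * dl Y * Real.log θ) +
              4 * dl Y * Real.log θ * Real.log θ := by ring
            _ ≤ _ := by
              have := mul_le_mul_of_nonneg_left h3 hC2
              linarith
        have h5 : A (1 - dl Y) (θ + 1) - Real.log m ≤ (Real.log T + 2 * C2) +
            4 * dl Y * Real.log θ * Real.log θ := by linarith
        have h6 : W (1 - dl Y) (θ + 1) * Real.log θ ≤ 1 := by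
          have e1 := W_mono_sigma (σ := 1) (σ' := 1 - dl Y) hσ (by linarith) (θ + 1)
          have e2 := W1_upper θ hθ1
          have e3 := mul_le_mul_of_nonneg_right e1 hlθ
          linarith
        have h7 : (m : ℝ) ^ (-(1 - dl Y)) ≤ (m : ℝ)⁻¹ * Real.exp (C4 / 4) := by
          rw [hrp]
          apply mul_le_mul_of_nonneg_left _ (by positivity)
          apply Real.exp_le_exp.mpr
          have : Real.log m ≤ C4 * Real.log Y := by linarith
          calc _ ≤ dl Y * (C4 * Real.log Y) := mul_le_mul_of_nonneg_left this hd0.le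
            _ = C4 * (dl Y * Real.log Y) := by ring
            _ = C4 / 4 := by rw [hd2]; ring
        have h8 : w * Real.log θ ≤ (m : ℝ)⁻¹ * Real.exp (C4 / 4) := by
          calc w * Real.log θ = (m : ℝ) ^ (-(1 - dl Y)) * (W (1 - dl Y) (θ + 1) * Real.log θ) := by
                rw [hw]; ring
            _ ≤ (m : ℝ) ^ (-(1 - dl Y)) * 1 := mul_le_mul_of_nonneg_left h6 (by positivity)
            _ ≤ _ := by rw [mul_one]; exact h7
        have h9 : w * (4 * dl Y * Real.log θ * Real.log θ) ≤
            (m : ℝ)⁻¹ * (Real.log T + Real.log m) * (Real.exp (C4 / 4) * (4 * dl Y)) := by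
          calc _ = (w * Real.log θ) * ((4 * dl Y) * Real.log θ) := by ring
            _ ≤ ((m : ℝ)⁻¹ * Real.exp (C4 / 4)) * ((4 * dl Y) * (Real.log T + Real.log m)) := by
                apply mul_le_mul h8 _ (by positivity) (by positivity)
                apply mul_le_mul_of_nonneg_left hlθT (by positivity)
            _ = _ := by ring
        have h10 := mul_le_mul_of_nonneg_left h5 hw0
        linarith
  have hsum := (Finset.sum_le_sum hpt).trans d2
  have hsub' : S' ⊆ B T X (Y + 1) := Finset.filter_subset _ _
  rw [Finset.sum_sub_distrib, Finset.sum_sub_distrib, ← Finset.sum_mul, Finset.sum_ite_mem,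
    Finset.sum_ite_mem, Finset.inter_eq_right.mpr hsub, Finset.inter_eq_right.mpr hsub',
    ← Finset.sum_mul, ← Finset.sum_mul] at hsum
  have hS'sum := hlog T hT Y hY S' (by
    intro m hm
    rw [hS', Finset.mem_filter] at hm
    exact ⟨(mem_B.mp hm.1).2.1, hm.2⟩)
  have h1 : (∑ m ∈ S', (m : ℝ)⁻¹ * (Real.log T + Real.log m)) * (Real.exp (C4 / 4) * (4 * dl Y)) ≤
      Real.exp (C4 / 4) * CS * (1 + Real.log T) := by
    calc _ ≤ (CS * (1 + Real.log T) * Real.log Y) * (Real.exp (C4 / 4) * (4 * dl Y)) :=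
          mul_le_mul_of_nonneg_right hS'sum (by positivity)
      _ = Real.exp (C4 / 4) * CS * (1 + Real.log T) * (4 * (dl Y * Real.log Y)) := by ring
      _ = _ := by rw [hd2]; ring
  have h2 : (∑ m ∈ S, (m : ℝ)⁻¹) * (E * c * C4) ≤ D * (1 + Real.log T) := by
    have h3 : 0 ≤ Real.log T + 2 * C2 := by positivity
    rw [hD]
    nlinarith
  have hEpos : 0 < E := Real.exp_pos _
  rw [Real.exp_neg, ← hE]
  calc _ = (∑ m ∈ S, (m : ℝ)⁻¹) * (E * c * C4) / (E * c * C4) :=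
        (mul_div_cancel_right₀ _ (by
          have : 0 < C4 := by linarith
          positivity)).symm
    _ ≤ D * (1 + Real.log T) / (E * c * C4) := by
      apply div_le_div_of_nonneg_right h2 (by positivity)
    _ = _ := by field_simp

end PP

namespace PP

/-- largest prime factor -/
def lp (n : ℕ) : ℕ := n.primeFactors.sup id

lemma lp_max {n r : ℕ} (hn : n ≠ 0) (hr : r.Prime) (hd : r ∣ n) : r ≤ lp n := by
  exact Finset.le_sup (f := id) (Nat.mem_primeFactors.mpr ⟨hr, hd, hn⟩)

lemma lp_prime {n : ℕ} (hn : 2 ≤ n) : (lp n).Prime ∧ lp n ∣ n := by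
  have hne : n.primeFactors.Nonempty := Nat.nonempty_primeFactors.mpr (by omega)
  obtain ⟨q, hq, he⟩ := Finset.exists_mem_eq_sup n.primeFactors hne id
  have : lp n = q := he
  rw [this]
  exact ⟨Nat.prime_of_mem_primeFactors hq, Nat.dvd_of_mem_primeFactors hq⟩

lemma lp_facts {T n : ℕ} (hn : 2 ≤ n) (hB : BT T n) :
    lp n * (n / lp n) = n ∧ n / lp n ≠ 0 ∧ BT T (n / lp n) ∧
      n / lp n ∈ Nat.smoothNumbers (lp n + 1) ∧ lp n ≤ T * (n / lp n) := by
  obtain ⟨hP, hPn⟩ := lp_prime hn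
  have hmul : lp n * (n / lp n) = n := Nat.mul_div_cancel' hPn
  have hmax : ∀ r, r.Prime → r ∣ n → r ≤ lp n := fun r hr hd => lp_max (by omega) hr hd
  generalize lp n = P at *
  generalize hm : n / P = m at *
  have hm0 : m ≠ 0 := by
    rintro rfl
    omega
  have hfac : ∀ p, p.Prime → p ≠ P → n.factorization p = m.factorization p := by
    intro p hp hpP
    have := fact_mul_pow (a := 1) hP hm0 hp hpP
    rwa [pow_one, hmul] at this
  have hmn : m ∣ n := Dvd.intro_left P hmul
  refine ⟨hmul, hm0, ⟨hm0, ?_⟩, ?_, ?_⟩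
  · intro r hr hrm
    have h1 := hmax r hr (hrm.trans hmn)
    rw [← sm_congr (m := n) (fun p hp hpr => hfac p hp (by omega))]
    exact hB.2 r hr (hrm.trans hmn)
  · rw [Nat.mem_smoothNumbers']
    intro r hr hrm
    have h1 := hmax r hr (hrm.trans hmn)
    omega
  · have h1 := hB.2 P hP hPn
    rw [sm_congr (m' := m) (fun p hp hpr => hfac p hp (by omega))] at h1
    exact h1.trans (Nat.mul_le_mul_left _ (Nat.le_of_dvd (Nat.pos_of_ne_zero hm0) (sm_dvd hm0 P)))

lemma scale_sum : ∃ C L0 : ℝ, 0 < C ∧ 1 ≤ L0 ∧ ∀ T : ℕ, 1 ≤ T → ∀ L : ℝ, L0 ≤ L → ∀ j : ℕ,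
    ∀ Y : ℕ, 2 ≤ Y → 2 ^ j * Real.log Y ≤ L → ∀ S : Finset ℕ,
    (∀ m ∈ S, BT T m ∧ m ∈ Nat.smoothNumbers (Y + 1) ∧ L / 4 ≤ Real.log m ∧ Real.log m ≤ L) →
    (∑ m ∈ S, (m : ℝ)⁻¹) * 2 ^ (j + 1) ≤ C * (1 + Real.log T) * (1 / 2) ^ j := by
  obtain ⟨CD, LD, hCD, hLD, hD⟩ := lemmaD 4 (by norm_num)
  obtain ⟨CE, V0, hCE, hV0, hE⟩ := lemmaE
  refine ⟨CD * (32 * V0 ^ 2) + CE * 1024, 4 * LD, by positivity, by linarith, ?_⟩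
  intro T hT L hL j Y hY hjY S hS
  have hTlog : 0 ≤ Real.log T := Real.log_natCast_nonneg T
  obtain ⟨hl, _⟩ := dl_facts hY
  have h2j : (0 : ℝ) < 2 ^ j := by positivity
  have hhalf : ((1 : ℝ) / 2) ^ j = 1 / 2 ^ j := by rw [div_pow, one_pow]
  rw [hhalf]
  by_cases hj : (2 : ℝ) ^ j ≤ 4 * V0
  · have h1 := hD T hT (L / 4) (by linarith) S (fun m hm =>
      ⟨(hS m hm).1, (hS m hm).2.2.1, by linarith [(hS m hm).2.2.2]⟩)
    have h2 : (2 : ℝ) ^ (j + 1) ≤ 32 * V0 ^ 2 * (1 / 2 ^ j) := by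
      rw [mul_one_div, le_div_iff₀ h2j, pow_succ]
      nlinarith
    calc _ ≤ (CD * (1 + Real.log T)) * (32 * V0 ^ 2 * (1 / 2 ^ j)) := by
          apply mul_le_mul h1 h2 (by positivity) (by positivity)
      _ = CD * (32 * V0 ^ 2) * (1 + Real.log T) * (1 / 2 ^ j) := by ring
      _ ≤ _ := by
          apply mul_le_mul_of_nonneg_right _ (by positivity)
          apply mul_le_mul_of_nonneg_right _ (by linarith)
          linarith
  · push Not at hj
    have h1 := hE T hT Y hY (L / 4) (by nlinarith) S (fun m hm =>
      ⟨(hS m hm).1, (hS m hm).2.1, (hS m hm).2.2.1⟩)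
    have h2 : Real.exp (-(L / 4 / (4 * Real.log Y))) ≤ 512 / (2 ^ j) ^ 2 := by
      have h3 : (2 : ℝ) ^ j / 16 ≤ L / 4 / (4 * Real.log Y) := by
        rw [le_div_iff₀ (by linarith)]
        linarith
      have h4 : Real.exp (-(L / 4 / (4 * Real.log Y))) ≤ Real.exp (-((2 : ℝ) ^ j / 16)) :=
        Real.exp_le_exp.mpr (by linarith)
      refine h4.trans ?_
      have h5 := Real.quadratic_le_exp_of_nonneg (x := (2 : ℝ) ^ j / 16) (by positivity)
      rw [Real.exp_neg, inv_eq_one_div, div_le_div_iff₀ (Real.exp_pos _) (by positivity)]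
      nlinarith
    calc _ ≤ (CE * (1 + Real.log T) * (512 / (2 ^ j) ^ 2)) * 2 ^ (j + 1) := by
          apply mul_le_mul_of_nonneg_right _ (by positivity)
          exact h1.trans (mul_le_mul_of_nonneg_left h2 (by positivity))
      _ = CE * 1024 * (1 + Real.log T) * (1 / 2 ^ j) := by
          rw [pow_succ (2 : ℝ) j]
          generalize (2 : ℝ) ^ j = x at h2j ⊢
          field_simp
          try ring
      _ ≤ _ := by
          apply mul_le_mul_of_nonneg_right _ (by positivity)
          apply mul_le_mul_of_nonneg_right _ (by linarith)
          have : 0 < CD * (32 * V0 ^ 2) := by positivity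
          linarith

lemma half_sum (s : Finset ℕ) : ∑ j ∈ s, ((1 : ℝ) / 2) ^ j ≤ 2 := by
  have h := summable_geometric_two
  have := h.sum_le_tsum s (fun _ _ => by positivity)
  rwa [tsum_geometric_two] at this

theorem lemmaF : ∃ C X0 : ℝ, 0 < C ∧ 3 ≤ X0 ∧ ∀ X : ℝ, X0 ≤ X → ∀ T : ℕ, 1 ≤ T →
    T * Real.log X ≤ √X → ∀ S : Finset ℕ, (∀ n ∈ S, BT T n ∧ (n : ℝ) ≤ X) →
    (S.card : ℝ) ≤ C * X * (1 + Real.log T) / Real.log X := by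
  obtain ⟨Cs, L0, hCs, hL0, hsc⟩ := scale_sum
  obtain ⟨Cp, hCp, hpi⟩ := pi_bound
  refine ⟨1 + Cp * Cs * 2, Real.exp L0 + 3, by positivity, by have := Real.exp_pos L0; linarith, ?_⟩
  intro X hX T hT hTX S hS
  have hX3 : 3 ≤ X := by have := Real.exp_pos L0; linarith
  have hX0 : 0 < X := by linarith
  set L := Real.log X with hL
  have hLL : L0 ≤ L := by
    rw [hL, Real.le_log_iff_exp_le hX0]; linarith
  have hL1 : 1 ≤ L := by linarith
  have hT0 : (0 : ℝ) < T := by exact_mod_cast hT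
  have hTlog : 0 ≤ Real.log T := Real.log_natCast_nonneg T
  -- small part
  set S1 := S.filter (fun n : ℕ => (n : ℝ) ≤ X / L) with hS1
  set S2 := S.filter (fun n : ℕ => ¬ (n : ℝ) ≤ X / L) with hS2
  have hcard : S.card = S1.card + S2.card := (Finset.card_filter_add_card_filter_not _).symm
  have hc1 : (S1.card : ℝ) ≤ X / L := by
    have hsub : S1 ⊆ Finset.Icc 1 ⌊X / L⌋₊ := by
      intro n hn
      rw [hS1, Finset.mem_filter] at hn
      rw [Finset.mem_Icc]
      exact ⟨Nat.pos_of_ne_zero (hS n hn.1).1.1, Nat.le_floor hn.2⟩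
    have h1 := Finset.card_le_card hsub
    rw [Nat.card_Icc] at h1
    have h2 : (S1.card : ℝ) ≤ ⌊X / L⌋₊ := by
      have : S1.card ≤ ⌊X / L⌋₊ := by omega
      exact_mod_cast this
    exact h2.trans (Nat.floor_le (by positivity))
  -- facts for elements of S2
  have hfacts : ∀ n ∈ S2, 2 ≤ n ∧ L / 4 ≤ Real.log (n / lp n : ℕ) ∧ Real.log (n / lp n : ℕ) ≤ L ∧
      BT T n ∧ (n : ℝ) ≤ X := by
    intro n hn
    rw [hS2, Finset.mem_filter, not_le] at hn
    obtain ⟨hnS, hnX⟩ := hn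
    obtain ⟨hB, hnX'⟩ := hS n hnS
    have hXL : 1 ≤ X / L := by
      rw [le_div_iff₀ (by linarith), one_mul]
      have := Real.log_le_sub_one_of_pos hX0
      linarith
    have hn2 : 2 ≤ n := by
      have : (1 : ℝ) < n := by linarith
      have : 1 < n := by exact_mod_cast this
      omega
    obtain ⟨hmul, hm0, hBm, hsmo, hPT⟩ := lp_facts hn2 hB
    have hmpos : (0 : ℝ) < (n / lp n : ℕ) := by exact_mod_cast Nat.pos_of_ne_zero hm0
    have hn0 : (0 : ℝ) < n := by exact_mod_cast (by omega : 0 < n)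
    refine ⟨hn2, ?_, ?_, hB, hnX'⟩
    · have h1 : (n : ℝ) ≤ T * (n / lp n : ℕ) * (n / lp n : ℕ) := by
        have : n ≤ T * (n / lp n) * (n / lp n) := by
          conv_lhs => rw [← hmul]
          exact Nat.mul_le_mul_right _ hPT
        exact_mod_cast this
      have h2 := Real.log_le_log hn0 h1
      rw [Real.log_mul (by positivity) (by positivity), Real.log_mul (by positivity) (by positivity)] at h2
      have h3 := Real.log_le_log (by positivity) hnX.le
      rw [Real.log_div (by positivity) (by positivity), ← hL] at h3
      have h4 := Real.log_le_log (by positivity) hTX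
      rw [Real.log_mul (by positivity) (by positivity), Real.log_sqrt hX0.le, ← hL] at h4
      linarith
    · apply Real.log_le_log hmpos
      refine le_trans ?_ hnX'
      exact_mod_cast Nat.div_le_self n (lp n)
  let jf : ℕ → ℕ := fun n => Nat.log 2 ⌊L / Real.log (lp n)⌋₊
  have hlpX : ∀ n ∈ S2, (lp n).Prime ∧ 0 < Real.log (lp n) ∧ 2 ^ (jf n) * Real.log (lp n) ≤ L ∧
      L < 2 ^ (jf n + 1) * Real.log (lp n) := by
    intro n hn
    obtain ⟨hn2, _, _, hB, hnX'⟩ := hfacts n hn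
    obtain ⟨hP, hPn⟩ := lp_prime hn2
    have hP1 : (1 : ℝ) < lp n := by exact_mod_cast hP.one_lt
    have hlpos : 0 < Real.log (lp n) := Real.log_pos hP1
    have hle : Real.log (lp n) ≤ L := by
      apply Real.log_le_log (by linarith)
      refine le_trans ?_ hnX'
      exact_mod_cast Nat.le_of_dvd (by omega) hPn
    have hfl : 1 ≤ ⌊L / Real.log (lp n)⌋₊ := by
      apply Nat.le_floor
      rw [Nat.cast_one, le_div_iff₀ hlpos]; linarith
    refine ⟨hP, hlpos, ?_, ?_⟩
    · have h1 : 2 ^ (jf n) ≤ ⌊L / Real.log (lp n)⌋₊ := Nat.pow_log_le_self 2 (by omega)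
      rw [← le_div_iff₀ hlpos]
      calc ((2 : ℝ)) ^ (jf n) ≤ (⌊L / Real.log (lp n)⌋₊ : ℝ) := by exact_mod_cast h1
        _ ≤ _ := Nat.floor_le (by positivity)
    · have h1 : ⌊L / Real.log (lp n)⌋₊ < 2 ^ (jf n + 1) := Nat.lt_pow_succ_log_self (by norm_num) _
      rw [← div_lt_iff₀ hlpos]
      have h2 := (Nat.floor_lt (by positivity)).mp h1
      push_cast at h2
      exact h2
  have hj : ∀ j, ((S2.filter (fun n => jf n = j)).card : ℝ) ≤
      (Cp * X / L) * (Cs * (1 + Real.log T)) * (1 / 2) ^ j := by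
    intro j
    set Sj := S2.filter (fun n => jf n = j) with hSj
    have hmem : ∀ n ∈ Sj, n ∈ S2 ∧ jf n = j := fun n hn => by
      rw [hSj, Finset.mem_filter] at hn; exact hn
    rcases Sj.eq_empty_or_nonempty with he | ⟨n0, hn0⟩
    · rw [he]; simp only [Finset.card_empty, Nat.cast_zero]; positivity
    set Y := Sj.sup lp with hY
    have hYle : ∀ n ∈ Sj, lp n ≤ Y := fun n hn => Finset.le_sup (f := lp) hn
    have hYP : 2 ≤ Y ∧ 2 ^ j * Real.log Y ≤ L := by
      obtain ⟨n1, hn1, he⟩ := Finset.exists_mem_eq_sup Sj ⟨n0, hn0⟩ lp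
      have heY : Y = lp n1 := he
      obtain ⟨h1, h2⟩ := hmem n1 hn1
      obtain ⟨a, b, c, d⟩ := hlpX n1 h1
      rw [heY, ← h2]
      exact ⟨a.two_le, c⟩
    have hM := hsc T hT L hLL j Y hYP.1 hYP.2 (Sj.image (fun n => n / lp n)) (by
      intro m hm
      rw [Finset.mem_image] at hm
      obtain ⟨n, hn, rfl⟩ := hm
      obtain ⟨h1, h2⟩ := hmem n hn
      obtain ⟨hn2, a, b, hB, _⟩ := hfacts n h1
      obtain ⟨hmul, hm0, hBm, hsmo, hPT⟩ := lp_facts hn2 hB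
      refine ⟨hBm, ?_, a, b⟩
      rw [Nat.mem_smoothNumbers'] at hsmo ⊢
      intro p hp hpm
      have := hsmo p hp hpm
      have := hYle n hn
      omega)
    rw [Finset.card_eq_sum_card_image (fun n => n / lp n) Sj]
    push_cast
    have hfib : ∀ m ∈ Sj.image (fun n => n / lp n),
        ((Sj.filter (fun n => n / lp n = m)).card : ℝ) ≤ (Cp * X / L) * ((m : ℝ)⁻¹ * 2 ^ (j + 1)) := by
      intro m hm
      rw [Finset.mem_image] at hm
      obtain ⟨n1, hn1, hn1m⟩ := hm
      have hx : ∀ n ∈ Sj, n / lp n = m → lp n * m = n ∧ (lp n : ℝ) ≤ X / m ∧ m ≠ 0 := by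
        intro n hn hnm
        obtain ⟨h1, h2⟩ := hmem n hn
        obtain ⟨hn2, a, b, hB, hnX⟩ := hfacts n h1
        obtain ⟨hmul, hm0, hBm, hsmo, hPT⟩ := lp_facts hn2 hB
        rw [hnm] at hmul hm0
        have hmpos : (0 : ℝ) < m := by exact_mod_cast Nat.pos_of_ne_zero hm0
        refine ⟨hmul, ?_, hm0⟩
        rw [le_div_iff₀ hmpos]
        refine le_trans (le_of_eq ?_) hnX
        exact_mod_cast hmul
      obtain ⟨a1, a2, a3⟩ := hx n1 hn1 hn1m
      obtain ⟨b1, b2, b3, b4⟩ := hlpX n1 (hmem n1 hn1).1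
      rw [(hmem n1 hn1).2] at b3 b4
      have hmpos : (0 : ℝ) < m := by exact_mod_cast Nat.pos_of_ne_zero a3
      have hP2 : (2 : ℝ) ≤ lp n1 := by exact_mod_cast b1.two_le
      have hxm : 2 ≤ X / m := by linarith
      have hlog : L < 2 ^ (j + 1) * Real.log (X / m) := by
        have : Real.log (lp n1) ≤ Real.log (X / m) := Real.log_le_log (by linarith) a2
        have h2 : (0 : ℝ) < 2 ^ (j + 1) := by positivity
        nlinarith
      have h1 : (Sj.filter (fun n => n / lp n = m)).card ≤ Nat.primeCounting ⌊X / m⌋₊ := by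
        rw [Nat.primeCounting, ← Nat.primesBelow_card_eq_primeCounting']
        apply Finset.card_le_card_of_injOn lp
        · intro n hn
          rw [Finset.mem_coe, Finset.mem_filter] at hn
          obtain ⟨c1, c2, c3⟩ := hx n hn.1 hn.2
          obtain ⟨d1, _⟩ := hlpX n (hmem n hn.1).1
          rw [Finset.mem_coe, Nat.mem_primesBelow]
          exact ⟨Nat.lt_succ_of_le (Nat.le_floor c2), d1⟩
        · intro n hn n' hn' he
          rw [Finset.mem_coe, Finset.mem_filter] at hn hn'
          rw [← (hx n hn.1 hn.2).1, ← (hx n' hn'.1 hn'.2).1, he]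
      have h2 := hpi (X / m) hxm
      have hlpos : 0 < Real.log (X / m) := Real.log_pos (by linarith)
      calc _ ≤ ((Nat.primeCounting ⌊X / m⌋₊ : ℕ) : ℝ) := by exact_mod_cast h1
        _ ≤ Cp * (X / m) / Real.log (X / m) := h2
        _ = Cp * (X / m) * (1 / Real.log (X / m)) := by ring
        _ ≤ Cp * (X / m) * (2 ^ (j + 1) / L) := by
          apply mul_le_mul_of_nonneg_left _ (by positivity)
          rw [div_le_div_iff₀ hlpos (by linarith)]
          linarith
        _ = _ := by ring
    refine (Finset.sum_le_sum hfib).trans ?_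
    rw [← Finset.mul_sum, ← Finset.sum_mul, mul_assoc]
    exact mul_le_mul_of_nonneg_left hM (by positivity)
  have hc2 : (S2.card : ℝ) ≤ (Cp * X / L) * (Cs * (1 + Real.log T)) * 2 := by
    rw [Finset.card_eq_sum_card_image jf S2]
    push_cast
    refine (Finset.sum_le_sum (fun j _ => hj j)).trans ?_
    rw [← Finset.mul_sum]
    exact mul_le_mul_of_nonneg_left (half_sum _) (by positivity)
  rw [hcard]
  push_cast
  have e : (1 + Cp * Cs * 2) * X * (1 + Real.log T) / L =
    X / L * (1 + Real.log T) + (Cp * X / L) * (Cs * (1 + Real.log T)) * 2 := by ring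
  rw [e]
  have h3 : X / L ≤ X / L * (1 + Real.log T) := by
    have : 0 ≤ X / L := by positivity
    nlinarith
  linarith

end PP

namespace PP

lemma practical_ord {p n u k : ℕ} (hp : p.Prime) (hn : IsPPractical p n) (hu : 1 ≤ u)
    (hk : 2 ≤ k) (hnuk : n = u * k) (hpk : ¬ p ∣ k) :
    ∃ r : ℕ, r.Prime ∧ r ∣ k ∧ orderOf (p : ZMod r) ≤ u + 1 := by
  by_contra hcon
  push Not at hcon
  haveI : Fact p.Prime := ⟨hp⟩
  have hun : u + 1 ≤ n := by rw [hnuk]; nlinarith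
  obtain ⟨g, hg, hdeg⟩ := hn (u + 1) (by omega) hun
  set Q : Polynomial (ZMod p) := ∑ i ∈ Finset.range k, (X ^ u) ^ i with hQ
  have hfac : (X ^ n - 1 : Polynomial (ZMod p)) = Q * (X ^ u - 1) := by
    rw [hQ, geom_sum_mul, ← pow_mul, hnuk]
  have hn0 : n ≠ 0 := by omega
  have hXn : (X ^ n - 1 : Polynomial (ZMod p)) ≠ 0 := by
    have := X_pow_sub_C_ne_zero (R := ZMod p) (Nat.pos_of_ne_zero hn0) 1
    simpa using this
  have hg0 : g ≠ 0 := by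
    rintro rfl
    simp at hdeg
  have hcop : IsCoprime g Q := by
    apply isCoprime_of_irreducible_dvd
    · rintro ⟨h, _⟩; exact hg0 h
    intro h hirr hhg hhQ
    haveI : Fact (Irreducible h) := ⟨hirr⟩
    have hh0 : h ≠ 0 := hirr.ne_zero
    have hD : h.natDegree ≤ u + 1 := hdeg ▸ natDegree_le_of_dvd hhg hg0
    have hDpos : 0 < h.natDegree := hirr.natDegree_pos
    let α : AdjoinRoot h := AdjoinRoot.root h
    have hev : ∀ f : Polynomial (ZMod p), h ∣ f → aeval α f = 0 := by
      intro f hf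
      rw [AdjoinRoot.aeval_eq]
      exact AdjoinRoot.mk_eq_zero.mpr hf
    have hαn : α ^ n = 1 := by
      have := hev _ (hhg.trans hg)
      simpa [sub_eq_zero] using this
    have hα0 : α ≠ 0 := by
      intro h0
      rw [h0, zero_pow hn0] at hαn
      exact zero_ne_one hαn
    haveI hfin : Module.Finite (ZMod p) (AdjoinRoot h) := (AdjoinRoot.powerBasis hh0).finite
    haveI : Finite (AdjoinRoot h) := Module.finite_of_finite (ZMod p)
    letI : Fintype (AdjoinRoot h) := Fintype.ofFinite _
    have hcard : Fintype.card (AdjoinRoot h) = p ^ h.natDegree := by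
      rw [Module.card_eq_pow_finrank (K := ZMod p), ZMod.card,
        (AdjoinRoot.powerBasis hh0).finrank, AdjoinRoot.powerBasis_dim]
    have hαq : α ^ (p ^ h.natDegree - 1) = 1 := by
      rw [← hcard]
      exact FiniteField.pow_card_sub_one_eq_one α hα0
    have hd1 := orderOf_dvd_of_pow_eq_one hαn
    have hd2 := orderOf_dvd_of_pow_eq_one hαq
    have hcopr : Nat.Coprime (orderOf α) k := by
      rw [Nat.coprime_iff_gcd_eq_one]
      by_contra hne
      obtain ⟨r, hr, hrd⟩ := Nat.exists_prime_and_dvd hne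
      have hrα := hrd.trans (Nat.gcd_dvd_left _ _)
      have hrk := hrd.trans (Nat.gcd_dvd_right _ _)
      have h1 := hcon r hr hrk
      have h2 : (p : ZMod r) ^ h.natDegree = 1 := by
        have h3 : r ∣ p ^ h.natDegree - 1 := hrα.trans hd2
        have h4 : ((p ^ h.natDegree - 1 : ℕ) : ZMod r) = 0 :=
          (ZMod.natCast_eq_zero_iff _ _).mpr h3
        rw [Nat.cast_sub (Nat.one_le_pow _ _ hp.pos)] at h4
        push_cast at h4
        exact sub_eq_zero.mp h4
      have h5 := orderOf_le_of_pow_eq_one hDpos h2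
      omega
    have hdu : orderOf α ∣ u := by
      rw [hnuk] at hd1
      exact hcopr.dvd_of_dvd_mul_right hd1
    have hαu : α ^ u = 1 := orderOf_dvd_iff_pow_eq_one.mp hdu
    have hQα := hev _ hhQ
    rw [hQ] at hQα
    simp only [map_sum, map_pow, aeval_X, hαu, one_pow, Finset.sum_const, Finset.card_range,
      nsmul_eq_mul, mul_one] at hQα
    have hk0 : ((k : ZMod p)) ≠ 0 := by
      rwa [Ne, ZMod.natCast_eq_zero_iff]
    apply hk0
    apply (algebraMap (ZMod p) (AdjoinRoot h)).injective
    rw [map_zero, map_natCast]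
    exact hQα
  have hdvd : g ∣ X ^ u - 1 := by
    rw [hfac] at hg
    exact hcop.dvd_of_dvd_mul_left hg
  have hXu : (X ^ u - 1 : Polynomial (ZMod p)) ≠ 0 := by
    have := X_pow_sub_C_ne_zero (R := ZMod p) hu 1
    simpa using this
  have := natDegree_le_of_dvd hdvd hXu
  have h2 : (X ^ u - 1 : Polynomial (ZMod p)).natDegree = u := by
    have := natDegree_X_pow_sub_C (R := ZMod p) (n := u) (r := 1)
    simpa using this
  omega

lemma sm_split {n : ℕ} (hn : n ≠ 0) (r : ℕ) :
    ∃ k, n = sm n r * k ∧ ∀ q, q.Prime → q ∣ k → r ≤ q := by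
  have h1 : n ∈ Nat.smoothNumbers (max r (n + 1)) := by
    rw [Nat.mem_smoothNumbers']
    intro p hp hpm
    have := Nat.le_of_dvd (Nat.pos_of_ne_zero hn) hpm
    omega
  refine ⟨∏ p ∈ Nat.primesBelow (max r (n + 1)) \ Nat.primesBelow r, p ^ (n.factorization p), ?_, ?_⟩
  · conv_lhs => rw [← sm_smooth h1]
    unfold sm
    rw [mul_comm, Finset.prod_sdiff (primesBelow_mono (le_max_left _ _))]
  · intro q hq hd
    rw [hq.prime.dvd_finset_prod_iff] at hd
    obtain ⟨a, ha, had⟩ := hd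
    rw [Finset.mem_sdiff, Nat.mem_primesBelow, Nat.mem_primesBelow] at ha
    have := (Nat.prime_dvd_prime_iff_eq hq ha.1.2).mp (hq.dvd_of_dvd_pow had)
    subst this
    by_contra hlt
    exact ha.2 ⟨by omega, hq⟩

lemma practical_BT {p n T : ℕ} (hp : p.Prime) (hn0 : n ≠ 0) (hn : IsPPractical p n) (hT : p ≤ T)
    (h : ∀ r, r.Prime → r ∣ n → T < r → r ≤ T * orderOf (p : ZMod r)) : BT (2 * T) n := by
  refine ⟨hn0, ?_⟩
  intro r0 hr0 hr0n
  have hspos : 0 < sm n r0 := by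
    apply Finset.prod_pos
    intro q hq
    exact pow_pos (Nat.prime_of_mem_primesBelow hq).pos _
  by_cases hle : r0 ≤ 2 * T
  · exact hle.trans (Nat.le_mul_of_pos_right _ hspos)
  push Not at hle
  obtain ⟨k, hk, hkq⟩ := sm_split hn0 r0
  have hr0k : r0 ∣ k := by
    rw [hk] at hr0n
    rcases (Nat.Prime.dvd_mul hr0).mp hr0n with h1 | h1
    · exfalso
      unfold sm at h1
      rw [hr0.prime.dvd_finset_prod_iff] at h1
      obtain ⟨a, ha, had⟩ := h1
      rw [Nat.mem_primesBelow] at ha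
      have := (Nat.prime_dvd_prime_iff_eq hr0 ha.2).mp (hr0.dvd_of_dvd_pow had)
      omega
    · exact h1
  have hk0 : k ≠ 0 := by
    rintro rfl
    rw [mul_zero] at hk
    exact hn0 hk
  have hk2 : 2 ≤ k := hr0.two_le.trans (Nat.le_of_dvd (Nat.pos_of_ne_zero hk0) hr0k)
  have hpk : ¬ p ∣ k := by
    intro hd
    have := hkq p hp hd
    omega
  obtain ⟨r, hr, hrk, hord⟩ := practical_ord hp hn hspos hk2 hk hpk
  have h1 := hkq r hr hrk
  have h2 := h r hr (hrk.trans (Dvd.intro_left _ hk.symm)) (by omega)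
  calc r0 ≤ r := h1
    _ ≤ T * orderOf (p : ZMod r) := h2
    _ ≤ T * (sm n r0 + 1) := Nat.mul_le_mul_left _ hord
    _ ≤ T * (2 * sm n r0) := Nat.mul_le_mul_left _ (by omega)
    _ = 2 * T * sm n r0 := by ring

end PP

namespace PP

lemma count_ap (q e N : ℕ) (he : 0 < e) (hc : Nat.Coprime q e) :
    |((((Finset.Ioc 0 N).filter (fun j : ℕ => e ∣ 1 + q * j)).card : ℝ)) - (N : ℝ) / e| ≤ 1 := by
  haveI : NeZero e := ⟨he.ne'⟩
  set v : ℕ := (-((q : ZMod e)⁻¹)).val with hv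
  have hvz : ((v : ℕ) : ZMod e) = -((q : ZMod e)⁻¹) := by rw [hv, ZMod.natCast_zmod_val]
  have hqq : (q : ZMod e) * (q : ZMod e)⁻¹ = 1 := ZMod.coe_mul_inv_eq_one q hc
  have hiff : ∀ j : ℕ, e ∣ 1 + q * j ↔ j ≡ v [MOD e] := by
    intro j
    rw [← ZMod.natCast_eq_natCast_iff, hvz, ← ZMod.natCast_eq_zero_iff]
    push_cast
    constructor
    · intro h
      have : (q : ZMod e)⁻¹ * (1 + q * j) = 0 := by rw [h, mul_zero]
      have h2 : (q : ZMod e)⁻¹ * (1 + q * j) = (q : ZMod e)⁻¹ + (q * (q : ZMod e)⁻¹) * j := by ring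
      rw [h2, hqq, one_mul] at this
      exact eq_neg_of_add_eq_zero_right this
    · intro h
      rw [h, mul_neg, hqq]; ring
  have h1 := Nat.Ioc_filter_modEq_card 0 N he v
  rw [Finset.filter_congr (fun j _ => hiff j)]
  have he' : (0 : ℚ) < e := by exact_mod_cast he
  have hmono : ⌊(((0 : ℕ) : ℚ) - v) / (e : ℚ)⌋ ≤ ⌊((N : ℚ) - v) / (e : ℚ)⌋ := by
    gcongr
    simp
  rw [max_eq_left (by linarith)] at h1
  have h2 : |((((Finset.Ioc 0 N).filter (fun j : ℕ => j ≡ v [MOD e])).card : ℚ)) - (N : ℚ) / e| ≤ 1 := by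
    have h3 : ((((Finset.Ioc 0 N).filter (fun j : ℕ => j ≡ v [MOD e])).card : ℚ)) =
      (⌊((N : ℚ) - v) / (e : ℚ)⌋ : ℚ) - (⌊(((0 : ℕ) : ℚ) - v) / (e : ℚ)⌋ : ℚ) := by exact_mod_cast h1
    rw [h3]
    have a1 := Int.floor_le (((N : ℚ) - v) / (e : ℚ))
    have a2 := Int.lt_floor_add_one (((N : ℚ) - v) / (e : ℚ))
    have a3 := Int.floor_le ((((0 : ℕ) : ℚ) - v) / (e : ℚ))
    have a4 := Int.lt_floor_add_one ((((0 : ℕ) : ℚ) - v) / (e : ℚ))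
    have a5 : ((N : ℚ) - v) / e - (((0 : ℕ) : ℚ) - v) / e = N / e := by
      rw [← sub_div]; congr 1; push_cast; ring
    rw [abs_le]
    constructor <;> linarith
  have := (Rat.cast_le (K := ℝ)).mpr h2
  push_cast at this
  exact this

lemma sum_moeb (m : ℕ) : ∑ f ∈ m.divisors, ((ArithmeticFunction.moebius f : ℤ) : ℝ) = if m = 1 then 1 else 0 := by
  have h := congrArg (fun F : ArithmeticFunction ℤ => F m) ArithmeticFunction.moebius_mul_coe_zeta
  rw [ArithmeticFunction.coe_mul_zeta_apply, ArithmeticFunction.one_apply] at h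
  have := congrArg (fun z : ℤ => (z : ℝ)) h
  push_cast at this
  exact this

lemma sum_moeb' (D l d : ℕ) (hd : d ∈ Finset.Icc 1 D) (hl : 0 < l) :
    ∑ e ∈ Finset.Icc 1 D, (if l ∣ e ∧ e ∣ d then ((ArithmeticFunction.moebius (d / e) : ℤ) : ℝ) else 0) =
      if d = l then 1 else 0 := by
  rw [← Finset.sum_filter]
  rw [Finset.mem_Icc] at hd
  by_cases hld : l ∣ d
  · obtain ⟨m, rfl⟩ := hld
    have hm : 0 < m := Nat.pos_of_mul_pos_left (by omega : 0 < l * m) |> fun h => h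
    have hs := sum_moeb m
    have h1 : (l * m = l) ↔ m = 1 := by
      constructor
      · intro h
        exact Nat.eq_of_mul_eq_mul_left hl (by rw [h, mul_one])
      · rintro rfl; simp
    simp only [h1]
    rw [← hs]
    refine Finset.sum_nbij' (fun e => l * m / e) (fun f => l * m / f) ?_ ?_ ?_ ?_ ?_
    · intro e he
      rw [Finset.mem_filter, Finset.mem_Icc] at he
      obtain ⟨⟨he1, he2⟩, ⟨c, rfl⟩, hed⟩ := he
      rw [Nat.mul_div_mul_left _ _ hl]
      rw [Nat.mem_divisors]
      have : c ∣ m := Nat.dvd_of_mul_dvd_mul_left hl hed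
      exact ⟨Nat.div_dvd_of_dvd this, hm.ne'⟩
    · intro f hf
      rw [Nat.mem_divisors] at hf
      obtain ⟨⟨c, rfl⟩, _⟩ := hf
      have hf0 : 0 < f := Nat.pos_of_mul_pos_right hm |> fun h => h
      have hc0 : 0 < c := Nat.pos_of_mul_pos_left hm |> fun h => h
      have : l * (f * c) / f = l * c := by
        rw [show l * (f * c) = f * (l * c) by ring, Nat.mul_div_cancel_left _ hf0]
      rw [this, Finset.mem_filter, Finset.mem_Icc]
      refine ⟨⟨Nat.mul_pos hl hc0, ?_⟩, Dvd.intro _ rfl, ⟨f, by ring⟩⟩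
      refine le_trans ?_ hd.2
      exact Nat.mul_le_mul_left _ (Nat.le_mul_of_pos_left _ hf0)
    · intro e he
      rw [Finset.mem_filter, Finset.mem_Icc] at he
      exact Nat.div_div_self he.2.2 (by omega)
    · intro f hf
      rw [Nat.mem_divisors] at hf
      exact Nat.div_div_self (hf.1.trans (Dvd.intro_left _ rfl)) (by omega)
    · intro e he; rfl
  · rw [Finset.filter_eq_empty_iff.mpr]
    · rw [Finset.sum_empty, if_neg]
      rintro rfl; exact hld dvd_rfl
    · intro e _ h
      exact hld (h.1.trans h.2)

noncomputable def mu (d : ℕ) : ℝ := ((ArithmeticFunction.moebius d : ℤ) : ℝ)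
noncomputable def GG (D : ℕ) : ℝ := ∑ d ∈ Finset.Icc 1 D, (mu d) ^ 2 / (Nat.totient d : ℝ)
noncomputable def nu (D e : ℕ) : ℝ :=
  ∑ d ∈ Finset.Icc 1 D, if e ∣ d then mu d * mu (d / e) / (Nat.totient d : ℝ) else 0

lemma abs_mu_le (d : ℕ) : |mu d| ≤ 1 := by
  unfold mu
  have := ArithmeticFunction.abs_moebius_le_one (n := d)
  exact_mod_cast this

lemma abs_mu_sq (d : ℕ) : |mu d| = mu d ^ 2 := by
  unfold mu
  rcases ArithmeticFunction.moebius_eq_or d with h | h | h <;> rw [h] <;> simp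

lemma nu_one (D : ℕ) : nu D 1 = GG D := by
  unfold nu GG
  refine Finset.sum_congr rfl (fun d _ => ?_)
  rw [if_pos (one_dvd _), Nat.div_one, pow_two]

lemma abs_nu_le (D e : ℕ) : |nu D e| ≤ GG D := by
  unfold nu GG
  refine (Finset.abs_sum_le_sum_abs _ _).trans (Finset.sum_le_sum (fun d _ => ?_))
  split_ifs
  · rw [abs_div, abs_mul, Nat.abs_cast, ← abs_mu_sq]
    have := mul_le_mul_of_nonneg_left (abs_mu_le (d / e)) (abs_nonneg (mu d))
    gcongr
    linarith
  · simp; positivity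

lemma ysum (D l : ℕ) (hl : l ∈ Finset.Icc 1 D) :
    ∑ e ∈ Finset.Icc 1 D, (if l ∣ e then nu D e else 0) = mu l / (Nat.totient l : ℝ) := by
  unfold nu
  have h1 : ∀ e ∈ Finset.Icc 1 D, (if l ∣ e then (∑ d ∈ Finset.Icc 1 D, if e ∣ d then mu d * mu (d / e) / (Nat.totient d : ℝ) else 0) else 0)
      = ∑ d ∈ Finset.Icc 1 D, mu d / (Nat.totient d : ℝ) * (if l ∣ e ∧ e ∣ d then mu (d / e) else 0) := by
    intro e _
    split_ifs with h
    · refine Finset.sum_congr rfl (fun d _ => ?_)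
      by_cases h2 : e ∣ d
      · simp only [h, h2, and_self, if_true]; ring
      · simp [h2]
    · symm
      apply Finset.sum_eq_zero
      intro d _
      rw [if_neg (fun hh => h hh.1), mul_zero]
  rw [Finset.sum_congr rfl h1, Finset.sum_comm]
  have h2 : ∀ d ∈ Finset.Icc 1 D, ∑ e ∈ Finset.Icc 1 D, mu d / (Nat.totient d : ℝ) * (if l ∣ e ∧ e ∣ d then mu (d / e) else 0)
      = if d = l then mu l / (Nat.totient l : ℝ) else 0 := by
    intro d hd
    rw [← Finset.mul_sum]
    have := sum_moeb' D l d hd (by rw [Finset.mem_Icc] at hl; omega)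
    unfold mu
    rw [this]
    split_ifs with h
    · rw [h, mul_one]
    · simp
  rw [Finset.sum_congr rfl h2, Finset.sum_ite_eq' , if_pos hl]

lemma gcd_sum (D a b : ℕ) (ha : a ∈ Finset.Icc 1 D) :
    ((Nat.gcd a b : ℕ) : ℝ) = ∑ l ∈ Finset.Icc 1 D, (Nat.totient l : ℝ) * (if l ∣ a then 1 else 0) * (if l ∣ b then 1 else 0) := by
  rw [Finset.mem_Icc] at ha
  have hg : 0 < Nat.gcd a b := Nat.gcd_pos_of_pos_left _ (by omega)
  have h := Nat.sum_totient (Nat.gcd a b)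
  have h2 : ((Nat.gcd a b : ℕ) : ℝ) = ∑ l ∈ (Nat.gcd a b).divisors, (Nat.totient l : ℝ) := by
    exact_mod_cast h.symm
  rw [h2]
  have h3 : (Nat.gcd a b).divisors = (Finset.Icc 1 D).filter (fun l => l ∣ a ∧ l ∣ b) := by
    ext l
    rw [Nat.mem_divisors, Finset.mem_filter, Finset.mem_Icc, Nat.dvd_gcd_iff]
    constructor
    · rintro ⟨h, _⟩
      exact ⟨⟨Nat.pos_of_dvd_of_pos h.1 (by omega), (Nat.le_of_dvd (by omega) h.1).trans ha.2⟩, h⟩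
    · rintro ⟨_, h⟩; exact ⟨h, hg.ne'⟩
  rw [h3, Finset.sum_filter]
  refine Finset.sum_congr rfl (fun l _ => ?_)
  by_cases h1 : l ∣ a <;> by_cases h2 : l ∣ b <;> simp [h1, h2]

lemma quad (D : ℕ) : ∑ a ∈ Finset.Icc 1 D, ∑ b ∈ Finset.Icc 1 D, nu D a * nu D b * (Nat.gcd a b : ℝ) = GG D := by
  have h1 : ∀ a ∈ Finset.Icc 1 D, ∑ b ∈ Finset.Icc 1 D, nu D a * nu D b * (Nat.gcd a b : ℝ) =
      ∑ l ∈ Finset.Icc 1 D, (Nat.totient l : ℝ) * (if l ∣ a then nu D a else 0) * (∑ b ∈ Finset.Icc 1 D, if l ∣ b then nu D b else 0) := by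
    intro a ha
    simp_rw [Finset.mul_sum]
    rw [Finset.sum_comm]
    refine Finset.sum_congr rfl (fun b _ => ?_)
    rw [gcd_sum D a b ha, Finset.mul_sum]
    refine Finset.sum_congr rfl (fun l _ => ?_)
    by_cases h1 : l ∣ a <;> by_cases h2 : l ∣ b <;> simp [h1, h2]
    ring
  rw [Finset.sum_congr rfl h1, Finset.sum_comm]
  unfold GG
  refine Finset.sum_congr rfl (fun l hl => ?_)
  rw [← Finset.sum_mul, ← Finset.mul_sum, ysum D l hl]
  have : (0 : ℝ) < Nat.totient l := by
    rw [Finset.mem_Icc] at hl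
    exact_mod_cast Nat.totient_pos.mpr (by omega)
  field_simp

lemma GG_lower (D : ℕ) : Real.log (D + 1) ≤ 2 * GG D := by
  have h0 : Real.log (D + 1) ≤ ∑ n ∈ Finset.Icc 1 D, ((n : ℝ))⁻¹ := by
    have h := log_add_one_le_harmonic D
    rw [harmonic_eq_sum_Icc] at h
    push_cast at h
    exact h
  have hsq : ∀ n : ℕ, ∃ ab : ℕ × ℕ, ab.2 ^ 2 * ab.1 = n ∧ Squarefree ab.1 := by
    intro n
    obtain ⟨a, b, h1, h2⟩ := Nat.sq_mul_squarefree n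
    exact ⟨(a, b), h1, h2⟩
  choose f hf1 hf2 using hsq
  have hinj : Function.Injective f := by
    intro x y h
    rw [← hf1 x, ← hf1 y, h]
  set A := (Finset.Icc 1 D).filter (fun d => Squarefree d)
  have h1 : ∑ n ∈ Finset.Icc 1 D, ((n : ℝ))⁻¹ ≤ ∑ ab ∈ A ×ˢ Finset.Icc 1 D, ((ab.1 : ℝ))⁻¹ * ((ab.2 : ℝ) ^ 2)⁻¹ := by
    have e1 : ∑ n ∈ Finset.Icc 1 D, ((n : ℝ))⁻¹ = ∑ ab ∈ (Finset.Icc 1 D).image f, ((ab.1 : ℝ))⁻¹ * ((ab.2 : ℝ) ^ 2)⁻¹ := by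
      rw [Finset.sum_image (fun x _ y _ h => hinj h)]
      refine Finset.sum_congr rfl (fun n _ => ?_)
      have : ((n : ℕ) : ℝ) = ((f n).2 : ℝ) ^ 2 * ((f n).1 : ℝ) := by exact_mod_cast (hf1 n).symm
      rw [this, mul_inv, mul_comm]
    rw [e1]
    refine Finset.sum_le_sum_of_subset_of_nonneg ?_ (fun _ _ _ => by positivity)
    intro ab hab
    rw [Finset.mem_image] at hab
    obtain ⟨n, hn, rfl⟩ := hab
    rw [Finset.mem_Icc] at hn
    have e2 := hf1 n
    have hpos : 0 < (f n).2 ^ 2 * (f n).1 := by omega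
    have hp1 : 0 < (f n).1 := Nat.pos_of_mul_pos_left hpos
    have hp2 : 0 < (f n).2 ^ 2 := Nat.pos_of_mul_pos_right hpos
    have hp3 : 0 < (f n).2 := Nat.pos_of_ne_zero (by rintro h; rw [h] at hp2; simp at hp2)
    have l1 : (f n).1 ≤ n := by
      calc (f n).1 ≤ (f n).2 ^ 2 * (f n).1 := Nat.le_mul_of_pos_left _ hp2
        _ = n := e2
    have l2 : (f n).2 ≤ n := by
      calc (f n).2 ≤ (f n).2 ^ 2 := Nat.le_self_pow (by norm_num) _
        _ ≤ (f n).2 ^ 2 * (f n).1 := Nat.le_mul_of_pos_right _ hp1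
        _ = n := e2
    simp only [A, Finset.mem_product, Finset.mem_filter, Finset.mem_Icc]
    exact ⟨⟨⟨hp1, by omega⟩, hf2 n⟩, hp3, by omega⟩
  rw [Finset.sum_product] at h1
  simp_rw [← Finset.mul_sum] at h1
  rw [← Finset.sum_mul] at h1
  have h2 : ∑ b ∈ Finset.Icc 1 D, ((b : ℝ) ^ 2)⁻¹ ≤ 2 := by
    have h := sum_Ioo_inv_sq_le (α := ℝ) 0 (D + 1)
    have e : Finset.Ioo 0 (D + 1) = Finset.Icc 1 D := by
      ext x; simp only [Finset.mem_Ioo, Finset.mem_Icc]; omega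
    rw [e] at h
    norm_num at h
    simpa using h
  have h3 : ∑ a ∈ A, ((a : ℝ))⁻¹ ≤ GG D := by
    unfold GG
    rw [Finset.sum_filter]
    refine Finset.sum_le_sum (fun d hd => ?_)
    rw [Finset.mem_Icc] at hd
    have : (0 : ℝ) < Nat.totient d := by exact_mod_cast Nat.totient_pos.mpr (by omega)
    split_ifs with h
    · have : mu d ^ 2 = 1 := by
        unfold mu
        have := ArithmeticFunction.moebius_sq_eq_one_of_squarefree h
        exact_mod_cast this
      rw [this, one_div]
      exact inv_anti₀ (by assumption) (by exact_mod_cast Nat.totient_le d)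
    · positivity
  have h4 : (0 : ℝ) ≤ ∑ a ∈ A, ((a : ℝ))⁻¹ := Finset.sum_nonneg (fun _ _ => by positivity)
  have h5 := mul_le_mul_of_nonneg_left h2 h4
  linarith

lemma sieve (q D N : ℕ) (hq : q.Prime) (hD : D < q) (hD1 : 1 ≤ D) :
    (((Finset.Ioc 0 N).filter (fun j : ℕ => (1 + q * j).Prime)).card : ℝ) ≤ N / GG D + (D : ℝ) ^ 4 := by
  have hG : 0 < GG D := by
    have h1 := GG_lower D
    have : 0 < Real.log (D + 1) := Real.log_pos (by
      have : (1 : ℝ) ≤ D := by exact_mod_cast hD1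
      linarith)
    linarith
  set S := (Finset.Ioc 0 N).filter (fun j : ℕ => (1 + q * j).Prime) with hS
  set F : ℕ → ℝ := fun j => ∑ e ∈ Finset.Icc 1 D, if e ∣ 1 + q * j then (e : ℝ) * nu D e else 0 with hF
  have hFS : ∀ j ∈ S, F j = GG D := by
    intro j hj
    rw [hS, Finset.mem_filter, Finset.mem_Ioc] at hj
    rw [hF]
    simp only
    rw [Finset.sum_eq_single_of_mem 1 (by rw [Finset.mem_Icc]; omega)]
    · rw [if_pos (one_dvd _), nu_one]; simp
    · intro e he hne
      rw [if_neg]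
      intro hdv
      rcases (Nat.dvd_prime hj.2).mp hdv with h | h
      · exact hne h
      · rw [Finset.mem_Icc] at he
        have : q * 1 ≤ q * j := Nat.mul_le_mul_left _ (by omega)
        omega
  have h1 : (S.card : ℝ) * GG D ^ 2 ≤ ∑ j ∈ Finset.Ioc 0 N, F j ^ 2 := by
    calc (S.card : ℝ) * GG D ^ 2 = ∑ j ∈ S, F j ^ 2 := by
          rw [Finset.sum_congr rfl (fun j hj => by rw [hFS j hj]), Finset.sum_const, nsmul_eq_mul]
      _ ≤ _ := Finset.sum_le_sum_of_subset_of_nonneg (Finset.filter_subset _ _) (fun _ _ _ => sq_nonneg _)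
  set c : ℕ → ℕ → ℝ := fun a b => (((Finset.Ioc 0 N).filter (fun j : ℕ => Nat.lcm a b ∣ 1 + q * j)).card : ℝ) with hc
  have h2 : ∑ j ∈ Finset.Ioc 0 N, F j ^ 2 = ∑ a ∈ Finset.Icc 1 D, ∑ b ∈ Finset.Icc 1 D,
      ((a : ℝ) * nu D a) * ((b : ℝ) * nu D b) * c a b := by
    have e1 : ∀ j ∈ Finset.Ioc 0 N, F j ^ 2 = ∑ a ∈ Finset.Icc 1 D, ∑ b ∈ Finset.Icc 1 D,
        ((a : ℝ) * nu D a) * ((b : ℝ) * nu D b) * (if Nat.lcm a b ∣ 1 + q * j then 1 else 0) := by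
      intro j _
      rw [hF]
      simp only
      rw [pow_two, Finset.sum_mul_sum]
      refine Finset.sum_congr rfl (fun a _ => Finset.sum_congr rfl (fun b _ => ?_))
      have : Nat.lcm a b ∣ 1 + q * j ↔ a ∣ 1 + q * j ∧ b ∣ 1 + q * j := Nat.lcm_dvd_iff
      by_cases ha : a ∣ 1 + q * j <;> by_cases hb : b ∣ 1 + q * j <;> simp [ha, hb, this]
    rw [Finset.sum_congr rfl e1, Finset.sum_comm]
    refine Finset.sum_congr rfl (fun a _ => ?_)
    rw [Finset.sum_comm]
    refine Finset.sum_congr rfl (fun b _ => ?_)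
    rw [← Finset.mul_sum, hc]
    simp only [Finset.sum_boole]
  have h3 : ∀ a ∈ Finset.Icc 1 D, ∀ b ∈ Finset.Icc 1 D,
      ((a : ℝ) * nu D a) * ((b : ℝ) * nu D b) * c a b ≤ N * (nu D a * nu D b * (Nat.gcd a b : ℝ)) + (D * GG D) * (D * GG D) := by
    intro a ha b hb
    rw [Finset.mem_Icc] at ha hb
    have hcop : ∀ x, 1 ≤ x ∧ x ≤ D → Nat.Coprime q x := by
      intro x hx
      rw [Nat.Prime.coprime_iff_not_dvd hq]
      intro h
      have := Nat.le_of_dvd (by omega) h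
      omega
    have hl0 : 0 < Nat.lcm a b := Nat.lcm_pos (by omega) (by omega)
    have hcl : Nat.Coprime q (Nat.lcm a b) := by
      apply Nat.Coprime.coprime_dvd_right (Nat.lcm_dvd_mul a b)
      exact Nat.Coprime.mul_right (hcop a ha) (hcop b hb)
    have hca := count_ap q (Nat.lcm a b) N hl0 hcl
    have hgl : ((Nat.gcd a b : ℕ) : ℝ) * (Nat.lcm a b : ℕ) = a * b := by exact_mod_cast Nat.gcd_mul_lcm a b
    have hl0' : (0 : ℝ) < (Nat.lcm a b : ℕ) := by exact_mod_cast hl0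
    have e1 : ((a : ℝ) * nu D a) * ((b : ℝ) * nu D b) * ((N : ℝ) / (Nat.lcm a b : ℕ)) = N * (nu D a * nu D b * (Nat.gcd a b : ℝ)) := by
      have : (a : ℝ) * b / (Nat.lcm a b : ℕ) = (Nat.gcd a b : ℕ) := by
        rw [← hgl]; field_simp
      rw [← this]; ring
    have e2 : ∀ x, 1 ≤ x ∧ x ≤ D → |(x : ℝ) * nu D x| ≤ D * GG D := by
      intro x hx
      rw [abs_mul, Nat.abs_cast]
      have : (x : ℝ) ≤ D := by exact_mod_cast hx.2
      exact mul_le_mul this (abs_nu_le D x) (abs_nonneg _) (by positivity)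
    have e3 : |((a : ℝ) * nu D a) * ((b : ℝ) * nu D b) * (c a b - (N : ℝ) / (Nat.lcm a b : ℕ))| ≤ (D * GG D) * (D * GG D) := by
      rw [abs_mul, abs_mul]
      calc _ ≤ |(a : ℝ) * nu D a| * |(b : ℝ) * nu D b| * 1 := mul_le_mul_of_nonneg_left hca (by positivity)
        _ = |(a : ℝ) * nu D a| * |(b : ℝ) * nu D b| := mul_one _
        _ ≤ _ := mul_le_mul (e2 a ha) (e2 b hb) (abs_nonneg _) (by positivity)
    have e4 := le_abs_self (((a : ℝ) * nu D a) * ((b : ℝ) * nu D b) * (c a b - (N : ℝ) / (Nat.lcm a b : ℕ)))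
    rw [mul_sub, e1] at e4
    rw [mul_sub, e1] at e3
    linarith
  have h4 : ∑ a ∈ Finset.Icc 1 D, ∑ b ∈ Finset.Icc 1 D,
      ((a : ℝ) * nu D a) * ((b : ℝ) * nu D b) * c a b ≤ N * GG D + (D : ℝ) ^ 4 * GG D ^ 2 := by
    calc _ ≤ ∑ a ∈ Finset.Icc 1 D, ∑ b ∈ Finset.Icc 1 D, (N * (nu D a * nu D b * (Nat.gcd a b : ℝ)) + (D * GG D) * (D * GG D)) :=
          Finset.sum_le_sum (fun a ha => Finset.sum_le_sum (fun b hb => h3 a ha b hb))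
      _ = N * GG D + (D : ℝ) ^ 4 * GG D ^ 2 := by
          simp_rw [Finset.sum_add_distrib, ← Finset.mul_sum]
          rw [quad]
          simp only [Finset.sum_const, Nat.card_Icc, nsmul_eq_mul, Nat.add_sub_cancel]
          ring
  have h5 : (S.card : ℝ) * GG D ^ 2 ≤ (N / GG D + (D : ℝ) ^ 4) * GG D ^ 2 := by
    have : (N / GG D + (D : ℝ) ^ 4) * GG D ^ 2 = N * GG D + (D : ℝ) ^ 4 * GG D ^ 2 := by field_simp
    rw [this]; linarith
  exact le_of_mul_le_mul_right h5 (by positivity)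

lemma brun_titchmarsh (q N : ℕ) (hq : q.Prime) (hN : 2 ≤ N) (hNq : N ≤ q ^ 4) :
    (((Finset.Ioc 0 N).filter (fun j : ℕ => (1 + q * j).Prime)).card : ℝ) ≤ 18 * N / Real.log N := by
  have hN' : (2 : ℝ) ≤ N := by exact_mod_cast hN
  have hlog : 0 < Real.log N := Real.log_pos (by linarith)
  set z : ℝ := (N : ℝ) ^ ((1 : ℝ) / 8) with hz
  have hz1 : 1 ≤ z := Real.one_le_rpow (by linarith) (by norm_num)
  have hz8 : z ^ 8 = N := by
    rw [hz, ← Real.rpow_natCast, ← Real.rpow_mul (by linarith)]; norm_num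
  have hlz : Real.log z = Real.log N / 8 := by
    rw [hz, Real.log_rpow (by linarith)]; ring
  set D := ⌊z⌋₊ with hDdef
  have hD1 : 1 ≤ D := Nat.le_floor (by simpa using hz1)
  have hDz : (D : ℝ) ≤ z := Nat.floor_le (by linarith)
  have hzD : z < D + 1 := Nat.lt_floor_add_one z
  have hDq : D < q := by
    by_contra hcon
    push Not at hcon
    have h1 : (q : ℝ) ≤ D := by exact_mod_cast hcon
    have hq2 : (2 : ℝ) ≤ q := by exact_mod_cast hq.two_le
    have h2 : (q : ℝ) ^ 8 ≤ z ^ 8 := pow_le_pow_left₀ (by linarith) (by linarith) 8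
    have h3 : (N : ℝ) ≤ (q : ℝ) ^ 4 := by exact_mod_cast hNq
    have h4 : (q : ℝ) ^ 4 < q ^ 8 := pow_lt_pow_right₀ (by linarith) (by norm_num)
    linarith
  have h := sieve q D N hq hDq hD1
  have hGl := GG_lower D
  have hl : Real.log N / 8 ≤ Real.log (D + 1) := by
    rw [← hlz]; exact Real.log_le_log (by linarith) hzD.le
  have hG : Real.log N / 16 ≤ GG D := by linarith
  have t1 : N / GG D ≤ 16 * N / Real.log N := by
    rw [div_le_div_iff₀ (by linarith) hlog]
    have := mul_le_mul_of_nonneg_left hG (show (0 : ℝ) ≤ 16 * N by positivity)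
    linarith
  have t2 : (D : ℝ) ^ 4 ≤ 2 * N / Real.log N := by
    have s1 : (D : ℝ) ^ 4 ≤ z ^ 4 := pow_le_pow_left₀ (by positivity) hDz 4
    have s2 : Real.log N ≤ 2 * z ^ 4 := by
      have s3 : Real.log (z ^ 4) ≤ z ^ 4 := by
        have := Real.log_le_sub_one_of_pos (show 0 < z ^ 4 by positivity)
        linarith
      rw [Real.log_pow, hlz] at s3
      push_cast at s3
      linarith
    rw [le_div_iff₀ hlog]
    calc (D : ℝ) ^ 4 * Real.log N ≤ z ^ 4 * (2 * z ^ 4) := mul_le_mul s1 s2 hlog.le (by positivity)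
      _ = 2 * z ^ 8 := by ring
      _ = 2 * N := by rw [hz8]
  have : 18 * (N : ℝ) / Real.log N = 16 * N / Real.log N + 2 * N / Real.log N := by ring
  linarith

end PP

namespace PP

lemma sum_sq_tail (k0 : ℕ) (hk0 : 1 ≤ k0) (K : Finset ℕ) (hK : ∀ k ∈ K, k0 ≤ k) :
    ∑ k ∈ K, ((k : ℝ) ^ 2)⁻¹ ≤ 2 / k0 := by
  obtain ⟨M, hM⟩ : ∃ M, ∀ k ∈ K, k < M := ⟨K.sup id + 1, fun k hk => by
    have := Finset.le_sup (f := id) hk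
    simp only [id] at this; omega⟩
  have h := sum_Ioo_inv_sq_le (α := ℝ) (k0 - 1) M
  rw [Nat.cast_sub hk0] at h
  have e : ((k0 : ℝ) - ((1 : ℕ) : ℝ) + 1) = k0 := by push_cast; ring
  rw [e] at h
  refine le_trans ?_ h
  refine Finset.sum_le_sum_of_subset_of_nonneg ?_ (fun _ _ _ => by positivity)
  intro k hk
  rw [Finset.mem_Ioo]
  have h1 := hK k hk
  have h2 := hM k hk
  omega

lemma dyadic (S : Finset ℕ) (f : ℕ → ℝ) (B : ℝ) (hB : 0 ≤ B) (k0 : ℕ) (hk0 : 1 ≤ k0)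
    (h : ∀ r ∈ S, k0 ≤ Nat.log 2 r)
    (hb : ∀ k, k0 ≤ k → ∑ r ∈ S.filter (fun r => Nat.log 2 r = k), f r ≤ B / (k : ℝ) ^ 2) :
    ∑ r ∈ S, f r ≤ 2 * B / k0 := by
  rw [← Finset.sum_fiberwise_of_maps_to (t := S.image (Nat.log 2)) (g := Nat.log 2)
    (fun r hr => Finset.mem_image_of_mem _ hr)]
  have hK : ∀ k ∈ S.image (Nat.log 2), k0 ≤ k := by
    intro k hk
    rw [Finset.mem_image] at hk
    obtain ⟨r, hr, rfl⟩ := hk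
    exact h r hr
  calc _ ≤ ∑ k ∈ S.image (Nat.log 2), B * ((k : ℝ) ^ 2)⁻¹ := Finset.sum_le_sum (fun k hk => by
          rw [← div_eq_mul_inv]; exact hb k (hK k hk))
    _ = B * ∑ k ∈ S.image (Nat.log 2), ((k : ℝ) ^ 2)⁻¹ := by rw [Finset.mul_sum]
    _ ≤ B * (2 / k0) := mul_le_mul_of_nonneg_left (sum_sq_tail k0 hk0 _ hK) hB
    _ = _ := by ring

lemma log2_bounds {r k : ℕ} (hr : r ≠ 0) (h : Nat.log 2 r = k) : 2 ^ k ≤ r ∧ r < 2 ^ (k + 1) := by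
  subst h
  exact ⟨Nat.pow_log_le_self 2 hr, Nat.lt_pow_succ_log_self (by norm_num) r⟩

lemma cheb_block : ∃ C : ℝ, 0 < C ∧ ∀ k : ℕ, 1 ≤ k → ∀ S : Finset ℕ,
    (∀ q ∈ S, q.Prime ∧ Nat.log 2 q = k) → (S.card : ℝ) ≤ C * 2 ^ k / k := by
  obtain ⟨C, hC, h⟩ := pi_bound
  refine ⟨4 * C, by linarith, fun k hk S hS => ?_⟩
  have h1 := h (2 ^ (k + 1)) (by
    calc (2 : ℝ) = 2 ^ 1 := by norm_num
      _ ≤ 2 ^ (k + 1) := pow_le_pow_right₀ (by norm_num) (by omega))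
  have e1 : ⌊(2 : ℝ) ^ (k + 1)⌋₊ = 2 ^ (k + 1) := by
    have : (2 : ℝ) ^ (k + 1) = ((2 ^ (k + 1) : ℕ) : ℝ) := by push_cast; rfl
    rw [this, Nat.floor_natCast]
  rw [e1, Real.log_pow] at h1
  have h2 : S.card ≤ Nat.primeCounting (2 ^ (k + 1)) := by
    have : Nat.primeCounting (2 ^ (k + 1)) = (Nat.primesBelow (2 ^ (k + 1) + 1)).card := by
      rw [Nat.primesBelow_card_eq_primeCounting']; rfl
    rw [this]
    apply Finset.card_le_card
    intro q hq
    rw [Nat.mem_primesBelow]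
    obtain ⟨hp, hl⟩ := hS q hq
    have := log2_bounds hp.ne_zero hl
    exact ⟨by omega, hp⟩
  have h3 : (S.card : ℝ) ≤ Nat.primeCounting (2 ^ (k + 1)) := by exact_mod_cast h2
  have hk' : (1 : ℝ) ≤ k := by exact_mod_cast hk
  have hl2 := Real.log_two_gt_d9
  refine h3.trans (h1.trans ?_)
  rw [div_le_div_iff₀ (by positivity) (by linarith), pow_succ (2 : ℝ) k]
  push_cast
  have hP : (0 : ℝ) < C * 2 ^ k := by positivity
  have : 2 * (k : ℝ) ≤ 4 * ((k + 1) * Real.log 2) := by nlinarith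
  calc C * (2 ^ k * 2) * k = (C * 2 ^ k) * (2 * k) := by ring
    _ ≤ (C * 2 ^ k) * (4 * ((k + 1) * Real.log 2)) := mul_le_mul_of_nonneg_left this hP.le
    _ = _ := by ring

lemma log_lower {r k : ℕ} (h : 2 ^ k ≤ r) : (k : ℝ) * Real.log 2 ≤ Real.log r := by
  rw [← Real.log_pow]
  exact Real.log_le_log (by positivity) (by exact_mod_cast h)

lemma log_upper {r k : ℕ} (hr : r ≠ 0) (h : r < 2 ^ (k + 1)) : Real.log r ≤ (k + 1 : ℝ) * Real.log 2 := by
  have : ((k + 1 : ℕ) : ℝ) * Real.log 2 = Real.log (2 ^ (k + 1)) := by rw [Real.log_pow]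
  push_cast at this
  rw [this]
  exact Real.log_le_log (by exact_mod_cast Nat.pos_of_ne_zero hr) (by exact_mod_cast h.le)

lemma log2_ge (y q : ℕ) (hy : 2 ≤ y) (hq : y ≤ q) : Nat.log 2 y ≤ Nat.log 2 q ∧ 1 ≤ Nat.log 2 y ∧
    Real.log y ≤ 2 * Nat.log 2 y := by
  have h1 : 1 ≤ Nat.log 2 y := Nat.log_pos (by norm_num) hy
  refine ⟨Nat.log_mono_right hq, h1, ?_⟩
  have h2 := log2_bounds (by omega) (rfl : Nat.log 2 y = _)
  have h3 := log_upper (by omega) h2.2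
  have h4 : (1 : ℝ) ≤ Nat.log 2 y := by exact_mod_cast h1
  have := Real.log_two_lt_d9
  nlinarith

/-- `∑ 1/(q log q)` over primes `q > y`. -/
lemma sum_qlogq : ∃ C : ℝ, 0 < C ∧ ∀ y : ℕ, 2 ≤ y → ∀ S : Finset ℕ, (∀ q ∈ S, q.Prime ∧ y ≤ q) →
    ∑ q ∈ S, ((q : ℝ) * Real.log q)⁻¹ ≤ C / Real.log y := by
  obtain ⟨C, hC, h⟩ := cheb_block
  refine ⟨8 * C, by linarith, fun y hy S hS => ?_⟩
  have hl2 := Real.log_two_gt_d9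
  obtain ⟨_, hy1, hy2⟩ := log2_ge y y hy le_rfl
  have hly : 0 < Real.log y := Real.log_pos (by exact_mod_cast hy)
  have := dyadic S (fun q => ((q : ℝ) * Real.log q)⁻¹) (2 * C) (by linarith) (Nat.log 2 y) hy1
    (fun q hq => (log2_ge y q hy (hS q hq).2).1) (by
    intro k hk
    have hk1 : 1 ≤ k := by omega
    have hk' : (1 : ℝ) ≤ k := by exact_mod_cast hk1
    have hc := h k hk1 (S.filter (fun r => Nat.log 2 r = k)) (by
      intro q hq
      rw [Finset.mem_filter] at hq
      exact ⟨(hS q hq.1).1, hq.2⟩)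
    calc _ ≤ ∑ q ∈ S.filter (fun r => Nat.log 2 r = k), ((2 : ℝ) ^ k * (k / 2))⁻¹ := by
          refine Finset.sum_le_sum (fun q hq => ?_)
          rw [Finset.mem_filter] at hq
          have hb := log2_bounds (hS q hq.1).1.ne_zero hq.2
          have hl := log_lower hb.1
          have hq' : (2 : ℝ) ^ k ≤ q := by exact_mod_cast hb.1
          refine inv_anti₀ (by positivity) ?_
          exact mul_le_mul hq' (by nlinarith) (by positivity) (by positivity)
      _ = ((S.filter (fun r => Nat.log 2 r = k)).card : ℝ) * ((2 : ℝ) ^ k * (k / 2))⁻¹ := by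
          rw [Finset.sum_const, nsmul_eq_mul]
      _ ≤ (C * 2 ^ k / k) * ((2 : ℝ) ^ k * (k / 2))⁻¹ := mul_le_mul_of_nonneg_right hc (by positivity)
      _ = 2 * C / (k : ℝ) ^ 2 := by field_simp)
  refine this.trans ?_
  have h0 : (0 : ℝ) < Nat.log 2 y := by exact_mod_cast hy1
  rw [div_le_div_iff₀ h0 hly]
  have := mul_le_mul_of_nonneg_left hy2 (show 0 ≤ 4 * C by linarith)
  linarith

/-- first exceptional set -/
lemma exc1 (p : ℕ) (hLP : ∃ C : ℝ, ∀ q : ℕ, q.Prime → Odd q → ∀ X : ℝ, 3 ≤ X →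
      (Nat.card {n : ℕ | 0 < n ∧ (n : ℝ) ≤ X ∧ ∃ r : ℕ, r.Prime ∧ r ∣ n ∧
          r % q = 1 ∧ (p : ZMod r) ^ ((r - 1) / q) = 1 ∧
          (q : ℝ) ^ 2 * (Real.log q) ^ 4 ≤ (r : ℝ)} : ℝ) ≤
        C * (X / (q * Real.log q) + X * Real.log (Real.log X) / (q : ℝ) ^ 2)) :
    ∃ C : ℝ, 0 < C ∧ ∀ y : ℕ, 2 ≤ y → ∀ X : ℝ, 3 ≤ X → 0 ≤ Real.log (Real.log X) →
      ∀ S : Finset ℕ, (∀ n ∈ S, 0 < n ∧ (n : ℝ) ≤ X ∧ ∃ q : ℕ, q.Prime ∧ y < q ∧ ∃ r : ℕ, r.Prime ∧ r ∣ n ∧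
          r % q = 1 ∧ (p : ZMod r) ^ ((r - 1) / q) = 1 ∧
          (q : ℝ) ^ 2 * (Real.log q) ^ 4 ≤ (r : ℝ)) →
      (S.card : ℝ) ≤ C * X * (1 / Real.log y + Real.log (Real.log X) / y) := by
  obtain ⟨C, hC⟩ := hLP
  obtain ⟨C2, hC2, h2⟩ := sum_qlogq
  refine ⟨(|C| + 1) * (C2 + 2), by positivity, fun y hy X hX hll S hS => ?_⟩
  set Q := (Finset.Icc 1 ⌊X⌋₊).filter (fun q => q.Prime ∧ y < q) with hQ
  set A : ℕ → Set ℕ := fun q => {n : ℕ | 0 < n ∧ (n : ℝ) ≤ X ∧ ∃ r : ℕ, r.Prime ∧ r ∣ n ∧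
          r % q = 1 ∧ (p : ZMod r) ^ ((r - 1) / q) = 1 ∧
          (q : ℝ) ^ 2 * (Real.log q) ^ 4 ≤ (r : ℝ)} with hA
  have hfin : ∀ q, (A q).Finite := by
    intro q
    refine (Finset.Icc 1 ⌊X⌋₊).finite_toSet.subset ?_
    intro n hn
    simp only [hA, Set.mem_setOf_eq] at hn
    simp only [Finset.coe_Icc, Set.mem_Icc]
    exact ⟨hn.1, Nat.le_floor hn.2.1⟩
  have hsub : S ⊆ Q.biUnion (fun q => (hfin q).toFinset) := by
    intro n hn
    obtain ⟨hn0, hnX, q, hq, hyq, r, hr, hrn, hrq, hpow, hqr⟩ := hS n hn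
    rw [Finset.mem_biUnion]
    refine ⟨q, ?_, ?_⟩
    · rw [hQ, Finset.mem_filter, Finset.mem_Icc]
      refine ⟨⟨hq.one_lt.le, ?_⟩, hq, hyq⟩
      have hqr : q ≤ r := by
        have h1 : q ∣ r - 1 := (Nat.modEq_iff_dvd' hr.one_lt.le).mp (by
          unfold Nat.ModEq; rw [hrq, Nat.mod_eq_of_lt hq.one_lt])
        have := Nat.le_of_dvd (by have := hr.two_le; omega) h1
        omega
      exact hqr.trans ((Nat.le_of_dvd hn0 hrn).trans (Nat.le_floor hnX))
    · rw [Set.Finite.mem_toFinset]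
      exact ⟨hn0, hnX, r, hr, hrn, hrq, hpow, hqr⟩
  have hcard : (S.card : ℝ) ≤ ∑ q ∈ Q, (Nat.card (A q) : ℝ) := by
    have h3 := (Finset.card_le_card hsub).trans Finset.card_biUnion_le
    have h4 : ∑ q ∈ Q, ((hfin q).toFinset).card = ∑ q ∈ Q, Nat.card (A q) := by
      refine Finset.sum_congr rfl (fun q _ => ?_)
      rw [Nat.card_coe_set_eq, Set.ncard_eq_toFinset_card _ (hfin q)]
    rw [h4] at h3
    exact_mod_cast h3
  have hQp : ∀ q ∈ Q, q.Prime ∧ y ≤ q := by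
    intro q hq
    rw [hQ, Finset.mem_filter] at hq
    exact ⟨hq.2.1, hq.2.2.le⟩
  have hb1 := h2 y hy Q hQp
  have hb2 : ∑ q ∈ Q, ((q : ℝ) ^ 2)⁻¹ ≤ 2 / y := sum_sq_tail y (by omega) Q (fun q hq => (hQp q hq).2)
  have hterm : ∀ q ∈ Q, (Nat.card (A q) : ℝ) ≤ (|C| + 1) * X * (((q : ℝ) * Real.log q)⁻¹ + Real.log (Real.log X) * ((q : ℝ) ^ 2)⁻¹) := by
    intro q hq
    have hq' := hQ ▸ hq
    rw [Finset.mem_filter] at hq'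
    have hodd : Odd q := hq'.2.1.odd_of_ne_two (by omega)
    have h5 := hC q hq'.2.1 hodd X hX
    have hlq : 0 < Real.log q := Real.log_pos (by exact_mod_cast hq'.2.1.one_lt)
    have e : X / (q * Real.log q) + X * Real.log (Real.log X) / (q : ℝ) ^ 2 = X * (((q : ℝ) * Real.log q)⁻¹ + Real.log (Real.log X) * ((q : ℝ) ^ 2)⁻¹) := by
      rw [div_eq_mul_inv, div_eq_mul_inv]; ring
    rw [e] at h5
    have hnn : 0 ≤ X * (((q : ℝ) * Real.log q)⁻¹ + Real.log (Real.log X) * ((q : ℝ) ^ 2)⁻¹) := by positivity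
    have h6 := mul_le_mul_of_nonneg_right (show C ≤ |C| + 1 by linarith [le_abs_self C]) hnn
    rw [← mul_assoc] at h6
    linarith
  have hX0 : 0 < X := by linarith
  have hly : 0 < Real.log y := Real.log_pos (by exact_mod_cast hy)
  calc (S.card : ℝ) ≤ _ := hcard
    _ ≤ _ := Finset.sum_le_sum hterm
    _ = (|C| + 1) * X * (∑ q ∈ Q, ((q : ℝ) * Real.log q)⁻¹ + Real.log (Real.log X) * ∑ q ∈ Q, ((q : ℝ) ^ 2)⁻¹) := by
        rw [← Finset.mul_sum, Finset.sum_add_distrib, ← Finset.mul_sum]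
    _ ≤ (|C| + 1) * X * (C2 / Real.log y + Real.log (Real.log X) * (2 / y)) := by gcongr
    _ ≤ (|C| + 1) * X * ((C2 + 2) * (1 / Real.log y + Real.log (Real.log X) / y)) := by
        refine mul_le_mul_of_nonneg_left ?_ (by positivity)
        have a1 : 0 ≤ 1 / Real.log y := by positivity
        have a2 : 0 ≤ Real.log (Real.log X) / y := by positivity
        have a3 := mul_nonneg hC2.le a2
        have e1 : C2 / Real.log y = C2 * (1 / Real.log y) := by ring
        have e2 : Real.log (Real.log X) * (2 / (y : ℝ)) = 2 * (Real.log (Real.log X) / y) := by ring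
        rw [e1, e2]
        linarith
    _ = _ := by ring

/-- counting multiples -/
lemma count_mult (X : ℝ) (hX : 0 ≤ X) (S R : Finset ℕ)
    (hS : ∀ n ∈ S, 0 < n ∧ (n : ℝ) ≤ X ∧ ∃ r ∈ R, r ∣ n) :
    (S.card : ℝ) ≤ X * ∑ r ∈ R, ((r : ℝ))⁻¹ := by
  have hsub : S ⊆ R.biUnion (fun r => (Finset.Ioc 0 ⌊X⌋₊).filter (fun n => r ∣ n)) := by
    intro n hn
    obtain ⟨h0, h1, r, hr, hrn⟩ := hS n hn
    rw [Finset.mem_biUnion]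
    exact ⟨r, hr, by rw [Finset.mem_filter, Finset.mem_Ioc]; exact ⟨⟨h0, Nat.le_floor h1⟩, hrn⟩⟩
  have h3 := (Finset.card_le_card hsub).trans Finset.card_biUnion_le
  have h4 : (S.card : ℝ) ≤ ∑ r ∈ R, (((Finset.Ioc 0 ⌊X⌋₊).filter (fun n => r ∣ n)).card : ℝ) := by exact_mod_cast h3
  refine h4.trans ?_
  rw [Finset.mul_sum]
  refine Finset.sum_le_sum (fun r _ => ?_)
  rw [Nat.Ioc_filter_dvd_card_eq_div]
  calc ((⌊X⌋₊ / r : ℕ) : ℝ) ≤ (⌊X⌋₊ : ℝ) / r := Nat.cast_div_le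
    _ ≤ X / r := by gcongr; exact Nat.floor_le hX
    _ = _ := div_eq_mul_inv _ _

end PP

namespace PP

/-- primes with small order -/
lemma exc_low (p : ℕ) (hp : p.Prime) : ∃ C : ℝ, 0 < C ∧ ∀ T : ℕ, 2 ≤ T → ∀ R : Finset ℕ,
    (∀ r ∈ R, r.Prime ∧ T < r ∧ r ≠ p ∧ (orderOf (p : ZMod r) : ℝ) * Real.log r ≤ Real.sqrt r) →
    ∑ r ∈ R, ((r : ℝ))⁻¹ ≤ C / Real.log T := by
  have hlp : 0 < Real.log p := Real.log_pos (by exact_mod_cast hp.one_lt)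
  refine ⟨4 * (16 * Real.log p), by positivity, fun T hT R hR => ?_⟩
  have hl2 := Real.log_two_gt_d9
  obtain ⟨_, hy1, hy2⟩ := log2_ge T T hT le_rfl
  have hlT : 0 < Real.log T := Real.log_pos (by exact_mod_cast hT)
  have := dyadic R (fun q => ((q : ℝ))⁻¹) (16 * Real.log p) (by positivity) (Nat.log 2 T) hy1
    (fun q hq => (log2_ge T q hT (hR q hq).2.1.le).1) (by
    intro k hk
    have hk1 : 1 ≤ k := by omega
    have hk' : (1 : ℝ) ≤ k := by exact_mod_cast hk1
    set S := R.filter (fun r => Nat.log 2 r = k) with hS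
    have hSb : ∀ r ∈ S, r.Prime ∧ 2 ^ k ≤ r ∧ r < 2 ^ (k + 1) ∧ r ≠ p ∧ (orderOf (p : ZMod r) : ℝ) * Real.log r ≤ Real.sqrt r := by
      intro r hr
      rw [hS, Finset.mem_filter] at hr
      obtain ⟨h1, h2, h3, h4⟩ := hR r hr.1
      have := log2_bounds h1.ne_zero hr.2
      exact ⟨h1, this.1, this.2, h3, h4⟩
    set Z : ℝ := Real.sqrt (2 ^ (k + 1)) / (k / 2) with hZ
    have hZ0 : 0 ≤ Z := by positivity
    set M := ⌊Z⌋₊ with hM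
    have hMZ : (M : ℝ) ≤ Z := Nat.floor_le hZ0
    have hord : ∀ r ∈ S, orderOf (p : ZMod r) ≤ M := by
      intro r hr
      obtain ⟨h1, h2, h3, h4, h5⟩ := hSb r hr
      apply Nat.le_floor
      rw [hZ, le_div_iff₀ (by positivity)]
      have hl := log_lower h2
      have : (k : ℝ) / 2 ≤ Real.log r := by nlinarith
      calc (orderOf (p : ZMod r) : ℝ) * (k / 2) ≤ orderOf (p : ZMod r) * Real.log r := by gcongr
        _ ≤ Real.sqrt r := h5
        _ ≤ _ := Real.sqrt_le_sqrt (by exact_mod_cast h3.le)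
    set P := ∏ l ∈ Finset.Icc 1 M, (p ^ l - 1) with hP
    have hfac : ∀ l ∈ Finset.Icc 1 M, 1 ≤ p ^ l - 1 := by
      intro l hl
      rw [Finset.mem_Icc] at hl
      have : p ^ 1 ≤ p ^ l := Nat.pow_le_pow_right hp.pos hl.1
      have h2 := hp.two_le
      rw [pow_one] at this
      omega
    have hP0 : P ≠ 0 := Finset.prod_ne_zero_iff.mpr (fun l hl => by have := hfac l hl; omega)
    have hsub : S ⊆ P.primeFactors := by
      intro r hr
      obtain ⟨h1, h2, h3, h4, h5⟩ := hSb r hr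
      haveI : Fact r.Prime := ⟨h1⟩
      rw [Nat.mem_primeFactors]
      refine ⟨h1, ?_, hP0⟩
      have hne : (p : ZMod r) ≠ 0 := by
        intro h
        rw [ZMod.natCast_eq_zero_iff] at h
        exact h4 ((Nat.prime_dvd_prime_iff_eq h1 hp).mp h)
      have hdv : orderOf (p : ZMod r) ∣ r - 1 := ZMod.orderOf_dvd_card_sub_one hne
      have hpos : 0 < orderOf (p : ZMod r) := Nat.pos_of_dvd_of_pos hdv (by have := h1.two_le; omega)
      have hmem : orderOf (p : ZMod r) ∈ Finset.Icc 1 M := by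
        rw [Finset.mem_Icc]; exact ⟨hpos, hord r hr⟩
      refine dvd_trans ?_ (Finset.dvd_prod_of_mem _ hmem)
      rw [← ZMod.natCast_eq_zero_iff, Nat.cast_sub (Nat.one_le_pow _ _ hp.pos)]
      push_cast
      rw [pow_orderOf_eq_one, sub_self]
    have hlogP : Real.log P ≤ (M : ℝ) * (M * Real.log p) := by
      rw [hP]
      push_cast
      rw [Real.log_prod (fun l hl => by
        have := hfac l hl
        have : (0:ℝ) < ((p ^ l - 1 : ℕ) : ℝ) := by exact_mod_cast this
        exact this.ne')]
      calc _ ≤ ∑ l ∈ Finset.Icc 1 M, ((M : ℝ) * Real.log p) := by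
            refine Finset.sum_le_sum (fun l hl => ?_)
            have h1 := hfac l hl
            rw [Finset.mem_Icc] at hl
            calc Real.log ((p ^ l - 1 : ℕ) : ℝ) ≤ Real.log ((p : ℝ) ^ l) := by
                  apply Real.log_le_log (by exact_mod_cast h1)
                  exact_mod_cast Nat.sub_le _ _
              _ = l * Real.log p := Real.log_pow _ _
              _ ≤ M * Real.log p := by
                  have : (l : ℝ) ≤ M := by exact_mod_cast hl.2
                  gcongr
        _ = _ := by rw [Finset.sum_const, Nat.card_Icc, nsmul_eq_mul]; simp
    have hsum : (S.card : ℝ) * (k / 2) ≤ (M : ℝ) * (M * Real.log p) := by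
      calc (S.card : ℝ) * (k / 2) = ∑ r ∈ S, ((k : ℝ) / 2) := by rw [Finset.sum_const, nsmul_eq_mul]
        _ ≤ ∑ r ∈ S, Real.log r := Finset.sum_le_sum (fun r hr => by
            have := log_lower (hSb r hr).2.1
            nlinarith)
        _ ≤ ∑ r ∈ P.primeFactors, Real.log r := Finset.sum_le_sum_of_subset_of_nonneg hsub
            (fun r _ _ => Real.log_natCast_nonneg r)
        _ ≤ Real.log P := log_prod_primeFactors_le hP0
        _ ≤ _ := hlogP
    have hM2 : (M : ℝ) * M ≤ 8 * 2 ^ k / k ^ 2 := by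
      calc (M : ℝ) * M ≤ Z * Z := mul_le_mul hMZ hMZ (by positivity) hZ0
        _ = (Real.sqrt (2 ^ (k + 1)) * Real.sqrt (2 ^ (k + 1))) / ((k / 2) * (k / 2)) := by
            rw [hZ]; field_simp
        _ = 8 * 2 ^ k / k ^ 2 := by
            rw [Real.mul_self_sqrt (by positivity), pow_succ (2 : ℝ) k]; field_simp; norm_num
    have hcard : (S.card : ℝ) ≤ 16 * Real.log p * 2 ^ k / k ^ 2 := by
      have e1 : (S.card : ℝ) * (1 / 2) ≤ (S.card : ℝ) * (k / 2) := by gcongr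
      have e2 := mul_le_mul_of_nonneg_right hM2 hlp.le
      have e3 : 16 * Real.log p * 2 ^ k / (k : ℝ) ^ 2 = 2 * (8 * 2 ^ k / k ^ 2 * Real.log p) := by ring
      rw [e3]
      linarith
    calc _ ≤ ∑ r ∈ S, ((2 : ℝ) ^ k)⁻¹ := Finset.sum_le_sum (fun r hr => by
          apply inv_anti₀ (by positivity)
          exact_mod_cast (hSb r hr).2.1)
      _ = (S.card : ℝ) * ((2 : ℝ) ^ k)⁻¹ := by rw [Finset.sum_const, nsmul_eq_mul]
      _ ≤ (16 * Real.log p * 2 ^ k / k ^ 2) * ((2 : ℝ) ^ k)⁻¹ := mul_le_mul_of_nonneg_right hcard (by positivity)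
      _ = _ := by field_simp)
  refine this.trans ?_
  have h0 : (0 : ℝ) < Nat.log 2 T := by exact_mod_cast hy1
  rw [div_le_div_iff₀ h0 hlT]
  have := mul_le_mul_of_nonneg_left hy2 (show 0 ≤ 2 * (16 * Real.log p) by positivity)
  linarith

/-- the smooth index case -/
lemma exc_smooth : ∃ C : ℝ, 0 < C ∧ ∀ y T : ℕ, 2 ≤ y → 1 ≤ T → ∀ L : ℝ, 0 ≤ L → ∀ R : Finset ℕ, ∀ i l : ℕ → ℕ,
    (∀ r ∈ R, r = 1 + i r * l r ∧ l r ≠ 0 ∧ Real.log (l r) ≤ L ∧ T ≤ i r ∧ i r ∈ Nat.smoothNumbers (y + 1)) →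
    ∑ r ∈ R, ((r : ℝ))⁻¹ ≤ C * (1 + L) * Real.log y * (T : ℝ) ^ (- dl y) := by
  obtain ⟨c, hc, hW⟩ := Wσ_lower
  refine ⟨1 / c, by positivity, fun y T hy hT L hL R i l hR => ?_⟩
  have hy' : (2 : ℝ) ≤ y := by exact_mod_cast hy
  obtain ⟨d1, d2, d3, d4⟩ := dl_facts hy
  have hly : 0 < Real.log y := by linarith
  have hT0 : (0 : ℝ) < T := by exact_mod_cast hT
  set A := R.image i
  set B' := R.image l
  have hinj : Set.InjOn (fun r => (i r, l r)) (R : Set ℕ) := by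
    intro r hr s hs h
    simp only [Prod.mk.injEq] at h
    rw [(hR r hr).1, (hR s hs).1, h.1, h.2]
  have h1 : ∑ r ∈ R, ((r : ℝ))⁻¹ ≤ (∑ a ∈ A, ((a : ℝ))⁻¹) * (∑ b ∈ B', ((b : ℝ))⁻¹) := by
    rw [Finset.sum_mul_sum, ← Finset.sum_product']
    calc ∑ r ∈ R, ((r : ℝ))⁻¹ ≤ ∑ r ∈ R, ((i r : ℝ))⁻¹ * ((l r : ℝ))⁻¹ := by
          refine Finset.sum_le_sum (fun r hr => ?_)
          obtain ⟨e1, e2, e3, e4, e5⟩ := hR r hr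
          rw [← mul_inv]
          apply inv_anti₀
          · have : 0 < i r := by omega
            have : 0 < l r := Nat.pos_of_ne_zero e2
            positivity
          · have : i r * l r ≤ r := by omega
            exact_mod_cast this
      _ = ∑ x ∈ R.image (fun r => (i r, l r)), ((x.1 : ℝ))⁻¹ * ((x.2 : ℝ))⁻¹ := by
          rw [Finset.sum_image hinj]
      _ ≤ _ := by
          refine Finset.sum_le_sum_of_subset_of_nonneg ?_ (fun _ _ _ => by positivity)
          intro x hx
          rw [Finset.mem_image] at hx
          obtain ⟨r, hr, rfl⟩ := hx
          rw [Finset.mem_product]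
          exact ⟨Finset.mem_image_of_mem _ hr, Finset.mem_image_of_mem _ hr⟩
  have h2 : ∑ b ∈ B', ((b : ℝ))⁻¹ ≤ 1 + L := sum_inv_le B' L (by
    intro m hm
    rw [Finset.mem_image] at hm
    obtain ⟨r, hr, rfl⟩ := hm
    exact ⟨(hR r hr).2.1, (hR r hr).2.2.1⟩) hL
  have hA : ∀ a ∈ A, T ≤ a ∧ a ∈ Nat.smoothNumbers (y + 1) := by
    intro a ha
    rw [Finset.mem_image] at ha
    obtain ⟨r, hr, rfl⟩ := ha
    exact ⟨(hR r hr).2.2.2.1, (hR r hr).2.2.2.2⟩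
  have h3 : ∑ a ∈ A, ((a : ℝ))⁻¹ ≤ (T : ℝ) ^ (- dl y) * ∑ a ∈ A, (a : ℝ) ^ (-(1 - dl y)) := by
    rw [Finset.mul_sum]
    refine Finset.sum_le_sum (fun a ha => ?_)
    have haT : (T : ℝ) ≤ a := by exact_mod_cast (hA a ha).1
    have ha0 : (0 : ℝ) < a := by linarith
    have : (a : ℝ)⁻¹ = (a : ℝ) ^ (- dl y) * (a : ℝ) ^ (-(1 - dl y)) := by
      rw [← Real.rpow_add ha0, ← Real.rpow_neg_one]; congr 1; ring
    rw [this]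
    refine mul_le_mul_of_nonneg_right ?_ (by positivity)
    exact Real.rpow_le_rpow_of_nonpos hT0 haT (by linarith)
  have h4 : ∑ a ∈ A, (a : ℝ) ^ (-(1 - dl y)) ≤ 1 / c * Real.log y := by
    have hs := smooth_sum (σ := 1 - dl y) (by linarith) (y + 1) A (fun a ha => (hA a ha).2)
    have hw := hW y hy
    have hnn : 0 ≤ ∑ a ∈ A, (a : ℝ) ^ (-(1 - dl y)) := Finset.sum_nonneg (fun _ _ => by positivity)
    have h5 := mul_le_mul_of_nonneg_left hw hnn
    have h6 : (∑ a ∈ A, (a : ℝ) ^ (-(1 - dl y))) * (c / Real.log y) ≤ 1 := h5.trans hs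
    rw [← le_div_iff₀ (by positivity)] at h6
    refine h6.trans (le_of_eq ?_)
    field_simp
  have hTp : 0 ≤ (T : ℝ) ^ (- dl y) := by positivity
  have h5 : ∑ a ∈ A, ((a : ℝ))⁻¹ ≤ (T : ℝ) ^ (- dl y) * (1 / c * Real.log y) := h3.trans (mul_le_mul_of_nonneg_left h4 hTp)
  calc _ ≤ _ := h1
    _ ≤ ((T : ℝ) ^ (- dl y) * (1 / c * Real.log y)) * (1 + L) := mul_le_mul h5 h2 (Finset.sum_nonneg (fun _ _ => by positivity)) (by positivity)
    _ = _ := by ring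

end PP

namespace PP

lemma m_bound (k : ℕ) (hk : 64 ≤ k) : 8 * Nat.log 2 (k + 1) + 10 ≤ k ∧ 6 ≤ Nat.log 2 (k + 1) := by
  have h6 : 6 ≤ Nat.log 2 (k + 1) := by
    apply Nat.le_log_of_pow_le (by norm_num); norm_num; omega
  refine ⟨?_, h6⟩
  have h1 : 2 ^ Nat.log 2 (k + 1) ≤ k + 1 := Nat.pow_log_le_self 2 (by omega)
  rcases Nat.lt_or_ge (Nat.log 2 (k + 1)) 7 with h | h
  · omega
  · have : ∀ m, 7 ≤ m → 8 * m + 12 ≤ 2 ^ m := by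
      intro m hm
      induction m, hm using Nat.le_induction with
      | base => norm_num
      | succ n hn ih => rw [pow_succ]; omega
    have := this _ h
    omega

lemma mid_block : ∃ C : ℝ, 0 < C ∧ ∀ k : ℕ, 64 ≤ k → ∀ S : Finset ℕ,
    (∀ r ∈ S, r.Prime ∧ Nat.log 2 r = k ∧ ∃ q : ℕ, q.Prime ∧ q ∣ r - 1 ∧
      2 ^ k ≤ q ^ 2 * (k + 1) ^ 4 ∧ q ^ 2 ≤ 2 ^ (k + 1) * (k + 1) ^ 2) →
    (S.card : ℝ) ≤ C * 2 ^ k * Real.log k / (k : ℝ) ^ 2 := by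
  obtain ⟨C, hC, hch⟩ := cheb_block
  refine ⟨288 * 64 * C, by positivity, fun k hk S hS => ?_⟩
  obtain ⟨hm1, hm2⟩ := m_bound k hk
  have hk' : (64 : ℝ) ≤ k := by exact_mod_cast hk
  have hl2 := Real.log_two_gt_d9
  have hmb := log2_bounds (show k + 1 ≠ 0 by omega) (rfl : Nat.log 2 (k + 1) = _)
  set m := Nat.log 2 (k + 1) with hm
  set Q := (Finset.range (2 ^ (k + 1))).filter (fun q => q.Prime ∧ 2 ^ k ≤ q ^ 2 * (k + 1) ^ 4 ∧ q ^ 2 ≤ 2 ^ (k + 1) * (k + 1) ^ 2) with hQ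
  have hJ : ∀ q ∈ Q, q.Prime ∧ 2 * Nat.log 2 q ≤ k + 2 * m + 3 ∧ k ≤ 2 * Nat.log 2 q + 4 * m + 5 := by
    intro q hq
    rw [hQ, Finset.mem_filter] at hq
    obtain ⟨_, hq0, hq1, hq2⟩ := hq
    have hb := log2_bounds hq0.ne_zero (rfl : Nat.log 2 q = _)
    set j := Nat.log 2 q
    refine ⟨hq0, ?_, ?_⟩
    · have : 2 ^ (2 * j) < 2 ^ (k + 1 + 2 * (m + 1)) := by
        calc 2 ^ (2 * j) = (2 ^ j) ^ 2 := by rw [← pow_mul, mul_comm]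
          _ ≤ q ^ 2 := Nat.pow_le_pow_left hb.1 2
          _ ≤ 2 ^ (k + 1) * (k + 1) ^ 2 := hq2
          _ < 2 ^ (k + 1) * (2 ^ (m + 1)) ^ 2 := by
              apply Nat.mul_lt_mul_of_pos_left (Nat.pow_lt_pow_left hmb.2 (by norm_num)) (by positivity)
          _ = 2 ^ (k + 1 + 2 * (m + 1)) := by rw [← pow_mul, ← pow_add]; congr 1; ring
      have := (Nat.pow_lt_pow_iff_right (by norm_num : 1 < 2)).mp this
      omega
    · have : 2 ^ k < 2 ^ (2 * (j + 1) + 4 * (m + 1)) := by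
        calc 2 ^ k ≤ q ^ 2 * (k + 1) ^ 4 := hq1
          _ < (2 ^ (j + 1)) ^ 2 * (2 ^ (m + 1)) ^ 4 := by
              apply Nat.mul_lt_mul'' (Nat.pow_lt_pow_left hb.2 (by norm_num)) (Nat.pow_lt_pow_left hmb.2 (by norm_num))
          _ = _ := by rw [← pow_mul, ← pow_mul, ← pow_add]; congr 1; ring
      have := (Nat.pow_lt_pow_iff_right (by norm_num : 1 < 2)).mp this
      omega
  set N : ℕ → ℕ := fun q => 2 ^ (k + 1) / q with hN
  set V : ℕ → Finset ℕ := fun q => (Finset.Ioc 0 (N q)).filter (fun j : ℕ => (1 + q * j).Prime) with hV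
  have hsub : S ⊆ Q.biUnion (fun q => (V q).image (fun j => 1 + q * j)) := by
    intro r hr
    obtain ⟨hrp, hrk, q, hq, ⟨j, hj⟩, hq1, hq2⟩ := hS r hr
    have hb := log2_bounds hrp.ne_zero hrk
    have hr2 := hrp.two_le
    have hrj : r = 1 + q * j := by omega
    have hj0 : 0 < j := by
      apply Nat.pos_of_ne_zero
      rintro rfl
      omega
    have hqr : q ≤ q * j := Nat.le_mul_of_pos_right _ hj0
    rw [Finset.mem_biUnion]
    refine ⟨q, ?_, ?_⟩
    · rw [hQ, Finset.mem_filter, Finset.mem_range]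
      exact ⟨by omega, hq, hq1, hq2⟩
    · rw [Finset.mem_image]
      refine ⟨j, ?_, hrj.symm⟩
      rw [hV]
      simp only
      rw [Finset.mem_filter, Finset.mem_Ioc]
      refine ⟨⟨hj0, ?_⟩, hrj ▸ hrp⟩
      rw [hN]
      simp only
      rw [Nat.le_div_iff_mul_le hq.pos]
      rw [mul_comm]; omega
  have hVc : ∀ q ∈ Q, ((V q).card : ℝ) ≤ 288 * 2 ^ k / k * (q : ℝ)⁻¹ := by
    intro q hq
    obtain ⟨hqp, hj1, hj2⟩ := hJ q hq
    have hb := log2_bounds hqp.ne_zero (rfl : Nat.log 2 q = _)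
    set j := Nat.log 2 q
    have hjk : k ≤ 4 * j := by omega
    have hkj : k ≤ 4 * (k - j) := by omega
    have hN1 : 2 ^ (k - j) ≤ N q := by
      rw [hN]
      simp only
      rw [Nat.le_div_iff_mul_le hqp.pos]
      calc 2 ^ (k - j) * q ≤ 2 ^ (k - j) * 2 ^ (j + 1) := Nat.mul_le_mul_left _ hb.2.le
        _ = 2 ^ (k + 1) := by rw [← pow_add]; congr 1; omega
    have hN2 : 2 ≤ N q := by
      calc 2 = 2 ^ 1 := by norm_num
        _ ≤ 2 ^ (k - j) := Nat.pow_le_pow_right (by norm_num) (by omega)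
        _ ≤ _ := hN1
    have hN3 : N q ≤ q ^ 4 := by
      rw [hN]
      simp only
      apply Nat.div_le_of_le_mul
      calc 2 ^ (k + 1) ≤ 2 ^ (j * 5) := Nat.pow_le_pow_right (by norm_num) (by omega)
        _ = (2 ^ j) ^ 5 := by rw [pow_mul]
        _ ≤ q ^ 5 := Nat.pow_le_pow_left hb.1 5
        _ = q * q ^ 4 := by ring
    have hbt := brun_titchmarsh q (N q) hqp hN2 hN3
    have hlN : (k : ℝ) / 8 ≤ Real.log (N q) := by
      have h1 := log_lower hN1
      have h2 : (k : ℝ) ≤ 4 * ((k - j : ℕ) : ℝ) := by exact_mod_cast hkj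
      nlinarith
    have hNle : (N q : ℝ) ≤ 2 ^ (k + 1) / q := by
      rw [hN]
      refine Nat.cast_div_le.trans ?_
      push_cast; rfl
    have hq0 : (0 : ℝ) < q := by exact_mod_cast hqp.pos
    calc ((V q).card : ℝ) ≤ 18 * (N q) / Real.log (N q) := hbt
      _ ≤ 18 * (2 ^ (k + 1) / q) / (k / 8) := by gcongr
      _ = _ := by rw [pow_succ (2 : ℝ) k]; field_simp; norm_num
  have hcard : (S.card : ℝ) ≤ ∑ q ∈ Q, ((V q).card : ℝ) := by
    have h3 := (Finset.card_le_card hsub).trans Finset.card_biUnion_le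
    have h4 : ∑ q ∈ Q, ((V q).image (fun j => 1 + q * j)).card ≤ ∑ q ∈ Q, (V q).card :=
      Finset.sum_le_sum (fun q _ => Finset.card_image_le)
    exact_mod_cast h3.trans h4
  have hQsum : ∑ q ∈ Q, ((q : ℝ))⁻¹ ≤ 16 * Real.log k * (4 * C / k) := by
    rw [← Finset.sum_fiberwise_of_maps_to (t := Q.image (Nat.log 2)) (g := Nat.log 2)
      (fun r hr => Finset.mem_image_of_mem _ hr)]
    have hin : ∀ j ∈ Q.image (Nat.log 2), ∑ q ∈ Q.filter (fun q => Nat.log 2 q = j), ((q : ℝ))⁻¹ ≤ 4 * C / k := by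
      intro j hj
      rw [Finset.mem_image] at hj
      obtain ⟨q0, hq0, rfl⟩ := hj
      obtain ⟨_, hj1, hj2⟩ := hJ q0 hq0
      set j := Nat.log 2 q0
      have hjk : k ≤ 4 * j := by omega
      have hjk' : (k : ℝ) ≤ 4 * j := by exact_mod_cast hjk
      have hc := hch j (by omega) (Q.filter (fun q => Nat.log 2 q = j)) (fun q hq => by
        rw [Finset.mem_filter] at hq
        exact ⟨(hJ q hq.1).1, hq.2⟩)
      calc _ ≤ ∑ q ∈ Q.filter (fun q => Nat.log 2 q = j), ((2 : ℝ) ^ j)⁻¹ := by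
            refine Finset.sum_le_sum (fun q hq => ?_)
            rw [Finset.mem_filter] at hq
            have hb := log2_bounds (hJ q hq.1).1.ne_zero hq.2
            exact inv_anti₀ (by positivity) (by exact_mod_cast hb.1)
        _ = ((Q.filter (fun q => Nat.log 2 q = j)).card : ℝ) * ((2 : ℝ) ^ j)⁻¹ := by rw [Finset.sum_const, nsmul_eq_mul]
        _ ≤ (C * 2 ^ j / j) * ((2 : ℝ) ^ j)⁻¹ := mul_le_mul_of_nonneg_right hc (by positivity)
        _ = C / j := by field_simp
        _ ≤ 4 * C / k := by
            rw [div_le_div_iff₀ (by linarith) (by linarith)]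
            have := mul_le_mul_of_nonneg_left hjk' hC.le
            linarith
    have hcJ : ((Q.image (Nat.log 2)).card : ℝ) ≤ 16 * Real.log k := by
      have h1 : Q.image (Nat.log 2) ⊆ Finset.Icc ((k - 4 * m - 5) / 2) ((k + 2 * m + 3) / 2) := by
        intro j hj
        rw [Finset.mem_image] at hj
        obtain ⟨q0, hq0, rfl⟩ := hj
        obtain ⟨_, hj1, hj2⟩ := hJ q0 hq0
        rw [Finset.mem_Icc]
        omega
      have h2 := Finset.card_le_card h1
      rw [Nat.card_Icc] at h2
      have h3 : (Q.image (Nat.log 2)).card ≤ 4 * m := by omega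
      have h4 : ((Q.image (Nat.log 2)).card : ℝ) ≤ 4 * m := by exact_mod_cast h3
      have h5 := log_lower hmb.1
      have h6 : Real.log ((k + 1 : ℕ) : ℝ) ≤ 2 * Real.log k := by
        have : 2 * Real.log k = Real.log ((k : ℝ) ^ 2) := by rw [Real.log_pow]; norm_num
        rw [this]
        apply Real.log_le_log (by positivity)
        push_cast
        nlinarith
      have h7 : (0 : ℝ) ≤ m := by positivity
      nlinarith
    calc _ ≤ ∑ j ∈ Q.image (Nat.log 2), 4 * C / (k : ℝ) := Finset.sum_le_sum hin
      _ = ((Q.image (Nat.log 2)).card : ℝ) * (4 * C / (k : ℝ)) := by rw [Finset.sum_const, nsmul_eq_mul]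
      _ ≤ _ := mul_le_mul_of_nonneg_right hcJ (by positivity)
  calc (S.card : ℝ) ≤ _ := hcard
    _ ≤ ∑ q ∈ Q, 288 * 2 ^ k / k * (q : ℝ)⁻¹ := Finset.sum_le_sum hVc
    _ = 288 * 2 ^ k / k * ∑ q ∈ Q, (q : ℝ)⁻¹ := by rw [Finset.mul_sum]
    _ ≤ 288 * 2 ^ k / k * (16 * Real.log k * (4 * C / k)) := mul_le_mul_of_nonneg_left hQsum (by positivity)
    _ = _ := by ring

lemma exc_mid : ∃ C : ℝ, 0 < C ∧ ∀ T : ℕ, 2 ^ 64 ≤ T → ∀ X : ℝ, 2 ≤ Real.log X → ∀ R : Finset ℕ,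
    (∀ r ∈ R, r.Prime ∧ T < r ∧ (r : ℝ) ≤ X ∧ ∃ q : ℕ, q.Prime ∧ q ∣ r - 1 ∧
      Real.sqrt r ≤ q * Real.log r ^ 2 ∧ (q : ℝ) ≤ Real.sqrt r * Real.log r) →
    ∑ r ∈ R, ((r : ℝ))⁻¹ ≤ C * Real.log (Real.log X) / Real.log T := by
  obtain ⟨C, hC, hmb⟩ := mid_block
  refine ⟨8 * C, by positivity, fun T hT X hX R hR => ?_⟩
  have hl2 := Real.log_two_gt_d9
  have hl2' := Real.log_two_lt_d9
  have hT2 : 2 ≤ T := le_trans (by norm_num) hT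
  obtain ⟨_, hy1, hy2⟩ := log2_ge T T hT2 le_rfl
  have hk64 : 64 ≤ Nat.log 2 T := Nat.le_log_of_pow_le (by norm_num) hT
  have hlT : 0 < Real.log T := Real.log_pos (by exact_mod_cast hT2)
  have hll : 0 < Real.log (Real.log X) := Real.log_pos (by linarith)
  have := dyadic R (fun q => ((q : ℝ))⁻¹) (2 * C * Real.log (Real.log X)) (by positivity) (Nat.log 2 T) hy1
    (fun q hq => (log2_ge T q hT2 (hR q hq).2.1.le).1) (by
    intro k hk
    have hk1 : 64 ≤ k := by omega
    have hk' : (64 : ℝ) ≤ k := by exact_mod_cast hk1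
    set S := R.filter (fun r => Nat.log 2 r = k) with hS
    rcases S.eq_empty_or_nonempty with hemp | ⟨r0, hr0⟩
    · rw [hemp, Finset.sum_empty]; positivity
    have hSb : ∀ r ∈ S, r.Prime ∧ 2 ^ k ≤ r ∧ r < 2 ^ (k + 1) ∧ (r : ℝ) ≤ X := by
      intro r hr
      rw [hS, Finset.mem_filter] at hr
      obtain ⟨h1, h2, h3, h4⟩ := hR r hr.1
      have := log2_bounds h1.ne_zero hr.2
      exact ⟨h1, this.1, this.2, h3⟩
    have hlk : Real.log k ≤ 2 * Real.log (Real.log X) := by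
      obtain ⟨h1, h2, h3, h4⟩ := hSb r0 hr0
      have h5 := log_lower h2
      have h6 : Real.log r0 ≤ Real.log X := Real.log_le_log (by exact_mod_cast h1.pos) h4
      have h7 : (k : ℝ) ≤ Real.log X ^ 2 := by nlinarith
      have := Real.log_le_log (by linarith) h7
      rw [Real.log_pow] at this
      push_cast at this
      exact this
    have hc := hmb k hk1 S (by
      intro r hr
      have hr' := hr
      rw [hS, Finset.mem_filter] at hr'
      obtain ⟨h1, h2, h3, q, hq, hqd, hq1, hq2⟩ := hR r hr'.1
      obtain ⟨_, hb1, hb2, _⟩ := hSb r hr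
      refine ⟨h1, hr'.2, q, hq, hqd, ?_, ?_⟩
      · have hlr := log_upper h1.ne_zero hb2
        have hlr0 : 0 ≤ Real.log r := Real.log_natCast_nonneg r
        have hlr' : Real.log r ≤ k + 1 := by nlinarith
        have e1 : Real.sqrt r ≤ q * (k + 1 : ℝ) ^ 2 := hq1.trans (by gcongr)
        have e2 : (r : ℝ) ≤ (q : ℝ) ^ 2 * (k + 1 : ℝ) ^ 4 := by
          calc (r : ℝ) = Real.sqrt r ^ 2 := (Real.sq_sqrt (by positivity)).symm
            _ ≤ (q * (k + 1 : ℝ) ^ 2) ^ 2 := pow_le_pow_left₀ (Real.sqrt_nonneg _) e1 2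
            _ = _ := by ring
        have e3 : r ≤ q ^ 2 * (k + 1) ^ 4 := by exact_mod_cast e2
        exact hb1.trans e3
      · have hlr := log_upper h1.ne_zero hb2
        have hlr0 : 0 ≤ Real.log r := Real.log_natCast_nonneg r
        have hlr' : Real.log r ≤ k + 1 := by nlinarith
        have e2 : (q : ℝ) ^ 2 ≤ r * (k + 1 : ℝ) ^ 2 := by
          calc (q : ℝ) ^ 2 ≤ (Real.sqrt r * Real.log r) ^ 2 := pow_le_pow_left₀ (by positivity) hq2 2
            _ ≤ (Real.sqrt r * (k + 1)) ^ 2 := by gcongr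
            _ = r * (k + 1 : ℝ) ^ 2 := by rw [mul_pow, Real.sq_sqrt (by positivity)]
        have e3 : q ^ 2 ≤ r * (k + 1) ^ 2 := by exact_mod_cast e2
        exact e3.trans (Nat.mul_le_mul_right _ hb2.le))
    calc _ ≤ ∑ r ∈ S, ((2 : ℝ) ^ k)⁻¹ := Finset.sum_le_sum (fun r hr => by
          apply inv_anti₀ (by positivity)
          exact_mod_cast (hSb r hr).2.1)
      _ = (S.card : ℝ) * ((2 : ℝ) ^ k)⁻¹ := by rw [Finset.sum_const, nsmul_eq_mul]
      _ ≤ (C * 2 ^ k * Real.log k / (k : ℝ) ^ 2) * ((2 : ℝ) ^ k)⁻¹ := mul_le_mul_of_nonneg_right hc (by positivity)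
      _ = C * Real.log k / (k : ℝ) ^ 2 := by field_simp
      _ ≤ _ := by
          have := mul_le_mul_of_nonneg_left hlk hC.le
          gcongr ?_ / _
          linarith)
  refine this.trans ?_
  have h0 : (0 : ℝ) < Nat.log 2 T := by exact_mod_cast hy1
  rw [div_le_div_iff₀ h0 hlT]
  have := mul_le_mul_of_nonneg_left hy2 (show 0 ≤ 2 * (2 * C * Real.log (Real.log X)) by positivity)
  linarith

end PP

namespace PP

/-- classification of exceptional primes -/
lemma classify (p : ℕ) (hp : p.Prime) (y T r : ℕ) (hr : r.Prime) (hpT : p ≤ T) (hTr : T < r)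
    (hbad : T * orderOf (p : ZMod r) < r) :
    (∃ q : ℕ, q.Prime ∧ y < q ∧ r % q = 1 ∧ (p : ZMod r) ^ ((r - 1) / q) = 1 ∧ (q : ℝ) ^ 2 * (Real.log q) ^ 4 ≤ (r : ℝ)) ∨
    ((orderOf (p : ZMod r) : ℝ) * Real.log r ≤ Real.sqrt r) ∨
    (∃ q : ℕ, q.Prime ∧ q ∣ r - 1 ∧ Real.sqrt r ≤ q * Real.log r ^ 2 ∧ (q : ℝ) ≤ Real.sqrt r * Real.log r) ∨
    (r = 1 + ((r - 1) / orderOf (p : ZMod r)) * orderOf (p : ZMod r) ∧ orderOf (p : ZMod r) ≠ 0 ∧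
      orderOf (p : ZMod r) ≤ r ∧ T ≤ (r - 1) / orderOf (p : ZMod r) ∧
      (r - 1) / orderOf (p : ZMod r) ∈ Nat.smoothNumbers (y + 1)) := by
  have : Fact r.Prime := ⟨hr⟩
  have hr2 := hr.two_le
  have hne : (p : ZMod r) ≠ 0 := by
    intro h
    rw [ZMod.natCast_eq_zero_iff] at h
    have := (Nat.prime_dvd_prime_iff_eq hr hp).mp h
    omega
  have hdv : orderOf (p : ZMod r) ∣ r - 1 := ZMod.orderOf_dvd_card_sub_one hne
  have hpos : 0 < orderOf (p : ZMod r) := Nat.pos_of_dvd_of_pos hdv (by omega)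
  set l := orderOf (p : ZMod r) with hl
  obtain ⟨i, hi⟩ := hdv
  have hdiv : (r - 1) / l = i := by rw [hi, Nat.mul_div_cancel_left _ hpos]
  have hi0 : i ≠ 0 := by rintro rfl; omega
  rw [hdiv]
  by_cases hsm : ∃ q : ℕ, q.Prime ∧ q ∣ i ∧ y < q
  · obtain ⟨q, hq, ⟨c, hc⟩, hyq⟩ := hsm
    have hqr1 : q ∣ r - 1 := ⟨l * c, by rw [hi, hc]; ring⟩
    have hqle : q ≤ r - 1 := Nat.le_of_dvd (by omega) hqr1
    by_cases hbig : (q : ℝ) ^ 2 * (Real.log q) ^ 4 ≤ (r : ℝ)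
    · left
      refine ⟨q, hq, hyq, ?_, ?_, hbig⟩
      · have h1 : 1 ≡ r [MOD q] := (Nat.modEq_iff_dvd' (by omega)).mpr hqr1
        unfold Nat.ModEq at h1
        rw [← h1, Nat.mod_eq_of_lt hq.one_lt]
      · have : (r - 1) / q = l * c := by
          rw [hi, hc, show l * (q * c) = q * (l * c) by ring, Nat.mul_div_cancel_left _ hq.pos]
        rw [this, pow_mul, hl, pow_orderOf_eq_one, one_pow]
    · right
      push Not at hbig
      have hr0 : (0 : ℝ) < r := by exact_mod_cast hr.pos
      have hlr : 0 < Real.log r := Real.log_pos (by exact_mod_cast hr.one_lt)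
      have hq0 : (0 : ℝ) < q := by exact_mod_cast hq.pos
      have hlq : 0 ≤ Real.log q := Real.log_natCast_nonneg q
      by_cases hql : (q : ℝ) ≤ Real.sqrt r * Real.log r
      · right; left
        refine ⟨q, hq, hqr1, ?_, hql⟩
        have h1 : Real.log q ≤ Real.log r := Real.log_le_log hq0 (by exact_mod_cast (by omega : q ≤ r))
        have h2 : Real.sqrt r ≤ q * Real.log q ^ 2 := by
          apply Real.sqrt_le_iff.mpr
          refine ⟨by positivity, ?_⟩
          have : ((q : ℝ) * Real.log q ^ 2) ^ 2 = (q : ℝ) ^ 2 * (Real.log q) ^ 4 := by ring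
          rw [this]; exact hbig.le
        exact h2.trans (by gcongr)
      · left
        push Not at hql
        have hlq' : l * q ≤ r := by
          have : l * q ≤ l * q * c := Nat.le_mul_of_pos_right _ (by
            apply Nat.pos_of_ne_zero; rintro rfl; apply hi0; rw [hc]; ring)
          have h2 : l * q * c = r - 1 := by rw [hi, hc]; ring
          omega
        have h3 : (l : ℝ) * q ≤ r := by exact_mod_cast hlq'
        have h4 : (l : ℝ) * (Real.sqrt r * Real.log r) ≤ r := by
          refine le_trans ?_ h3
          gcongr
        have hs : 0 < Real.sqrt r := Real.sqrt_pos.mpr hr0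
        have h5 : ((l : ℝ) * Real.log r) * Real.sqrt r ≤ Real.sqrt r * Real.sqrt r := by
          rw [Real.mul_self_sqrt hr0.le]; linarith
        exact le_of_mul_le_mul_right h5 hs
  · push Not at hsm
    right; right; right
    refine ⟨by rw [mul_comm, ← hi]; omega, hpos.ne', ?_, ?_, ?_⟩
    · have : l ≤ l * i := Nat.le_mul_of_pos_right _ (Nat.pos_of_ne_zero hi0)
      omega
    · have : T * l ≤ l * i := by omega
      rw [mul_comm] at this
      exact Nat.le_of_mul_le_mul_left this hpos
    · rw [Nat.mem_smoothNumbers']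
      intro q hq hqi
      have := hsm q hq hqi
      omega

lemma combine (p : ℕ) (hp : p.Prime) (hLP : ∃ C : ℝ, ∀ q : ℕ, q.Prime → Odd q → ∀ X : ℝ, 3 ≤ X →
      (Nat.card {n : ℕ | 0 < n ∧ (n : ℝ) ≤ X ∧ ∃ r : ℕ, r.Prime ∧ r ∣ n ∧
          r % q = 1 ∧ (p : ZMod r) ^ ((r - 1) / q) = 1 ∧
          (q : ℝ) ^ 2 * (Real.log q) ^ 4 ≤ (r : ℝ)} : ℝ) ≤
        C * (X / (q * Real.log q) + X * Real.log (Real.log X) / (q : ℝ) ^ 2)) :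
    ∃ C X0 : ℝ, 0 < C ∧ 3 ≤ X0 ∧ ∀ X : ℝ, X0 ≤ X → 3 ≤ Real.log X → ∀ y T : ℕ, 2 ≤ y → 2 ^ 64 ≤ T → p ≤ T →
      ((2 * T : ℕ) : ℝ) * Real.log X ≤ Real.sqrt X →
      (Nat.card {n : ℕ | 0 < n ∧ (n : ℝ) ≤ X ∧ IsPPractical p n} : ℝ) ≤
        C * X * (Real.log T / Real.log X + 1 / Real.log y + Real.log (Real.log X) / y +
          Real.log (Real.log X) / Real.log T + Real.log X * Real.log y * (T : ℝ) ^ (- dl y)) := by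
  classical
  obtain ⟨C0, X0, hC0, hX0, h0⟩ := lemmaF
  obtain ⟨C1, hC1, h1⟩ := exc1 p hLP
  obtain ⟨C2, hC2, h2⟩ := exc_low p hp
  obtain ⟨C3, hC3, h3⟩ := exc_mid
  obtain ⟨C4, hC4, h4⟩ := exc_smooth
  refine ⟨3 * C0 + C1 + C2 + C3 + 2 * C4, X0, by positivity, hX0, fun X hX hL y T hy hT hpT hTX => ?_⟩
  have hX3 : 3 ≤ X := hX0.trans hX
  have hXpos : 0 < X := by linarith
  have hlL : 1 ≤ Real.log (Real.log X) := by
    rw [Real.le_log_iff_exp_le (by linarith)]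
    have := Real.exp_one_lt_d9
    linarith
  have hT2 : 2 ≤ T := le_trans (by norm_num) hT
  have hlT : 0 < Real.log T := Real.log_pos (by exact_mod_cast hT2)
  have hly : 0 < Real.log y := Real.log_pos (by exact_mod_cast hy)
  set l : ℕ → ℕ := fun r => orderOf (p : ZMod r) with hl
  set i : ℕ → ℕ := fun r => (r - 1) / l r with hi
  set P := (Finset.Icc 1 ⌊X⌋₊).filter (fun n => IsPPractical p n) with hP
  have hPm : ∀ n ∈ P, 0 < n ∧ (n : ℝ) ≤ X ∧ IsPPractical p n := by
    intro n hn
    rw [hP, Finset.mem_filter, Finset.mem_Icc] at hn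
    exact ⟨hn.1.1, (Nat.le_floor_iff hXpos.le).mp hn.1.2, hn.2⟩
  have hcard : Nat.card {n : ℕ | 0 < n ∧ (n : ℝ) ≤ X ∧ IsPPractical p n} = P.card := by
    rw [Nat.card_coe_set_eq, ← Set.ncard_coe_finset P]
    congr 1
    ext n
    simp only [Set.mem_setOf_eq, Finset.mem_coe]
    refine ⟨fun h => ?_, fun h => hPm n h⟩
    rw [hP, Finset.mem_filter, Finset.mem_Icc]
    exact ⟨⟨h.1, Nat.le_floor h.2.1⟩, h.2.2⟩
  rw [hcard]
  set R := (Finset.Icc 1 ⌊X⌋₊).filter (fun r => r.Prime ∧ T < r) with hR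
  have hRm : ∀ r ∈ R, r.Prime ∧ T < r ∧ (r : ℝ) ≤ X := by
    intro r hr
    rw [hR, Finset.mem_filter, Finset.mem_Icc] at hr
    exact ⟨hr.2.1, hr.2.2, (Nat.le_floor_iff hXpos.le).mp hr.1.2⟩
  set Rl := R.filter (fun r => (orderOf (p : ZMod r) : ℝ) * Real.log r ≤ Real.sqrt r) with hRl
  set Rm := R.filter (fun r => ∃ q : ℕ, q.Prime ∧ q ∣ r - 1 ∧ Real.sqrt r ≤ q * Real.log r ^ 2 ∧ (q : ℝ) ≤ Real.sqrt r * Real.log r) with hRm'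
  set Rs := R.filter (fun r => r = 1 + i r * l r ∧ l r ≠ 0 ∧ l r ≤ r ∧ T ≤ i r ∧ i r ∈ Nat.smoothNumbers (y + 1)) with hRs
  set S0 := P.filter (fun n => BT (2 * T) n) with hS0
  set S1 := P.filter (fun n => ∃ q : ℕ, q.Prime ∧ y < q ∧ ∃ r : ℕ, r.Prime ∧ r ∣ n ∧
          r % q = 1 ∧ (p : ZMod r) ^ ((r - 1) / q) = 1 ∧
          (q : ℝ) ^ 2 * (Real.log q) ^ 4 ≤ (r : ℝ)) with hS1
  set S2 := P.filter (fun n => ∃ r ∈ Rl, r ∣ n) with hS2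
  set S3 := P.filter (fun n => ∃ r ∈ Rm, r ∣ n) with hS3
  set S4 := P.filter (fun n => ∃ r ∈ Rs, r ∣ n) with hS4
  have hcov : P ⊆ S0 ∪ (S1 ∪ (S2 ∪ (S3 ∪ S4))) := by
    intro n hn
    obtain ⟨hn0, hnX, hnp⟩ := hPm n hn
    simp only [Finset.mem_union, hS0, hS1, hS2, hS3, hS4, Finset.mem_filter, hn, true_and]
    by_cases hBT : BT (2 * T) n
    · left; exact hBT
    right
    have hex : ∃ r, r.Prime ∧ r ∣ n ∧ T < r ∧ T * orderOf (p : ZMod r) < r := by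
      by_contra hcon
      push Not at hcon
      exact hBT (practical_BT hp hn0.ne' hnp hpT hcon)
    obtain ⟨r, hr, hrn, hTr, hbad⟩ := hex
    have hrR : r ∈ R := by
      rw [hR, Finset.mem_filter, Finset.mem_Icc]
      exact ⟨⟨hr.one_lt.le, (Nat.le_of_dvd hn0 hrn).trans (Nat.le_floor hnX)⟩, hr, hTr⟩
    rcases classify p hp y T r hr hpT hTr hbad with ⟨q, hq, hyq, e1, e2, e3⟩ | h | h | h
    · left; exact ⟨q, hq, hyq, r, hr, hrn, e1, e2, e3⟩
    · right; left
      exact ⟨r, Finset.mem_filter.mpr ⟨hrR, h⟩, hrn⟩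
    · right; right; left
      exact ⟨r, Finset.mem_filter.mpr ⟨hrR, h⟩, hrn⟩
    · right; right; right
      exact ⟨r, Finset.mem_filter.mpr ⟨hrR, h⟩, hrn⟩
  have hsumc : (P.card : ℝ) ≤ S0.card + S1.card + S2.card + S3.card + S4.card := by
    have a0 := Finset.card_le_card hcov
    have a1 := Finset.card_union_le S0 (S1 ∪ (S2 ∪ (S3 ∪ S4)))
    have a2 := Finset.card_union_le S1 (S2 ∪ (S3 ∪ S4))
    have a3 := Finset.card_union_le S2 (S3 ∪ S4)
    have a4 := Finset.card_union_le S3 S4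
    have : P.card ≤ S0.card + S1.card + S2.card + S3.card + S4.card := by omega
    exact_mod_cast this
  have b0 : (S0.card : ℝ) ≤ 3 * C0 * X * (Real.log T / Real.log X) := by
    have := h0 X hX (2 * T) (by omega) hTX S0 (fun n hn => by
      rw [hS0, Finset.mem_filter] at hn
      exact ⟨hn.2, (hPm n hn.1).2.1⟩)
    refine this.trans ?_
    have e1 : 1 + Real.log ((2 * T : ℕ) : ℝ) ≤ 3 * Real.log T := by
      push_cast
      rw [Real.log_mul (by norm_num) (by positivity)]
      have h64 : (2 : ℝ) ≤ Real.log T := by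
        have := log_lower hT
        have := Real.log_two_gt_d9
        push_cast at *
        linarith
      have := Real.log_two_lt_d9
      linarith
    calc C0 * X * (1 + Real.log ((2 * T : ℕ) : ℝ)) / Real.log X ≤ C0 * X * (3 * Real.log T) / Real.log X := by gcongr
      _ = _ := by ring
  have b1 : (S1.card : ℝ) ≤ C1 * X * (1 / Real.log y + Real.log (Real.log X) / y) :=
    h1 y hy X hX3 (by linarith) S1 (fun n hn => by
      rw [hS1, Finset.mem_filter] at hn
      obtain ⟨c1, c2, c3⟩ := hPm n hn.1
      exact ⟨c1, c2, hn.2⟩)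
  have b2 : (S2.card : ℝ) ≤ X * (C2 / Real.log T) := by
    refine (count_mult X hXpos.le S2 Rl (fun n hn => ?_)).trans (mul_le_mul_of_nonneg_left (h2 T hT2 Rl (fun r hr => ?_)) hXpos.le)
    · rw [hS2, Finset.mem_filter] at hn
      obtain ⟨c1, c2, c3⟩ := hPm n hn.1
      exact ⟨c1, c2, hn.2⟩
    · rw [hRl, Finset.mem_filter] at hr
      obtain ⟨c1, c2, c3⟩ := hRm r hr.1
      exact ⟨c1, c2, by omega, hr.2⟩
  have b3 : (S3.card : ℝ) ≤ X * (C3 * Real.log (Real.log X) / Real.log T) := by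
    refine (count_mult X hXpos.le S3 Rm (fun n hn => ?_)).trans (mul_le_mul_of_nonneg_left (h3 T hT X (by linarith) Rm (fun r hr => ?_)) hXpos.le)
    · rw [hS3, Finset.mem_filter] at hn
      obtain ⟨c1, c2, c3⟩ := hPm n hn.1
      exact ⟨c1, c2, hn.2⟩
    · rw [hRm', Finset.mem_filter] at hr
      obtain ⟨c1, c2, c3⟩ := hRm r hr.1
      exact ⟨c1, c2, c3, hr.2⟩
  have b4 : (S4.card : ℝ) ≤ X * (C4 * (1 + Real.log X) * Real.log y * (T : ℝ) ^ (- dl y)) := by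
    refine (count_mult X hXpos.le S4 Rs (fun n hn => ?_)).trans (mul_le_mul_of_nonneg_left (h4 y T hy (by omega) (Real.log X) (by linarith) Rs i l (fun r hr => ?_)) hXpos.le)
    · rw [hS4, Finset.mem_filter] at hn
      obtain ⟨c1, c2, c3⟩ := hPm n hn.1
      exact ⟨c1, c2, hn.2⟩
    · rw [hRs, Finset.mem_filter] at hr
      obtain ⟨c1, c2, c3⟩ := hRm r hr.1
      obtain ⟨d1, d2, d3, d4, d5⟩ := hr.2
      refine ⟨d1, d2, ?_, d4, d5⟩
      have : (l r : ℝ) ≤ X := le_trans (by exact_mod_cast d3) c3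
      exact Real.log_le_log (by exact_mod_cast Nat.pos_of_ne_zero d2) this
  have hTp : 0 < (T : ℝ) ^ (- dl y) := by
    have : (0 : ℝ) < T := by exact_mod_cast (by omega : 0 < T)
    positivity
  have hL0 : 0 < Real.log X := by linarith
  set u1 := Real.log T / Real.log X with hu1
  set u2 := 1 / Real.log y with hu2
  set u3 := Real.log (Real.log X) / y with hu3
  set u4 := Real.log (Real.log X) / Real.log T with hu4
  set u5 := Real.log X * Real.log y * (T : ℝ) ^ (- dl y) with hu5
  have p1 : 0 ≤ X * u1 := by positivity
  have p2 : 0 ≤ X * u2 := by positivity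
  have p3 : 0 ≤ X * u3 := by positivity
  have p4 : 0 ≤ X * u4 := by positivity
  have p5 : 0 ≤ X * u5 := by positivity
  have b2' : (S2.card : ℝ) ≤ C2 * (X * u4) := by
    refine b2.trans ?_
    have : C2 / Real.log T ≤ C2 * u4 := by
      rw [hu4, ← mul_div_assoc]
      gcongr
      exact le_mul_of_one_le_right hC2.le hlL
    calc X * (C2 / Real.log T) ≤ X * (C2 * u4) := by gcongr
      _ = _ := by ring
  have b3' : (S3.card : ℝ) ≤ C3 * (X * u4) := by
    refine b3.trans (le_of_eq ?_)
    rw [hu4]; ring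
  have b4' : (S4.card : ℝ) ≤ 2 * C4 * (X * u5) := by
    refine b4.trans ?_
    calc X * (C4 * (1 + Real.log X) * Real.log y * (T : ℝ) ^ (- dl y))
        ≤ X * (C4 * (2 * Real.log X) * Real.log y * (T : ℝ) ^ (- dl y)) := by gcongr; linarith
      _ = _ := by rw [hu5]; ring
  have b1' : (S1.card : ℝ) ≤ C1 * (X * u2) + C1 * (X * u3) := by
    refine b1.trans (le_of_eq ?_); ring
  have b0' : (S0.card : ℝ) ≤ 3 * C0 * (X * u1) := by
    refine b0.trans (le_of_eq ?_); ring
  set K := 3 * C0 + C1 + C2 + C3 + 2 * C4 with hK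
  have q0 : 3 * C0 * (X * u1) ≤ K * (X * u1) := mul_le_mul_of_nonneg_right (by linarith) p1
  have q1 : C1 * (X * u2) ≤ K * (X * u2) := mul_le_mul_of_nonneg_right (by linarith) p2
  have q2 : C1 * (X * u3) ≤ K * (X * u3) := mul_le_mul_of_nonneg_right (by linarith) p3
  have q3 : (C2 + C3) * (X * u4) ≤ K * (X * u4) := mul_le_mul_of_nonneg_right (by linarith) p4
  have q4 : 2 * C4 * (X * u5) ≤ K * (X * u5) := mul_le_mul_of_nonneg_right (by linarith) p5
  have : K * X * (u1 + u2 + u3 + u4 + u5) = K * (X * u1) + K * (X * u2) + K * (X * u3) + K * (X * u4) + K * (X * u5) := by ring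
  rw [this]
  linarith

end PP

namespace PP

lemma params (p : ℕ) (L a : ℝ) (hL : 300 ≤ L) (ha : a = Real.sqrt (L / Real.log L)) (ha100 : 100 ≤ a)
    (hLp : max 64 (p : ℝ) ≤ Real.sqrt L) :
    ∃ y T : ℕ, 2 ≤ y ∧ 2 ^ 64 ≤ T ∧ p ≤ T ∧ ((2 * T : ℕ) : ℝ) * L ≤ Real.exp (L / 2) ∧
      Real.log T / L + 1 / Real.log y + Real.log L / y +
          Real.log L / Real.log T + L * Real.log y * (T : ℝ) ^ (- dl y) ≤ 30 * (1 / a) := by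
  have hL0 : 0 < L := by linarith
  set u := Real.log L with hu
  have hu1 : 1 ≤ u := by
    rw [hu, Real.le_log_iff_exp_le hL0]
    have := Real.exp_one_lt_d9
    linarith
  have hexpu : Real.exp u = L := Real.exp_log hL0
  have ha0 : 0 < a := by linarith
  have ha2 : a ^ 2 = L / u := by rw [ha, Real.sq_sqrt (by positivity)]
  have hLa : L = a ^ 2 * u := by rw [ha2]; field_simp
  set b := a * u with hb
  have hab : a * b = L := by rw [hb, hLa]; ring
  have hb0 : 0 < b := by positivity
  have hsq : Real.sqrt L ≤ b := by
    apply Real.sqrt_le_iff.mpr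
    refine ⟨hb0.le, ?_⟩
    have : b ^ 2 = L * u := by rw [hb, hLa]; ring
    rw [this]
    exact le_mul_of_one_le_right hL0.le hu1
  have hb64 : 64 ≤ b := (le_max_left _ _).trans (hLp.trans hsq)
  have hbp : (p : ℝ) ≤ b := (le_max_right _ _).trans (hLp.trans hsq)
  have huL : u ≤ L := by
    have := Real.add_one_le_exp u
    linarith
  have hu3a : u ≤ 3 * a := by
    have h := Real.pow_div_factorial_le_exp u (by linarith) 3
    rw [hexpu] at h
    have e : ((Nat.factorial 3 : ℕ) : ℝ) = 6 := by norm_num [Nat.factorial]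
    rw [e, hLa, div_le_iff₀ (by norm_num)] at h
    have h2 : u ^ 2 ≤ 6 * a ^ 2 := by
      have : u ^ 2 * u ≤ (6 * a ^ 2) * u := by linarith [show u ^ 2 * u = u ^ 3 by ring]
      exact le_of_mul_le_mul_right this (by linarith)
    nlinarith
  have hexpa : u * a ≤ Real.exp a := by
    have h := Real.pow_div_factorial_le_exp a (by linarith) 3
    have e : ((Nat.factorial 3 : ℕ) : ℝ) = 6 := by norm_num [Nat.factorial]
    rw [e] at h
    refine le_trans ?_ h
    rw [le_div_iff₀ (by norm_num)]
    have h1 : u * a ≤ 3 * a * a := mul_le_mul_of_nonneg_right hu3a ha0.le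
    have h2 : 18 * (a * a) ≤ a * (a * a) := mul_le_mul_of_nonneg_right (by linarith) (by positivity)
    have h3 : a ^ 3 = a * (a * a) := by ring
    linarith
  -- ceilings
  have hceil : ∀ c : ℝ, 0 ≤ c → Real.exp c ≤ (⌈Real.exp c⌉₊ : ℝ) ∧ c ≤ Real.log (⌈Real.exp c⌉₊ : ℝ) ∧
      Real.log (⌈Real.exp c⌉₊ : ℝ) ≤ c + 1 := by
    intro c hc
    have h1 := Nat.le_ceil (Real.exp c)
    have h2 := Nat.ceil_lt_add_one (Real.exp_pos c).le
    have h3 : 1 ≤ Real.exp c := Real.one_le_exp hc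
    have h4 : (⌈Real.exp c⌉₊ : ℝ) ≤ Real.exp (c + 1) := by
      rw [Real.exp_add]
      have := Real.exp_one_gt_d9
      have h5 : Real.exp c * 2 ≤ Real.exp c * Real.exp 1 := mul_le_mul_of_nonneg_left (by linarith) (by linarith)
      linarith
    refine ⟨h1, ?_, ?_⟩
    · rw [Real.le_log_iff_exp_le (by linarith)]; exact h1
    · rw [Real.log_le_iff_le_exp (by linarith)]; exact h4
  set y := ⌈Real.exp a⌉₊ with hy
  set T := ⌈Real.exp (24 * b)⌉₊ with hT
  obtain ⟨y1, y2, y3⟩ := hceil a ha0.le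
  obtain ⟨t1, t2, t3⟩ := hceil (24 * b) (by linarith)
  rw [← hy] at y1 y2 y3
  rw [← hT] at t1 t2 t3
  have hyr : (2 : ℝ) ≤ y := by
    have := Real.add_one_le_exp a
    linarith
  have hTr : 24 * b + 1 ≤ (T : ℝ) := by
    have := Real.add_one_le_exp (24 * b)
    linarith
  have hT0 : (0 : ℝ) < T := by linarith
  have hy2' : 2 ≤ y := by exact_mod_cast hyr
  have hlT : Real.log T ≤ 25 * b := by linarith
  have hly : Real.log y ≤ 2 * a := by linarith
  refine ⟨y, T, hy2', ?_, ?_, ?_, ?_⟩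
  · have h1 : (2 : ℝ) ^ 64 ≤ T := by
      refine le_trans ?_ t1
      have : (2 : ℝ) ^ 64 ≤ Real.exp 1 ^ 64 := pow_le_pow_left₀ (by norm_num) (by
        have := Real.exp_one_gt_d9
        linarith) 64
      refine this.trans ?_
      rw [← Real.exp_nat_mul]
      apply Real.exp_le_exp.mpr
      push_cast
      linarith
    exact_mod_cast h1
  · have : (p : ℝ) ≤ T := by linarith
    exact_mod_cast this
  · push_cast
    have h1 : (T : ℝ) ≤ Real.exp (25 * b) := by
      rw [← Real.log_le_iff_le_exp hT0]; exact hlT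
    have h2 : (2 : ℝ) ≤ Real.exp 1 := by
      have := Real.exp_one_gt_d9
      linarith
    calc 2 * (T : ℝ) * L ≤ Real.exp 1 * Real.exp (25 * b) * Real.exp u := by rw [hexpu]; gcongr
      _ = Real.exp (1 + 25 * b + u) := by rw [← Real.exp_add, ← Real.exp_add]
      _ ≤ Real.exp (L / 2) := by
          apply Real.exp_le_exp.mpr
          have h3 : 100 * b ≤ L := by
            rw [← hab]; exact mul_le_mul_of_nonneg_right ha100 hb0.le
          have h4 : 100 * u ≤ b := mul_le_mul_of_nonneg_right ha100 (by linarith)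
          linarith
  · have hinv : 0 < 1 / a := by positivity
    have c1 : Real.log T / L ≤ 25 * (1 / a) := by
      rw [div_le_iff₀ hL0, ← hab]
      have : 25 * (1 / a) * (a * b) = 25 * b := by field_simp
      rw [this]; exact hlT
    have c2 : 1 / Real.log y ≤ 1 / a := one_div_le_one_div_of_le ha0 y2
    have c3 : u / y ≤ 1 / a := by
      rw [div_le_div_iff₀ (by linarith) ha0]
      linarith
    have c4 : u / Real.log T ≤ 1 / a := by
      rw [div_le_div_iff₀ (by linarith) ha0]
      have : u * a = b := by rw [hb]; ring
      rw [this]; linarith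
    have hlog0 : 0 < Real.log y := by linarith
    have c5 : L * Real.log y * (T : ℝ) ^ (- dl y) ≤ 2 * (1 / a) := by
      have d1 : 3 * u ≤ dl y * Real.log T := by
        unfold dl
        have e1 : 1 / (4 * (2 * a)) ≤ 1 / (4 * Real.log y) := one_div_le_one_div_of_le (by linarith) (by linarith)
        calc 3 * u = 1 / (4 * (2 * a)) * (24 * b) := by rw [hb]; field_simp; norm_num
          _ ≤ 1 / (4 * Real.log y) * Real.log T := mul_le_mul e1 t2 (by linarith) (by positivity)
      have d2 : (T : ℝ) ^ (- dl y) ≤ (L ^ 3)⁻¹ := by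
        rw [Real.rpow_def_of_pos hT0]
        have : (L ^ 3)⁻¹ = Real.exp (-(3 * u)) := by
          rw [Real.exp_neg, ← hexpu, ← Real.exp_nat_mul]; norm_num
        rw [this]
        apply Real.exp_le_exp.mpr
        linarith
      calc L * Real.log y * (T : ℝ) ^ (- dl y) ≤ L * (2 * a) * (L ^ 3)⁻¹ := by gcongr
        _ = 2 * a / L ^ 2 := by field_simp
        _ ≤ 2 * (1 / a) := by
            rw [div_le_iff₀ (by positivity)]
            have e1 : a ^ 2 ≤ L ^ 2 := by
              have : a ^ 2 ≤ L := by
                rw [hLa]; exact le_mul_of_one_le_right (by positivity) hu1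
              nlinarith
            have e2 : 2 * a = 2 * (1 / a) * a ^ 2 := by field_simp
            rw [e2]
            exact mul_le_mul_of_nonneg_left e1 (by positivity)
    linarith

end PP

theorem stmt0 (p : ℕ) (hp : p.Prime)
    (hLP : ∃ C : ℝ, ∀ q : ℕ, q.Prime → Odd q → ∀ X : ℝ, 3 ≤ X →
      (Nat.card {n : ℕ | 0 < n ∧ (n : ℝ) ≤ X ∧ ∃ r : ℕ, r.Prime ∧ r ∣ n ∧
          r % q = 1 ∧ (p : ZMod r) ^ ((r - 1) / q) = 1 ∧
          (q : ℝ) ^ 2 * (Real.log q) ^ 4 ≤ (r : ℝ)} : ℝ) ≤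
        C * (X / (q * Real.log q) + X * Real.log (Real.log X) / (q : ℝ) ^ 2)) :
    ∃ C' : ℝ, ∀ᶠ X : ℝ in atTop,
      (Nat.card {n : ℕ | 0 < n ∧ (n : ℝ) ≤ X ∧ IsPPractical p n} : ℝ) ≤
        C' * X * Real.sqrt (Real.log (Real.log X) / Real.log X) := by
  obtain ⟨C, X0, hC, hX0, h⟩ := PP.combine p hp hLP
  refine ⟨C * 30, ?_⟩
  have hlog : Tendsto Real.log atTop atTop := Real.tendsto_log_atTop
  have hs : ∀ᶠ L : ℝ in atTop, max 64 (p : ℝ) ≤ Real.sqrt L := by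
    filter_upwards [eventually_ge_atTop ((max 64 (p : ℝ)) ^ 2)] with L hL
    exact Real.le_sqrt_of_sq_le hL
  have hq : ∀ᶠ L : ℝ in atTop, 100 ≤ Real.sqrt (L / Real.log L) := by
    have ho := Real.isLittleO_log_id_atTop.bound (show (0 : ℝ) < 1 / 10000 by norm_num)
    filter_upwards [ho, eventually_ge_atTop (300 : ℝ)] with L hL h300
    have hl : 0 < Real.log L := Real.log_pos (by linarith)
    simp only [id, Real.norm_eq_abs] at hL
    rw [abs_of_pos hl, abs_of_pos (by linarith)] at hL
    apply Real.le_sqrt_of_sq_le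
    rw [le_div_iff₀ hl]
    linarith
  filter_upwards [eventually_ge_atTop X0, hlog.eventually hs, hlog.eventually hq,
    hlog.eventually (eventually_ge_atTop (300 : ℝ))] with X hX h1 h2 h3
  obtain ⟨y, T, hy, hT, hpT, hTX, hbd⟩ := PP.params p (Real.log X) _ h3 rfl h2 h1
  have hXpos : 0 < X := by linarith
  have hsqrt : Real.exp (Real.log X / 2) = Real.sqrt X := by
    rw [Real.exp_half, Real.exp_log hXpos]
  rw [hsqrt] at hTX
  have hfin := h X hX (by linarith) y T hy hT hpT hTX
  refine hfin.trans ?_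
  have e : 1 / Real.sqrt (Real.log X / Real.log (Real.log X)) = Real.sqrt (Real.log (Real.log X) / Real.log X) := by
    rw [one_div, ← Real.sqrt_inv, inv_div]
  rw [e] at hbd
  calc _ ≤ C * X * (30 * Real.sqrt (Real.log (Real.log X) / Real.log X)) :=
        mul_le_mul_of_nonneg_left hbd (by positivity)
    _ = _ := by ring
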